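/- Let f : [0,1] → [0,∞) be Lipschitz with f(0) = f(1) = 0, and let c, θ > 0 and p < 3 be such that f(T) ≥ c T^p for all T ∈ [0,θ]. Then u is not quenching; in fact, for every A ∈ ℝ and every initial datum T₀ : ℝ^{1+m} → [0,1] that is h-periodic in the last m coordinates, compactly supported in x, and not identically zero, no classical solution of T_t + A u(y) T_x = ΔT + M f(T) with initial datum T₀ quenches. -/

import Mathlib

open MeasureTheory
open scoped BigOperators

noncomputable section

/-- Partial derivative of `g : ℝ^N → ℝ` in the `i`-th coordinate direction. -/
def pd {N : ℕ} (i : Fin N) (g : (Fin N → ℝ) → ℝ) (z : Fin N → ℝ) : ℝ :=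
  fderiv ℝ g z (Pi.single i 1)

/-- Laplacian of `g : ℝ^N → ℝ`. -/
def lap {N : ℕ} (g : (Fin N → ℝ) → ℝ) (z : Fin N → ℝ) : ℝ :=
  ∑ i, pd i (pd i g) z

/-- A classical solution of `T_t + A u(y) T_x = ΔT + M f(T)` on the cylinder `ℝ×[0,h]^m`,
viewed as a `[0,1]`-valued function on `ℝ^{1+m}` (coordinate `0` is `x`, the remaining `m`
coordinates are `y`), `h`-periodic in each of the last `m` spatial coordinates,
continuous on `[0,∞)×ℝ^{1+m}`, `C¹` in `t` and `C²` in the spatial variables for `t > 0`,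
satisfying the equation pointwise for `t > 0` and `T(0,·) = T₀`. -/
structure IsShearSol (m : ℕ) (h M A : ℝ) (u : (Fin m → ℝ) → ℝ)
    (f : ℝ → ℝ) (T0 : (Fin (m+1) → ℝ) → ℝ) (T : ℝ → (Fin (m+1) → ℝ) → ℝ) : Prop where
  cont : ContinuousOn (fun p : ℝ × (Fin (m+1) → ℝ) => T p.1 p.2) {p | 0 ≤ p.1}
  mem_Icc : ∀ t z, 0 ≤ t → T t z ∈ Set.Icc (0:ℝ) 1
  periodic : ∀ t z, 0 ≤ t → ∀ j : Fin m, T t (z + Pi.single j.succ h) = T t z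
  timeDiff : ∀ t z, 0 < t → DifferentiableAt ℝ (fun s => T s z) t
  spaceC2 : ∀ t, 0 < t → ContDiff ℝ 2 (T t)
  eqn : ∀ t z, 0 < t →
    deriv (fun s => T s z) t + A * u (fun j => z j.succ) * pd 0 (T t) z
      = lap (T t) z + M * f (T t z)
  init : ∀ z, T 0 z = T0 z

/-- Admissible initial data: `[0,1]`-valued, `h`-periodic in the last `m` coordinates,
and compactly supported in `x`. -/
def AdmissibleIC (m : ℕ) (h : ℝ) (T0 : (Fin (m+1) → ℝ) → ℝ) : Prop :=
  (∀ z, T0 z ∈ Set.Icc (0:ℝ) 1) ∧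
  (∀ z, ∀ j : Fin m, T0 (z + Pi.single j.succ h) = T0 z) ∧
  (∃ L : ℝ, ∀ z, L ≤ |z 0| → T0 z = 0)

/-- `T` quenches: `lim_{t→∞} sup_{(x,y)} T(t,x,y) = 0` (for nonnegative `T`). -/
def CylQuenches (m : ℕ) (T : ℝ → (Fin (m+1) → ℝ) → ℝ) : Prop :=
  ∀ ε > (0:ℝ), ∃ t₀ : ℝ, ∀ t ≥ t₀, ∀ z, T t z ≤ ε

/-- The shear profile `u` is quenching: for every admissible initial datum there is `A₀`
such that for all `|A| ≥ A₀` every classical solution quenches. -/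
def IsQuenchingProfile (m : ℕ) (h M : ℝ) (u : (Fin m → ℝ) → ℝ) (f : ℝ → ℝ) : Prop :=
  ∀ T0 : (Fin (m+1) → ℝ) → ℝ, AdmissibleIC m h T0 →
    ∃ A₀ : ℝ, ∀ A : ℝ, A₀ ≤ |A| →
      ∀ T : ℝ → (Fin (m+1) → ℝ) → ℝ, IsShearSol m h M A u f T0 T → CylQuenches m T

/-- A plateau of the (h-periodic) profile `u`: a nonempty open connected subset of the
torus `(h𝕋)^m` on which `u` is constant. -/
def IsPlateau (m : ℕ) (h : ℝ) (u : (Fin m → ℝ) → ℝ)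
    (P : Set (Fin m → AddCircle h)) : Prop :=
  P.Nonempty ∧ IsOpen P ∧ IsConnected P ∧
    ∃ v : ℝ, ∀ y : Fin m → ℝ, (fun j => (y j : AddCircle h)) ∈ P → u y = v

/-- The (Euclidean-distance) ball of radius `R` about `q₀` in the torus `(h𝕋)^m`. -/
def torusBall (m : ℕ) (h : ℝ) (q₀ : Fin m → AddCircle h) (R : ℝ) :
    Set (Fin m → AddCircle h) :=
  {q | Real.sqrt (∑ j, (dist (q j) (q₀ j))^2) < R}

section PartialDerivatives

variable {N : ℕ}

theorem HasFDerivAt.pd_eq {g : (Fin N → ℝ) → ℝ} {L : (Fin N → ℝ) →L[ℝ] ℝ} {z : Fin N → ℝ}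
    (hg : HasFDerivAt g L z) (i : Fin N) : pd i g z = L (Pi.single i 1) := by
  rw [pd, hg.fderiv]

theorem hasDerivAt_line {g : (Fin N → ℝ) → ℝ} (i : Fin N) (z : Fin N → ℝ) (r : ℝ)
    (hg : DifferentiableAt ℝ g (z + r • Pi.single i 1)) :
    HasDerivAt (fun s : ℝ => g (z + s • Pi.single i 1)) (pd i g (z + r • Pi.single i 1)) r := by
  have h1 : HasDerivAt (fun s : ℝ => z + s • (Pi.single i 1 : Fin N → ℝ)) (Pi.single i 1) r := by
    simpa using ((hasDerivAt_id r).smul_const (Pi.single i 1 : Fin N → ℝ)).const_add z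
  exact hg.hasFDerivAt.comp_hasDerivAt r h1

theorem contDiff_pd {g : (Fin N → ℝ) → ℝ} (hg : ContDiff ℝ 2 g) (i : Fin N) :
    ContDiff ℝ 1 (pd i g) := by
  unfold pd
  exact (hg.fderiv_right (m := 1) (by norm_num)).clm_apply contDiff_const

/-- First and second order necessary conditions at a global maximum on the line. -/
theorem deriv_eq_zero_and_second_deriv_nonpos_of_max {φ φ' : ℝ → ℝ} {c : ℝ}
    (hφ : ∀ r, HasDerivAt φ (φ' r) r) (hφ' : HasDerivAt φ' c 0) (hmax : ∀ r, φ r ≤ φ 0) :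
    φ' 0 = 0 ∧ c ≤ 0 := by
  have hloc : IsLocalMax φ 0 := Filter.Eventually.of_forall hmax
  have h0 : φ' 0 = 0 := hloc.hasDerivAt_eq_zero (hφ 0)
  refine ⟨h0, ?_⟩
  by_contra! hc
  have hd : deriv φ = φ' := funext fun r => (hφ r).deriv
  have hmin : IsLocalMin φ 0 := by
    refine isLocalMin_of_deriv_deriv_pos ?_ ?_ (hφ 0).continuousAt
    · rwa [hd, hφ'.deriv]
    · rwa [hd]
  have heq : φ =ᶠ[nhds 0] fun _ => φ 0 := by
    filter_upwards [hmin] with r hr using le_antisymm (hmax r) hr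
  have h2 : deriv φ =ᶠ[nhds 0] fun _ => 0 := by
    refine heq.deriv.trans ?_
    simp
  have h3 := h2.deriv_eq
  rw [hd, hφ'.deriv] at h3
  simp at h3
  exact hc.ne' h3

theorem hasDerivAt_sum_sq_line (i : Fin N) (z : Fin N → ℝ) (r : ℝ) :
    HasDerivAt (fun s : ℝ => ∑ j, (z + s • (Pi.single i 1 : Fin N → ℝ)) j ^ 2) (2 * (z i + r)) r := by
  have h : ∀ s : ℝ, ∑ j, (z + s • (Pi.single i 1 : Fin N → ℝ)) j ^ 2
      = ∑ j, z j ^ 2 + 2 * s * z i + s ^ 2 := by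
    intro s
    have : ∀ j, (z + s • (Pi.single i 1 : Fin N → ℝ)) j ^ 2
        = z j ^ 2 + (if j = i then 2 * s * z i + s ^ 2 else 0) := by
      intro j
      by_cases hj : j = i
      · subst hj; simp; ring
      · simp [hj]
    rw [Finset.sum_congr rfl fun j _ => this j, Finset.sum_add_distrib]
    simp
    ring
  simp_rw [h]
  have := (((hasDerivAt_id r).const_mul 2).mul_const (z i)).const_add (∑ j, z j ^ 2)
  refine (this.add (hasDerivAt_pow 2 r)).congr_deriv ?_
  simp
  ring

theorem norm_sq_le_sum_sq (z : Fin N → ℝ) : ‖z‖ ^ 2 ≤ ∑ j, z j ^ 2 := by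
  have h : ‖z‖ ≤ Real.sqrt (∑ j, z j ^ 2) := by
    refine (pi_norm_le_iff_of_nonneg (Real.sqrt_nonneg _)).2 fun i => ?_
    rw [Real.norm_eq_abs]
    refine Real.abs_le_sqrt ?_
    exact Finset.single_le_sum (f := fun j => z j ^ 2) (fun j _ => sq_nonneg (z j)) (Finset.mem_univ i)
  calc ‖z‖ ^ 2 ≤ Real.sqrt (∑ j, z j ^ 2) ^ 2 := by gcongr
    _ = _ := Real.sq_sqrt (Finset.sum_nonneg fun j _ => sq_nonneg (z j))

end PartialDerivatives

/-- Maximum principle on the whole space for functions bounded above, where the differential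
inequality is only required at points where the function is positive. -/
theorem parabolic_max_principle {m : ℕ} {w : ℝ → (Fin (m+1) → ℝ) → ℝ} {b : (Fin (m+1) → ℝ) → ℝ}
    {β t₀ t₁ B : ℝ} (hb : ∀ z, |b z| ≤ β)
    (hcont : ContinuousOn (fun p : ℝ × (Fin (m+1) → ℝ) => w p.1 p.2) (Set.Icc t₀ t₁ ×ˢ Set.univ))
    (hB : ∀ t ∈ Set.Icc t₀ t₁, ∀ z, w t z ≤ B) (h0 : ∀ z, w t₀ z ≤ 0)
    (hd : ∀ t ∈ Set.Ioc t₀ t₁, ∀ z, DifferentiableAt ℝ (fun s => w s z) t)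
    (hC : ∀ t ∈ Set.Ioc t₀ t₁, ContDiff ℝ 2 (w t))
    (hL : ∀ t ∈ Set.Ioc t₀ t₁, ∀ z, 0 < w t z →
      deriv (fun s => w s z) t + b z * pd 0 (w t) z ≤ lap (w t) z) :
    ∀ t ∈ Set.Icc t₀ t₁, ∀ z, w t z ≤ 0 := by
  intro ts hts zs
  by_contra! hpos
  have hβ : 0 ≤ β := (abs_nonneg _).trans (hb 0)
  set l : ℝ := β + 2 * (m + 1) + 1 with hl
  have hlpos : 0 < l := by positivity
  set g : ℝ → (Fin (m+1) → ℝ) → ℝ := fun t z => Real.exp (l * t) * (1 + ∑ j, z j ^ 2) with hg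
  have hS : ∀ z : Fin (m+1) → ℝ, 0 ≤ ∑ j, z j ^ 2 :=
    fun z => Finset.sum_nonneg fun j _ => sq_nonneg (z j)
  have hgpos : ∀ t z, 0 < g t z := fun t z => by
    have := hS z; simp only [hg]; positivity
  set ε : ℝ := w ts zs / (2 * g ts zs) with hε
  have hεpos : 0 < ε := by have := hgpos ts zs; positivity
  set v : ℝ → (Fin (m+1) → ℝ) → ℝ := fun t z => w t z - ε * g t z with hv
  have hvs : 0 < v ts zs := by
    have := hgpos ts zs
    have h2 : ε * g ts zs = w ts zs / 2 := by rw [hε]; field_simp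
    simp only [hv, h2]; linarith
  obtain ⟨R, hR1, hR2⟩ : ∃ R : ℝ, ‖zs‖ ≤ R ∧ B ≤ ε * Real.exp (l * t₀) * R ^ 2 := by
    set q := |B| / (ε * Real.exp (l * t₀)) + 1
    have hq : 1 ≤ q := by simp only [q, le_add_iff_nonneg_left]; positivity
    refine ⟨max ‖zs‖ q, le_max_left _ _, ?_⟩
    have h1 : q ≤ (max ‖zs‖ q) ^ 2 := by
      have : q ≤ max ‖zs‖ q := le_max_right _ _
      nlinarith
    have h2 : B ≤ ε * Real.exp (l * t₀) * q := by
      have : ε * Real.exp (l * t₀) * q = |B| + ε * Real.exp (l * t₀) := by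
        simp only [q]; field_simp
      rw [this]
      have := le_abs_self B
      have : 0 < ε * Real.exp (l * t₀) := by positivity
      linarith
    exact h2.trans (by gcongr)
  have hout : ∀ t ∈ Set.Icc t₀ t₁, ∀ z, R ≤ ‖z‖ → v t z ≤ 0 := by
    intro t ht z hz
    have h1 := hB t ht z
    have h2 : Real.exp (l * t₀) ≤ Real.exp (l * t) := Real.exp_le_exp.2 (by nlinarith [ht.1])
    have hR0 : 0 ≤ R := (norm_nonneg _).trans hR1
    have h3 : R ^ 2 ≤ 1 + ∑ j, z j ^ 2 := by
      have := norm_sq_le_sum_sq z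
      nlinarith
    have h4 : ε * Real.exp (l * t₀) * R ^ 2 ≤ ε * g t z := by
      simp only [hg]
      rw [mul_assoc]
      gcongr
    simp only [hv]; linarith
  have hgc : Continuous fun p : ℝ × (Fin (m+1) → ℝ) => g p.1 p.2 := by
    simp only [hg]; fun_prop
  have hvc : ContinuousOn (fun p : ℝ × (Fin (m+1) → ℝ) => v p.1 p.2)
      (Set.Icc t₀ t₁ ×ˢ Metric.closedBall 0 R) := by
    simp only [hv]
    exact (hcont.mono (Set.prod_mono_right (Set.subset_univ _))).sub
      (hgc.continuousOn.const_mul ε |>.congr fun _ _ => rfl)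
  obtain ⟨⟨t, z⟩, ⟨htm, hzm⟩, hmax⟩ := (isCompact_Icc.prod (isCompact_closedBall _ _)).exists_isMaxOn
    ⟨(ts, zs), hts, by simpa using hR1⟩ hvc
  have hvpos : 0 < v t z :=
    hvs.trans_le (hmax (show (ts, zs) ∈ _ from ⟨hts, by simpa using hR1⟩))
  have hglob : ∀ s ∈ Set.Icc t₀ t₁, ∀ y, v s y ≤ v t z := by
    intro s hs y
    by_cases hy : ‖y‖ ≤ R
    · exact hmax (show (s, y) ∈ _ from ⟨hs, by simpa using hy⟩)
    · exact (hout s hs y (le_of_not_ge hy)).trans hvpos.le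
  have hwpos : 0 < w t z := by
    have := hgpos t z
    have : 0 < ε * g t z := by positivity
    simp only [hv] at hvpos; linarith
  have htm' : t ∈ Set.Ioc t₀ t₁ := by
    refine ⟨lt_of_le_of_ne htm.1 ?_, htm.2⟩
    rintro rfl
    exact absurd (h0 z) (not_le.2 hwpos)
  have hdt : ε * (l * g t z) ≤ deriv (fun s => w s z) t := by
    have h1 : HasDerivAt (fun s => v s z) (deriv (fun s => w s z) t - ε * (l * g t z)) t := by
      have h2 : HasDerivAt (fun s => g s z) (l * g t z) t := by
        have := (((hasDerivAt_id t).const_mul l).exp).mul_const (1 + ∑ j, z j ^ 2)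
        refine this.congr_deriv ?_
        simp [hg]; ring
      exact (hd t htm' z).hasDerivAt.sub (h2.const_mul ε)
    have h3 : 0 ≤ deriv (fun s => w s z) t - ε * (l * g t z) := by
      have hlim := h1.hasDerivWithinAt (s := Set.Iio t)
      rw [hasDerivWithinAt_iff_tendsto_slope' (by simp)] at hlim
      refine ge_of_tendsto hlim ?_
      filter_upwards [Ioo_mem_nhdsLT htm'.1] with s hs
      rw [slope_def_field]
      refine div_nonneg_of_nonpos ?_ (by linarith [hs.2])
      linarith [hglob s ⟨hs.1.le, hs.2.le.trans htm.2⟩ z]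
    linarith
  have hsp : ∀ i, pd i (w t) z = 2 * (ε * Real.exp (l * t)) * z i ∧
      pd i (pd i (w t)) z ≤ 2 * (ε * Real.exp (l * t)) := by
    intro i
    have hC2 := hC t htm'
    have hφ : ∀ r, HasDerivAt (fun s : ℝ => v t (z + s • Pi.single i 1))
        (pd i (w t) (z + r • Pi.single i 1) - ε * Real.exp (l * t) * (2 * (z i + r))) r := by
      intro r
      have h1 := hasDerivAt_line i z r (hC2.differentiable (by norm_num)).differentiableAt
      have h2 := ((hasDerivAt_sum_sq_line i z r).const_add 1).const_mul (ε * Real.exp (l * t))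
      refine (h1.sub h2).congr_of_eventuallyEq (Filter.Eventually.of_forall fun s => ?_)
      simp only [hv, hg, Pi.sub_apply]; ring
    have hφ' : HasDerivAt (fun r : ℝ => pd i (w t) (z + r • Pi.single i 1)
        - ε * Real.exp (l * t) * (2 * (z i + r)))
        (pd i (pd i (w t)) z - ε * Real.exp (l * t) * 2) 0 := by
      have h1 := hasDerivAt_line i z 0
        ((contDiff_pd hC2 i).differentiable (by norm_num)).differentiableAt
      have h2 := (((hasDerivAt_id (0:ℝ)).const_add (z i)).const_mul 2).const_mul
        (ε * Real.exp (l * t))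
      refine (h1.sub h2).congr_deriv ?_
      simp
    obtain ⟨ha, hb'⟩ := deriv_eq_zero_and_second_deriv_nonpos_of_max hφ hφ' (fun r => by
      simpa using hglob t htm (z + r • Pi.single i 1))
    simp only [zero_smul, add_zero] at ha
    constructor <;> linarith
  have hlap : lap (w t) z ≤ (m + 1) * (2 * (ε * Real.exp (l * t))) := by
    unfold lap
    refine (Finset.sum_le_card_nsmul _ _ _ fun i _ => (hsp i).2).trans ?_
    simp
  have hfin := hL t htm' z hwpos
  rw [(hsp 0).1] at hfin
  set e := ε * Real.exp (l * t) with he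
  have hepos : 0 < e := by positivity
  have hz0 : z 0 ^ 2 ≤ ∑ j, z j ^ 2 :=
    Finset.single_le_sum (f := fun j => z j ^ 2) (fun j _ => sq_nonneg (z j)) (Finset.mem_univ 0)
  have hgt : ε * (l * g t z) = e * (l * (1 + ∑ j, z j ^ 2)) := by
    simp only [hg, he]; ring
  rw [hgt] at hdt
  have hbz : -(e * (β * (1 + ∑ j, z j ^ 2))) ≤ b z * (2 * e * z 0) := by
    have h1 : |b z * (2 * z 0)| ≤ β * (1 + ∑ j, z j ^ 2) := by
      rw [abs_mul]
      refine mul_le_mul (hb z) ?_ (abs_nonneg _) hβ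
      rw [abs_le]
      constructor <;> nlinarith [sq_nonneg (z 0 + 1), sq_nonneg (z 0 - 1)]
    have h2 := (abs_le.1 h1).1
    nlinarith
  have : 0 < e * ((l - β) * (1 + ∑ j, z j ^ 2) - 2 * (m + 1)) := by
    refine mul_pos hepos ?_
    have : l - β = 2 * (m + 1) + 1 := by simp only [hl]; ring
    rw [this]
    have h5 : (0:ℝ) ≤ m := Nat.cast_nonneg m
    nlinarith [hS z]
  nlinarith

section RapidKernels

variable {N : ℕ}

/-- The linear functional with given partial derivatives. -/
def gradCLM (a : Fin N → ℝ) : (Fin N → ℝ) →L[ℝ] ℝ :=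
  ∑ j, a j • ContinuousLinearMap.proj (R := ℝ) (φ := fun _ : Fin N => ℝ) j

theorem gradCLM_apply (a v : Fin N → ℝ) : gradCLM a v = ∑ j, a j * v j := by
  simp [gradCLM]

theorem gradCLM_single (a : Fin N → ℝ) (i : Fin N) : gradCLM a (Pi.single i 1) = a i := by
  simp [gradCLM_apply, Pi.single_apply]

theorem norm_gradCLM_le (a : Fin N → ℝ) : ‖gradCLM a‖ ≤ ∑ j, |a j| := by
  refine ContinuousLinearMap.opNorm_le_bound _ (by positivity) fun v => ?_
  rw [gradCLM_apply, Finset.sum_mul]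
  refine (norm_sum_le _ _).trans (Finset.sum_le_sum fun j _ => ?_)
  rw [norm_mul, Real.norm_eq_abs]
  exact mul_le_mul_of_nonneg_left (norm_le_pi_norm v j) (abs_nonneg _)

theorem continuous_gradCLM : Continuous (gradCLM : (Fin N → ℝ) → _) := by
  unfold gradCLM
  fun_prop

theorem gradCLM_integral {α : Type*} [MeasurableSpace α] {μ : Measure α} {F : α → Fin N → ℝ}
    (hF : ∀ j, Integrable (fun x => F x j) μ) :
    ∫ x, gradCLM (F x) ∂μ = gradCLM fun j => ∫ x, F x j ∂μ := by
  unfold gradCLM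
  rw [integral_finsetSum _ fun j _ => (hF j).smul_const _]
  exact Finset.sum_congr rfl fun j _ => integral_smul_const _ _

theorem contDiff_succ_of_hasFDerivAt_gradCLM {g : (Fin N → ℝ) → ℝ} {G : Fin N → (Fin N → ℝ) → ℝ}
    {n : ℕ} (hg : ∀ z, HasFDerivAt g (gradCLM fun i => G i z) z) (hG : ∀ i, ContDiff ℝ n (G i)) :
    ContDiff ℝ (n + 1) g := by
  refine contDiff_succ_iff_hasFDerivAt.2 ⟨_, ?_, hg⟩
  unfold gradCLM
  exact ContDiff.sum fun i _ => (hG i).smul contDiff_const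

/-- A continuous kernel decaying faster than every power. -/
structure IsRapidKernel (k : (Fin N → ℝ) → ℝ) : Prop where
  cont : Continuous k
  decay : ∀ n : ℕ, ∃ C, ∀ ξ, |k ξ| * (1 + ‖ξ‖) ^ n ≤ C

namespace IsRapidKernel

variable {k l : (Fin N → ℝ) → ℝ}

theorem add (hk : IsRapidKernel k) (hl : IsRapidKernel l) :
    IsRapidKernel fun ξ => k ξ + l ξ := by
  refine ⟨hk.cont.add hl.cont, fun n => ?_⟩
  obtain ⟨C, hC⟩ := hk.decay n
  obtain ⟨D, hD⟩ := hl.decay n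
  refine ⟨C + D, fun ξ => ?_⟩
  have : |k ξ + l ξ| * (1 + ‖ξ‖) ^ n ≤ (|k ξ| + |l ξ|) * (1 + ‖ξ‖) ^ n := by
    gcongr; exact abs_add_le _ _
  linarith [hC ξ, hD ξ]

theorem const_mul (hk : IsRapidKernel k) (c : ℝ) : IsRapidKernel fun ξ => c * k ξ := by
  refine ⟨hk.cont.const_mul c, fun n => ?_⟩
  obtain ⟨C, hC⟩ := hk.decay n
  refine ⟨|c| * C, fun ξ => ?_⟩
  rw [abs_mul, mul_assoc]
  exact mul_le_mul_of_nonneg_left (hC ξ) (abs_nonneg _)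

theorem coord_mul (hk : IsRapidKernel k) (i : Fin N) : IsRapidKernel fun ξ => ξ i * k ξ := by
  refine ⟨(continuous_apply i).mul hk.cont, fun n => ?_⟩
  obtain ⟨C, hC⟩ := hk.decay (n + 1)
  refine ⟨C, fun ξ => (le_trans ?_ (hC ξ))⟩
  have h1 : |ξ i| ≤ 1 + ‖ξ‖ := (norm_le_pi_norm ξ i).trans (by linarith)
  calc |ξ i * k ξ| * (1 + ‖ξ‖) ^ n = |ξ i| * (|k ξ| * (1 + ‖ξ‖) ^ n) := by rw [abs_mul]; ring
    _ ≤ (1 + ‖ξ‖) * (|k ξ| * (1 + ‖ξ‖) ^ n) := by gcongr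
    _ = _ := by ring

theorem zero : IsRapidKernel (fun _ : Fin N → ℝ => (0 : ℝ)) :=
  ⟨continuous_const, fun n => ⟨0, fun ξ => by simp⟩⟩

theorem sum {ι : Type*} {s : Finset ι} {k : ι → (Fin N → ℝ) → ℝ}
    (hk : ∀ i ∈ s, IsRapidKernel (k i)) : IsRapidKernel fun ξ => ∑ i ∈ s, k i ξ := by
  classical
  induction s using Finset.induction_on with
  | empty => simpa using zero
  | insert a s ha ih =>
    simp only [Finset.sum_insert ha]
    exact (hk a (Finset.mem_insert_self _ _)).add
      (ih fun i hi => hk i (Finset.mem_insert_of_mem hi))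

theorem exists_le (hk : IsRapidKernel k) (n : ℕ) :
    ∃ C, 0 ≤ C ∧ ∀ ξ, |k ξ| ≤ C * ((1 + ‖ξ‖) ^ n)⁻¹ := by
  obtain ⟨C, hC⟩ := hk.decay n
  have hpos : ∀ ξ : Fin N → ℝ, 0 < (1 + ‖ξ‖) ^ n := fun ξ => by positivity
  refine ⟨C, le_trans (by positivity) (hC 0), fun ξ => ?_⟩
  rw [← div_eq_mul_inv, le_div_iff₀ (hpos ξ)]
  exact hC ξ

theorem integrable_inv_pow : Integrable fun ξ : Fin N → ℝ => ((1 + ‖ξ‖) ^ (N + 1))⁻¹ := by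
  have := integrable_one_add_norm (E := Fin N → ℝ) (μ := volume) (r := N + 1) (by simp)
  refine this.congr (Filter.Eventually.of_forall fun ξ => ?_)
  have h : (0 : ℝ) ≤ 1 + ‖ξ‖ := by positivity
  simp only
  rw [Real.rpow_neg h, ← Nat.cast_succ, Real.rpow_natCast]

theorem integrable (hk : IsRapidKernel k) : Integrable k := by
  obtain ⟨C, -, hC⟩ := hk.exists_le (N + 1)
  exact (integrable_inv_pow.const_mul C).mono' hk.cont.aestronglyMeasurable
    (Filter.Eventually.of_forall hC)

theorem integrable_abs_mul_norm (hk : IsRapidKernel k) : Integrable fun ξ => |k ξ| * ‖ξ‖ := by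
  obtain ⟨C, -, hC⟩ := hk.exists_le (N + 2)
  refine (integrable_inv_pow.const_mul C).mono'
    (hk.cont.abs.mul continuous_norm).aestronglyMeasurable (Filter.Eventually.of_forall fun ξ => ?_)
  have h : (0 : ℝ) < 1 + ‖ξ‖ := by positivity
  rw [Real.norm_eq_abs, abs_mul, abs_abs, abs_norm]
  calc |k ξ| * ‖ξ‖ ≤ C * ((1 + ‖ξ‖) ^ (N + 2))⁻¹ * (1 + ‖ξ‖) := by
        gcongr
        · exact (abs_nonneg _).trans (hC ξ)
        · exact hC ξ
        · linarith
    _ = _ := by rw [pow_succ]; field_simp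

end IsRapidKernel

/-- Rescaled convolution `∫ k(ξ) g(z + √τ ξ) dξ`. -/
def scaledConv (k : (Fin N → ℝ) → ℝ) (τ : ℝ) (g : (Fin N → ℝ) → ℝ) (z : Fin N → ℝ) : ℝ :=
  ∫ ξ, k ξ * g (z + Real.sqrt τ • ξ)

section ScaledConv

variable {k : (Fin N → ℝ) → ℝ} {g : (Fin N → ℝ) → ℝ} {B L τ : ℝ}

theorem integrable_scaledConv (hk : IsRapidKernel k) (hg : Continuous g) (hB : ∀ z, |g z| ≤ B)
    (τ : ℝ) (z : Fin N → ℝ) : Integrable fun ξ => k ξ * g (z + Real.sqrt τ • ξ) :=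
  hk.integrable.mul_bdd (c := B) (by fun_prop) (Filter.Eventually.of_forall fun ξ => hB _)

theorem abs_scaledConv_le (hk : IsRapidKernel k) (hB : ∀ z, |g z| ≤ B) (τ : ℝ) (z : Fin N → ℝ) :
    |scaledConv k τ g z| ≤ (∫ ξ, |k ξ|) * B := by
  rw [← integral_mul_const]
  rw [← Real.norm_eq_abs]
  refine norm_integral_le_of_norm_le (hk.integrable.abs.mul_const B)
    (Filter.Eventually.of_forall fun ξ => ?_)
  rw [norm_mul]
  exact mul_le_mul_of_nonneg_left (hB _) (norm_nonneg _)

theorem scaledConv_sub {g' : (Fin N → ℝ) → ℝ} {B' : ℝ} (hk : IsRapidKernel k) (hg : Continuous g)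
    (hB : ∀ z, |g z| ≤ B) (hg' : Continuous g') (hB' : ∀ z, |g' z| ≤ B') (τ : ℝ) (z : Fin N → ℝ) :
    scaledConv k τ (fun z => g z - g' z) z = scaledConv k τ g z - scaledConv k τ g' z := by
  unfold scaledConv
  rw [← integral_sub (integrable_scaledConv hk hg hB τ z) (integrable_scaledConv hk hg' hB' τ z)]
  simp only [mul_sub]

theorem scaledConv_const (k : (Fin N → ℝ) → ℝ) (c τ : ℝ) (z : Fin N → ℝ) :
    scaledConv k τ (fun _ => c) z = (∫ ξ, k ξ) * c :=
  integral_mul_const _ _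

theorem scaledConv_of_nonpos (hτ : τ ≤ 0) (z : Fin N → ℝ) :
    scaledConv k τ g z = (∫ ξ, k ξ) * g z := by
  simp only [scaledConv, Real.sqrt_eq_zero_of_nonpos hτ, zero_smul, add_zero]
  exact integral_mul_const _ _

theorem scaledConv_periodic {v : Fin N → ℝ} (hv : ∀ z, g (z + v) = g z) (z : Fin N → ℝ) :
    scaledConv k τ g (z + v) = scaledConv k τ g z := by
  unfold scaledConv
  congr 1
  ext ξ
  rw [add_right_comm, hv]

/-- Kernels with zero mean gain a factor `√τ` on Lipschitz functions. -/
theorem abs_scaledConv_le_sqrt (hk : IsRapidKernel k) (h0 : ∫ ξ, k ξ = 0) (hg : Continuous g)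
    (hB : ∀ z, |g z| ≤ B) (hL : ∀ z z', |g z - g z'| ≤ L * ‖z - z'‖) (τ : ℝ) (z : Fin N → ℝ) :
    |scaledConv k τ g z| ≤ (∫ ξ, |k ξ| * ‖ξ‖) * (Real.sqrt τ * L) := by
  have h1 : scaledConv k τ g z = ∫ ξ, k ξ * (g (z + Real.sqrt τ • ξ) - g z) := by
    simp only [mul_sub]
    rw [integral_sub (integrable_scaledConv hk hg hB τ z) (hk.integrable.mul_const _),
      integral_mul_const, h0]
    simp [scaledConv]
  rw [h1, ← integral_mul_const]
  rw [← Real.norm_eq_abs]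
  refine norm_integral_le_of_norm_le (hk.integrable_abs_mul_norm.mul_const _)
    (Filter.Eventually.of_forall fun ξ => ?_)
  rw [norm_mul]
  have := hL (z + Real.sqrt τ • ξ) z
  rw [add_sub_cancel_left, norm_smul, Real.norm_of_nonneg (Real.sqrt_nonneg _)] at this
  calc ‖k ξ‖ * ‖g (z + Real.sqrt τ • ξ) - g z‖ ≤ |k ξ| * (L * (Real.sqrt τ * ‖ξ‖)) :=
        mul_le_mul_of_nonneg_left this (norm_nonneg _)
    _ = _ := by ring

theorem continuous_scaledConv {X : Type*} [TopologicalSpace X] [FirstCountableTopology X]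
    (hk : IsRapidKernel k) {F : X → (Fin N → ℝ) → ℝ} {β : X → ℝ}
    (hF : Continuous fun p : X × (Fin N → ℝ) => F p.1 p.2) (hβ : Continuous β)
    (hFβ : ∀ s z, |F s z| ≤ β s) :
    Continuous fun p : ℝ × X × (Fin N → ℝ) => scaledConv k p.1 (F p.2.1) p.2.2 := by
  refine continuous_iff_continuousAt.2 fun p₀ => ?_
  refine continuousAt_of_dominated (bound := fun ξ => |k ξ| * (β p₀.2.1 + 1))
    (Filter.Eventually.of_forall fun p => ?_) ?_ (hk.integrable.abs.mul_const _)
    (Filter.Eventually.of_forall fun ξ => ?_)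
  · have : Continuous fun ξ => F p.2.1 (p.2.2 + Real.sqrt p.1 • ξ) :=
      hF.comp (by fun_prop : Continuous fun ξ => (p.2.1, p.2.2 + Real.sqrt p.1 • ξ))
    exact (hk.cont.mul this).aestronglyMeasurable
  · have : ∀ᶠ p : ℝ × X × (Fin N → ℝ) in nhds p₀, β p.2.1 < β p₀.2.1 + 1 :=
      (hβ.comp (continuous_fst.comp continuous_snd)).continuousAt.eventually_lt
        continuousAt_const (by simp)
    filter_upwards [this] with p hp
    refine Filter.Eventually.of_forall fun ξ => ?_
    rw [norm_mul]
    exact mul_le_mul_of_nonneg_left ((hFβ _ _).trans hp.le) (norm_nonneg _)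
  · have : Continuous fun p : ℝ × X × (Fin N → ℝ) => F p.2.1 (p.2.2 + Real.sqrt p.1 • ξ) :=
      hF.comp (by fun_prop : Continuous fun p : ℝ × X × (Fin N → ℝ) =>
        (p.2.1, p.2.2 + Real.sqrt p.1 • ξ))
    exact (this.const_mul (k ξ)).continuousAt

theorem scaledConv_eq_integral_translate (hτ : 0 < τ) (k g : (Fin N → ℝ) → ℝ) (z : Fin N → ℝ) :
    scaledConv k τ g z
      = (Real.sqrt τ ^ N)⁻¹ * ∫ w, k ((Real.sqrt τ)⁻¹ • (w - z)) * g w := by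
  have hr : 0 < Real.sqrt τ := Real.sqrt_pos.2 hτ
  have h1 := integral_add_left_eq_self (μ := volume)
    (fun w : Fin N → ℝ => k ((Real.sqrt τ)⁻¹ • (w - z)) * g w) z
  have h2 := Measure.integral_comp_smul volume
    (fun w : Fin N → ℝ => k ((Real.sqrt τ)⁻¹ • (z + w - z)) * g (z + w)) (Real.sqrt τ)
  rw [← h1, scaledConv]
  simp only [Module.finrank_fintype_fun_eq_card, Fintype.card_fin, smul_eq_mul] at h2
  rw [abs_of_pos (by positivity)] at h2
  rw [← h2]
  congr 1
  ext ξ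
  rw [add_sub_cancel_left, smul_smul, inv_mul_cancel₀ hr.ne', one_smul]

theorem hasFDerivAt_scaledConv {k' : Fin N → (Fin N → ℝ) → ℝ} (hk : IsRapidKernel k)
    (hk' : ∀ j, IsRapidKernel (k' j))
    (hd : ∀ ξ, HasFDerivAt k (gradCLM fun j => k' j ξ) ξ) (hg : Continuous g)
    (hB : ∀ z, |g z| ≤ B) (hτ : 0 < τ) (z : Fin N → ℝ) :
    HasFDerivAt (scaledConv k τ g)
      (gradCLM fun j => -(Real.sqrt τ)⁻¹ * scaledConv (k' j) τ g z) z := by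
  have hr : 0 < Real.sqrt τ := Real.sqrt_pos.2 hτ
  set r := Real.sqrt τ with hrdef
  have hB0 : 0 ≤ B := (abs_nonneg _).trans (hB 0)
  choose C hC0 hC using fun j => (hk' j).exists_le (N + 1)
  have hInt : ∀ {l : (Fin N → ℝ) → ℝ}, IsRapidKernel l → ∀ z : Fin N → ℝ,
      Integrable fun w => l (r⁻¹ • (w - z)) * g w := by
    intro l hl z
    have h1 := (hl.integrable.comp_smul (inv_pos.2 hr).ne').comp_sub_right z
    exact h1.mul_bdd (c := B) hg.aestronglyMeasurable (Filter.Eventually.of_forall fun ξ => hB _)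
  have hmain : HasFDerivAt (fun z => ∫ w, k (r⁻¹ • (w - z)) * g w)
      (∫ w, gradCLM fun j => -r⁻¹ * (k' j (r⁻¹ • (w - z)) * g w)) z := by
    refine hasFDerivAt_integral_of_dominated_of_fderiv_le
      (F' := fun z w => gradCLM fun j => -r⁻¹ * (k' j (r⁻¹ • (w - z)) * g w))
      (bound := fun w => (r⁻¹ * B * 2 ^ (N + 1) * ∑ j, C j) *
        ((1 + ‖r⁻¹ • (w - z)‖) ^ (N + 1))⁻¹)
      (Metric.ball_mem_nhds z hr)
      (Filter.Eventually.of_forall fun z => (hInt hk z).aestronglyMeasurable) (hInt hk z)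
      ?_ (Filter.Eventually.of_forall fun w z' hz' => ?_) ?_
      (Filter.Eventually.of_forall fun w z' _ => ?_)
    · refine (continuous_gradCLM.comp (continuous_pi fun j => ?_)).aestronglyMeasurable
      have := (hk' j).cont
      fun_prop
    · refine (norm_gradCLM_le _).trans ?_
      rw [Finset.mul_sum, Finset.sum_mul]
      refine Finset.sum_le_sum fun j _ => ?_
      rw [abs_mul, abs_mul, abs_neg, abs_of_pos (inv_pos.2 hr)]
      have h1 : (1 + ‖r⁻¹ • (w - z)‖) ≤ 2 * (1 + ‖r⁻¹ • (w - z')‖) := by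
        have h2 : r⁻¹ • (w - z) = r⁻¹ • (w - z') + r⁻¹ • (z' - z) := by
          rw [← smul_add]; congr 1; abel
        have h3 : ‖r⁻¹ • (z' - z)‖ ≤ 1 := by
          rw [norm_smul, norm_inv, Real.norm_of_nonneg hr.le, inv_mul_le_iff₀ hr, mul_one]
          exact (mem_ball_iff_norm.1 hz').le
        have h4 := norm_add_le (r⁻¹ • (w - z')) (r⁻¹ • (z' - z))
        rw [← h2] at h4
        linarith [norm_nonneg (r⁻¹ • (w - z'))]
      have h5 : ((1 + ‖r⁻¹ • (w - z')‖) ^ (N + 1))⁻¹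
          ≤ 2 ^ (N + 1) * ((1 + ‖r⁻¹ • (w - z)‖) ^ (N + 1))⁻¹ := by
        rw [← div_eq_mul_inv, le_div_iff₀ (by positivity), inv_mul_le_iff₀ (by positivity), mul_comm,
          ← mul_pow]
        gcongr
      calc r⁻¹ * (|k' j (r⁻¹ • (w - z'))| * |g w|)
          ≤ r⁻¹ * (C j * (2 ^ (N + 1) * ((1 + ‖r⁻¹ • (w - z)‖) ^ (N + 1))⁻¹) * B) := by
            gcongr
            · have := hC0 j
              positivity
            · exact (hC j _).trans (mul_le_mul_of_nonneg_left h5 (hC0 j))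
            · exact hB w
        _ = _ := by ring
    · exact ((IsRapidKernel.integrable_inv_pow.comp_smul (inv_pos.2 hr).ne').comp_sub_right
        z).const_mul _
    · have h1 : HasFDerivAt (fun z : Fin N → ℝ => r⁻¹ • (w - z))
          (r⁻¹ • -ContinuousLinearMap.id ℝ (Fin N → ℝ)) z' :=
        ((hasFDerivAt_id z').const_sub w).const_smul r⁻¹
      refine (((hd _).comp z' h1).mul_const (g w)).congr_fderiv ?_
      ext v
      simp [gradCLM_apply, Finset.mul_sum]
      refine Finset.sum_congr rfl fun j _ => ?_
      ring
  rw [gradCLM_integral fun j => (hInt (hk' j) z).const_mul _] at hmain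
  have h2 := hmain.const_mul (r ^ N)⁻¹
  have h3 : scaledConv k τ g = fun z => (r ^ N)⁻¹ * ∫ w, k (r⁻¹ • (w - z)) * g w :=
    funext fun z => scaledConv_eq_integral_translate hτ k g z
  rw [h3]
  refine h2.congr_fderiv ?_
  ext v
  simp only [smul_apply, gradCLM_apply, smul_eq_mul, Finset.mul_sum,
    integral_const_mul, scaledConv_eq_integral_translate hτ]
  refine Finset.sum_congr rfl fun j _ => ?_
  ring

theorem integral_partial_kernel_eq_zero {k' : Fin N → (Fin N → ℝ) → ℝ} (hk : IsRapidKernel k)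
    (hk' : ∀ j, IsRapidKernel (k' j))
    (hd : ∀ ξ, HasFDerivAt k (gradCLM fun j => k' j ξ) ξ) (j : Fin N) : ∫ ξ, k' j ξ = 0 := by
  have h1 := hasFDerivAt_scaledConv hk hk' hd (g := fun _ => 1) (B := 1) continuous_const
    (by simp) one_pos 0
  have h2 : scaledConv k 1 (fun _ => 1) = fun _ => (∫ ξ, k ξ) * 1 :=
    funext fun z => scaledConv_const k 1 1 z
  rw [h2] at h1
  have h3 := h1.unique (hasFDerivAt_const _ _)
  have h4 := congrArg (fun l => l (Pi.single j 1)) h3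
  simpa [gradCLM_single, scaledConv_const] using h4

/-- Derivative in the scale parameter. -/
theorem hasDerivAt_scaledConv {k' : Fin N → (Fin N → ℝ) → ℝ} {l : (Fin N → ℝ) → ℝ}
    (hk : IsRapidKernel k) (hl : IsRapidKernel l)
    (hd : ∀ ξ, HasFDerivAt k (gradCLM fun j => k' j ξ) ξ)
    (hkl : ∀ ξ, 2 * l ξ = -(N * k ξ) - ∑ j, k' j ξ * ξ j) (hg : Continuous g)
    (hB : ∀ z, |g z| ≤ B) (hτ : 0 < τ) (z : Fin N → ℝ) :
    HasDerivAt (fun τ => scaledConv k τ g z) (τ⁻¹ * scaledConv l τ g z) τ := by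
  have hr0 : 0 < Real.sqrt τ := Real.sqrt_pos.2 hτ
  set r₀ := Real.sqrt τ with hrdef
  have hB0 : 0 ≤ B := (abs_nonneg _).trans (hB 0)
  obtain ⟨C, hC0, hC⟩ := hl.exists_le (N + 1)
  have hInt : ∀ {l : (Fin N → ℝ) → ℝ}, IsRapidKernel l → ∀ r > (0 : ℝ),
      Integrable fun w => l (r⁻¹ • (w - z)) * g w := by
    intro l hl r hr
    have h1 := (hl.integrable.comp_smul (inv_pos.2 hr).ne').comp_sub_right z
    exact h1.mul_bdd (c := B) hg.aestronglyMeasurable (Filter.Eventually.of_forall fun ξ => hB _)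
  have hmem : Set.Ioo (r₀ / 2) (2 * r₀) ∈ nhds r₀ := Ioo_mem_nhds (by linarith) (by linarith)
  have hmain := (hasDerivAt_integral_of_dominated_loc_of_deriv_le (x₀ := r₀) (μ := volume)
      (F := fun (r : ℝ) (w : Fin N → ℝ) => (r ^ N)⁻¹ * (k (r⁻¹ • (w - z)) * g w))
      (F' := fun (r : ℝ) (w : Fin N → ℝ) => 2 * r⁻¹ * ((r ^ N)⁻¹ * (l (r⁻¹ • (w - z)) * g w)))
      (bound := fun w => (2 * (r₀ / 2)⁻¹ * (((r₀ / 2) ^ N)⁻¹ * (C * B))) *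
        ((1 + ‖(2 * r₀)⁻¹ • (w - z)‖) ^ (N + 1))⁻¹) hmem
      ?_ ((hInt hk r₀ hr0).const_mul _) (((hInt hl r₀ hr0).const_mul _).const_mul _).aestronglyMeasurable
      (Filter.Eventually.of_forall fun w r hr => ?_) ?_
      (Filter.Eventually.of_forall fun w r hr => ?_)).2
  · have h1 := hmain.comp τ (Real.hasDerivAt_sqrt hτ.ne')
    have h2 : (fun τ => scaledConv k τ g z) =ᶠ[nhds τ]
        (fun r : ℝ => ∫ w, (r ^ N)⁻¹ * (k (r⁻¹ • (w - z)) * g w)) ∘ Real.sqrt := by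
      filter_upwards [lt_mem_nhds hτ] with s hs
      rw [scaledConv_eq_integral_translate hs, Function.comp, integral_const_mul]
    refine (h1.congr_of_eventuallyEq h2).congr_deriv ?_
    rw [integral_const_mul, integral_const_mul, scaledConv_eq_integral_translate hτ, ← hrdef]
    have : τ = r₀ * r₀ := (Real.mul_self_sqrt hτ.le).symm
    rw [this]
    field_simp
  · filter_upwards [lt_mem_nhds hr0] with r hr
    exact ((hInt hk r hr).const_mul _).aestronglyMeasurable
  · have hrpos : 0 < r := by linarith [hr.1]
    have h1 : ‖(2 * r₀)⁻¹ • (w - z)‖ ≤ ‖r⁻¹ • (w - z)‖ := by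
      rw [norm_smul, norm_smul, norm_inv, norm_inv, Real.norm_of_nonneg (by positivity),
        Real.norm_of_nonneg hrpos.le]
      have := hr.2.le
      gcongr
    have h2 := hr.1.le
    have h3 : ‖2 * r⁻¹ * ((r ^ N)⁻¹ * (l (r⁻¹ • (w - z)) * g w))‖
        = 2 * r⁻¹ * ((r ^ N)⁻¹ * (|l (r⁻¹ • (w - z))| * |g w|)) := by
      rw [Real.norm_eq_abs, abs_mul, abs_mul (r ^ N)⁻¹, abs_mul (l _),
        abs_of_pos (by positivity : 0 < 2 * r⁻¹), abs_of_pos (by positivity : 0 < (r ^ N)⁻¹)]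
    rw [h3]
    calc 2 * r⁻¹ * ((r ^ N)⁻¹ * (|l (r⁻¹ • (w - z))| * |g w|))
        ≤ 2 * (r₀ / 2)⁻¹ * (((r₀ / 2) ^ N)⁻¹ *
          (C * ((1 + ‖(2 * r₀)⁻¹ • (w - z)‖) ^ (N + 1))⁻¹ * B)) := by
          gcongr
          · refine (hC _).trans ?_
            gcongr
          · exact hB w
      _ = _ := by ring
  · exact ((IsRapidKernel.integrable_inv_pow.comp_smul (by positivity : (2 * r₀)⁻¹ ≠ 0)).comp_sub_right
        z).const_mul _
  · have hrpos : 0 < r := by linarith [hr.1]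
    have h1 : HasDerivAt (fun r : ℝ => r⁻¹ • (w - z)) ((-(r ^ 2)⁻¹) • (w - z)) r :=
      (hasDerivAt_inv hrpos.ne').smul_const _
    have h2 := ((hd (r⁻¹ • (w - z))).comp_hasDerivAt r h1).mul_const (g w)
    have h3 := ((hasDerivAt_pow N r).inv (by positivity)).mul h2
    refine h3.congr_deriv ?_
    have h4 := hkl (r⁻¹ • (w - z))
    have h5 : (2 : ℝ) * r⁻¹ * ((r ^ N)⁻¹ * (l (r⁻¹ • (w - z)) * g w))
        = r⁻¹ * ((r ^ N)⁻¹ * ((2 * l (r⁻¹ • (w - z))) * g w)) := by ring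
    simp only [gradCLM_apply, Function.comp]
    rw [h5, h4]
    have h6 : ∑ j, k' j (r⁻¹ • (w - z)) * (-(r ^ 2)⁻¹ • (w - z)) j
        = -r⁻¹ * ∑ j, k' j (r⁻¹ • (w - z)) * (r⁻¹ • (w - z)) j := by
      rw [Finset.mul_sum]
      refine Finset.sum_congr rfl fun j _ => ?_
      simp only [Pi.smul_apply, smul_eq_mul]
      field_simp
    rw [h6]
    generalize ∑ j, k' j (r⁻¹ • (w - z)) * (r⁻¹ • (w - z)) j = q
    rcases Nat.eq_zero_or_pos N with hN | hN
    · subst hN; simp; ring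
    · obtain ⟨n, rfl⟩ : ∃ n, N = n + 1 := ⟨N - 1, by omega⟩
      simp only [Nat.add_sub_cancel, Pi.inv_apply]
      field_simp
      ring

end ScaledConv

end RapidKernels

section HeatKernel

variable {N : ℕ}

/-- Unnormalised Gaussian. -/
def gaussFun (ξ : Fin N → ℝ) : ℝ := Real.exp (-(1 / 4) * ∑ i, ξ i ^ 2)

theorem isRapidKernel_gaussFun : IsRapidKernel (gaussFun : (Fin N → ℝ) → ℝ) := by
  refine ⟨by unfold gaussFun; fun_prop, fun n => ⟨n.factorial * Real.exp 2, fun ξ => ?_⟩⟩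
  have h1 := Real.pow_div_factorial_le_exp (1 + ‖ξ‖) (by positivity) n
  rw [div_le_iff₀ (by positivity)] at h1
  have h2 : |gaussFun ξ| ≤ Real.exp (-‖ξ‖ ^ 2 / 4) := by
    rw [gaussFun, abs_of_pos (Real.exp_pos _)]
    refine Real.exp_le_exp.2 ?_
    have := norm_sq_le_sum_sq ξ
    linarith
  calc |gaussFun ξ| * (1 + ‖ξ‖) ^ n
      ≤ Real.exp (-‖ξ‖ ^ 2 / 4) * (Real.exp (1 + ‖ξ‖) * n.factorial) := by gcongr
    _ = n.factorial * Real.exp (-‖ξ‖ ^ 2 / 4 + (1 + ‖ξ‖)) := by rw [Real.exp_add (-‖ξ‖ ^ 2 / 4)]; ring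
    _ ≤ _ := by
      gcongr
      nlinarith [sq_nonneg (‖ξ‖ - 2)]

theorem integral_gaussFun_pos : 0 < ∫ ξ : Fin N → ℝ, gaussFun ξ := by
  rw [integral_pos_iff_support_of_nonneg (f := gaussFun) (fun ξ => (Real.exp_pos _).le)
    isRapidKernel_gaussFun.integrable]
  have : Function.support (gaussFun : (Fin N → ℝ) → ℝ) = Set.univ :=
    Set.eq_univ_of_forall fun ξ => (Real.exp_pos _).ne'
  rw [this]
  exact Measure.measure_univ_pos.2 (NeZero.ne _)

/-- Heat kernel at time one. -/
def heatK (ξ : Fin N → ℝ) : ℝ := (∫ η : Fin N → ℝ, gaussFun η)⁻¹ * gaussFun ξ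

/-- First partial derivatives of the heat kernel at time one. -/
def heatK1 (i : Fin N) (ξ : Fin N → ℝ) : ℝ := -(1 / 2) * (ξ i * heatK ξ)

/-- Second partial derivatives of the heat kernel at time one. -/
def heatK2 (i j : Fin N) (ξ : Fin N → ℝ) : ℝ :=
  1 / 4 * (ξ i * (ξ j * heatK ξ)) + (if i = j then -(1 / 2) else 0) * heatK ξ

theorem heatK_pos (ξ : Fin N → ℝ) : 0 < heatK ξ :=
  mul_pos (inv_pos.2 integral_gaussFun_pos) (Real.exp_pos _)

theorem isRapidKernel_heatK : IsRapidKernel (heatK : (Fin N → ℝ) → ℝ) :=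
  isRapidKernel_gaussFun.const_mul _

theorem isRapidKernel_heatK1 (i : Fin N) : IsRapidKernel (heatK1 i) :=
  (isRapidKernel_heatK.coord_mul i).const_mul _

theorem isRapidKernel_heatK2 (i j : Fin N) : IsRapidKernel (heatK2 i j) :=
  (((isRapidKernel_heatK.coord_mul j).coord_mul i).const_mul _).add
    (isRapidKernel_heatK.const_mul _)

theorem integral_heatK : ∫ ξ : Fin N → ℝ, heatK ξ = 1 := by
  unfold heatK
  rw [integral_const_mul, inv_mul_cancel₀ integral_gaussFun_pos.ne']

theorem integral_abs_heatK : ∫ ξ : Fin N → ℝ, |heatK ξ| = 1 := by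
  simp_rw [fun ξ : Fin N → ℝ => abs_of_pos (heatK_pos ξ)]
  exact integral_heatK

theorem hasFDerivAt_heatK (ξ : Fin N → ℝ) :
    HasFDerivAt heatK (gradCLM fun j => heatK1 j ξ) ξ := by
  have h1 : HasFDerivAt (fun ξ : Fin N → ℝ => ∑ i, ξ i ^ 2)
      (gradCLM fun j => 2 * ξ j) ξ := by
    have := HasFDerivAt.fun_sum (u := Finset.univ) fun i _ =>
      ((ContinuousLinearMap.proj (R := ℝ) (φ := fun _ : Fin N => ℝ) i).hasFDerivAt (x := ξ)).pow 2
    refine (this.congr_fderiv ?_)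
    ext v
    simp [gradCLM_apply]
  have h2 := (((h1.const_mul (-(1 / 4))).exp).const_mul (∫ η : Fin N → ℝ, gaussFun η)⁻¹)
  refine h2.congr_fderiv ?_
  ext v
  simp only [smul_apply, gradCLM_apply, smul_eq_mul,
    Finset.mul_sum, heatK1, heatK, gaussFun]
  refine Finset.sum_congr rfl fun j _ => ?_
  ring

theorem hasFDerivAt_heatK1 (i : Fin N) (ξ : Fin N → ℝ) :
    HasFDerivAt (heatK1 i) (gradCLM fun j => heatK2 i j ξ) ξ := by
  have h1 := (((ContinuousLinearMap.proj (R := ℝ) (φ := fun _ : Fin N => ℝ) i).hasFDerivAt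
    (x := ξ)).mul (hasFDerivAt_heatK ξ)).const_mul (-(1 / 2))
  refine h1.congr_fderiv ?_
  ext v
  simp only [smul_apply, add_apply, gradCLM_apply, smul_eq_mul,
    ContinuousLinearMap.proj_apply, heatK1, heatK2, add_mul, Finset.sum_add_distrib]
  simp only [ite_mul, zero_mul, Finset.sum_ite_eq, Finset.mem_univ, if_true, Finset.mul_sum,
    mul_add]
  congr 1
  · refine Finset.sum_congr rfl fun j _ => ?_
    ring
  · ring

/-- The Laplacian of the heat kernel at time one. -/
def heatKLap (ξ : Fin N → ℝ) : ℝ := ∑ i, heatK2 i i ξ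

theorem isRapidKernel_heatKLap : IsRapidKernel (heatKLap : (Fin N → ℝ) → ℝ) :=
  IsRapidKernel.sum fun i _ => isRapidKernel_heatK2 i i

theorem integral_heatK2 (i j : Fin N) : ∫ ξ, heatK2 i j ξ = 0 :=
  integral_partial_kernel_eq_zero (isRapidKernel_heatK1 i) (fun j => isRapidKernel_heatK2 i j)
    (hasFDerivAt_heatK1 i) j

theorem integral_heatKLap : ∫ ξ : Fin N → ℝ, heatKLap ξ = 0 := by
  unfold heatKLap
  rw [integral_finsetSum _ fun i _ => (isRapidKernel_heatK2 i i).integrable]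
  exact Finset.sum_eq_zero fun i _ => integral_heatK2 i i

variable {g : (Fin N → ℝ) → ℝ} {B τ : ℝ}

theorem scaledConv_heatKLap (hg : Continuous g) (hB : ∀ z, |g z| ≤ B) (τ : ℝ) (z : Fin N → ℝ) :
    scaledConv heatKLap τ g z = ∑ i, scaledConv (heatK2 i i) τ g z := by
  unfold scaledConv heatKLap
  rw [← integral_finsetSum _ fun i _ => integrable_scaledConv (isRapidKernel_heatK2 i i) hg hB τ z]
  simp only [Finset.sum_mul]

theorem hasFDerivAt_heat (hg : Continuous g) (hB : ∀ z, |g z| ≤ B) (hτ : 0 < τ)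
    (z : Fin N → ℝ) : HasFDerivAt (scaledConv heatK τ g)
      (gradCLM fun j => -(Real.sqrt τ)⁻¹ * scaledConv (heatK1 j) τ g z) z :=
  hasFDerivAt_scaledConv isRapidKernel_heatK isRapidKernel_heatK1 hasFDerivAt_heatK hg hB hτ z

theorem hasDerivAt_heat (hg : Continuous g) (hB : ∀ z, |g z| ≤ B) (hτ : 0 < τ) (z : Fin N → ℝ) :
    HasDerivAt (fun τ => scaledConv heatK τ g z) (τ⁻¹ * scaledConv heatKLap τ g z) τ := by
  refine hasDerivAt_scaledConv isRapidKernel_heatK isRapidKernel_heatKLap hasFDerivAt_heatK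
    (fun ξ => ?_) hg hB hτ z
  simp only [heatKLap, heatK2, heatK1, if_true, Finset.sum_add_distrib, ← Finset.mul_sum,
    Finset.sum_const, Finset.card_univ, Fintype.card_fin, nsmul_eq_mul]
  have h : ∑ j, -(1 / 2) * (ξ j * heatK ξ) * ξ j = -(1 / 2) * ∑ j, ξ j * (ξ j * heatK ξ) := by
    rw [Finset.mul_sum]
    exact Finset.sum_congr rfl fun j _ => by ring
  rw [h]
  ring

end HeatKernel

section Duhamel

variable {N : ℕ}

/-- A jointly continuous forcing term, bounded in space locally uniformly in time. -/
structure IsSource (F : ℝ → (Fin N → ℝ) → ℝ) (β : ℝ → ℝ) : Prop where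
  cont : Continuous fun p : ℝ × (Fin N → ℝ) => F p.1 p.2
  cont_bound : Continuous β
  bound : ∀ s z, |F s z| ≤ β s

/-- A forcing term which is Lipschitz in space locally uniformly in time. -/
structure IsLipSource (F : ℝ → (Fin N → ℝ) → ℝ) (β l : ℝ → ℝ) : Prop extends IsSource F β where
  cont_lip : Continuous l
  lip : ∀ s z z', |F s z - F s z'| ≤ l s * ‖z - z'‖

theorem IsSource.cont_slice {F : ℝ → (Fin N → ℝ) → ℝ} {β : ℝ → ℝ} (h : IsSource F β) (s : ℝ) :
    Continuous (F s) :=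
  h.cont.comp (by fun_prop : Continuous fun z : Fin N → ℝ => (s, z))

theorem exists_forall_abs_le_le {β : ℝ → ℝ} (hβ : Continuous β) (R : ℝ) :
    ∃ C, 0 ≤ C ∧ ∀ s, |s| ≤ R → β s ≤ C := by
  obtain ⟨C, hC⟩ := (isCompact_Icc (a := -R) (b := R)).bddAbove_image hβ.continuousOn
  refine ⟨max C 0, le_max_right _ _, fun s hs => le_max_of_le_left ?_⟩
  exact hC ⟨s, abs_le.1 hs, rfl⟩

theorem abs_mul_one_sub_le {t σ R : ℝ} (ht : |t| ≤ R) (h0 : 0 < σ) (h1 : σ ≤ 1) :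
    |t * (1 - σ)| ≤ R := by
  rw [abs_mul, abs_of_nonneg (by linarith : 0 ≤ 1 - σ)]
  nlinarith [abs_nonneg t]

theorem one_le_inv_sqrt {σ : ℝ} (h0 : 0 < σ) (h1 : σ ≤ 1) : 1 ≤ (Real.sqrt σ)⁻¹ :=
  (one_le_inv₀ (Real.sqrt_pos.2 h0)).2 (Real.sqrt_le_one.2 h1)

theorem intervalIntegrable_inv_sqrt (a b : ℝ) (ha : 0 ≤ a) (hb : 0 ≤ b) :
    IntervalIntegrable (fun σ => (Real.sqrt σ)⁻¹) volume a b := by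
  refine (intervalIntegral.intervalIntegrable_rpow' (r := -(1 / 2)) (by norm_num)).congr ?_
  intro σ hσ
  have h : 0 ≤ σ := by
    rcases Set.mem_uIoc.1 hσ with h | h
    · exact ha.trans h.1.le
    · exact hb.trans h.1.le
  simp only
  rw [Real.rpow_neg h, Real.sqrt_eq_rpow]

/-- Weighted superposition of rescaled convolutions. -/
def duhInt (w : ℝ → ℝ) (k : (Fin N → ℝ) → ℝ) (F : ℝ → (Fin N → ℝ) → ℝ) (t : ℝ)
    (z : Fin N → ℝ) : ℝ :=
  ∫ σ in (0 : ℝ)..1, w σ * scaledConv k (t * σ) (F (t * (1 - σ))) z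

/-- Local integrable domination of the integrand of `duhInt`. -/
def DuhDominated (w : ℝ → ℝ) (k : (Fin N → ℝ) → ℝ) (F : ℝ → (Fin N → ℝ) → ℝ) : Prop :=
  ∀ R : ℝ, ∃ C, ∀ t σ z, |t| ≤ R → 0 < σ → σ ≤ 1 →
    |w σ * scaledConv k (t * σ) (F (t * (1 - σ))) z| ≤ C * (Real.sqrt σ)⁻¹

variable {w : ℝ → ℝ} {k : (Fin N → ℝ) → ℝ} {F : ℝ → (Fin N → ℝ) → ℝ} {β l : ℝ → ℝ} {t : ℝ}

theorem continuous_scaledConv_source (hk : IsRapidKernel k) (hF : IsSource F β) :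
    Continuous fun p : (ℝ × ℝ) × (Fin N → ℝ) => scaledConv k (p.1.1 * p.1.2)
      (F (p.1.1 * (1 - p.1.2))) p.2 :=
  (continuous_scaledConv hk hF.cont hF.cont_bound hF.bound).comp
    (by fun_prop : Continuous fun p : (ℝ × ℝ) × (Fin N → ℝ) =>
      (p.1.1 * p.1.2, p.1.1 * (1 - p.1.2), p.2))

theorem measurable_duhInt_integrand (hw : Measurable w) (hk : IsRapidKernel k)
    (hF : IsSource F β) (t : ℝ) (z : Fin N → ℝ) :
    Measurable fun σ => w σ * scaledConv k (t * σ) (F (t * (1 - σ))) z := by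
  refine hw.mul (Continuous.measurable ?_)
  exact (continuous_scaledConv_source hk hF).comp
    (by fun_prop : Continuous fun σ : ℝ => ((t, σ), z))

theorem intervalIntegrable_duhInt (hw : Measurable w) (hk : IsRapidKernel k)
    (hF : IsSource F β) (hD : DuhDominated w k F) (t : ℝ) (z : Fin N → ℝ) :
    IntervalIntegrable (fun σ => w σ * scaledConv k (t * σ) (F (t * (1 - σ))) z) volume 0 1 := by
  obtain ⟨C, hC⟩ := hD |t|
  refine ((intervalIntegrable_inv_sqrt 0 1 le_rfl zero_le_one).const_mul C).mono_fun'
    (measurable_duhInt_integrand hw hk hF t z).aestronglyMeasurable ?_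
  refine (ae_restrict_iff' measurableSet_uIoc).2 (Filter.Eventually.of_forall fun σ hσ => ?_)
  rw [Set.uIoc_of_le zero_le_one] at hσ
  exact hC t σ z le_rfl hσ.1 hσ.2

theorem continuous_duhInt (hw : Measurable w) (hk : IsRapidKernel k) (hF : IsSource F β)
    (hD : DuhDominated w k F) :
    Continuous fun p : ℝ × (Fin N → ℝ) => duhInt w k F p.1 p.2 := by
  refine continuous_iff_continuousAt.2 fun p₀ => ?_
  obtain ⟨C, hC⟩ := hD (|p₀.1| + 1)
  refine intervalIntegral.continuousAt_of_dominated_interval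
    (bound := fun σ => C * (Real.sqrt σ)⁻¹)
    (Filter.Eventually.of_forall fun p =>
      (measurable_duhInt_integrand hw hk hF p.1 p.2).aestronglyMeasurable) ?_
    ((intervalIntegrable_inv_sqrt 0 1 le_rfl zero_le_one).const_mul C)
    (Filter.Eventually.of_forall fun σ _ => ?_)
  · have : ∀ᶠ p : ℝ × (Fin N → ℝ) in nhds p₀, |p.1| < |p₀.1| + 1 :=
      (continuous_fst.abs).continuousAt.eventually_lt continuousAt_const (by simp)
    filter_upwards [this] with p hp
    refine Filter.Eventually.of_forall fun σ hσ => ?_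
    rw [Set.uIoc_of_le zero_le_one] at hσ
    exact hC p.1 σ p.2 hp.le hσ.1 hσ.2
  · refine Continuous.continuousAt ?_
    exact ((continuous_scaledConv_source hk hF).comp
      (by fun_prop : Continuous fun p : ℝ × (Fin N → ℝ) => ((p.1, σ), p.2))).const_mul _

theorem duhDominated_of_abs_le (hk : IsRapidKernel k) (hF : IsSource F β)
    (hw : ∀ σ, 0 < σ → σ ≤ 1 → |w σ| ≤ (Real.sqrt σ)⁻¹) : DuhDominated w k F := by
  intro R
  obtain ⟨C, hC0, hC⟩ := exists_forall_abs_le_le hF.cont_bound R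
  refine ⟨(∫ ξ, |k ξ|) * C, fun t σ z ht h0 h1 => ?_⟩
  rw [abs_mul, mul_comm]
  have h2 := abs_scaledConv_le hk (fun z => (hF.bound _ z).trans (hC _ (abs_mul_one_sub_le ht h0 h1)))
    (t * σ) z
  have h3 : 0 ≤ ∫ ξ, |k ξ| := integral_nonneg fun ξ => abs_nonneg _
  exact mul_le_mul h2 (hw σ h0 h1) (abs_nonneg _) (by positivity)

theorem duhDominated_of_lip (hk : IsRapidKernel k) (h0 : ∫ ξ, k ξ = 0) (hF : IsLipSource F β l)
    (hw : ∀ σ, 0 < σ → σ ≤ 1 → |w σ| ≤ σ⁻¹) : DuhDominated w k F := by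
  intro R
  obtain ⟨C, hC0, hC⟩ := exists_forall_abs_le_le hF.cont_lip R
  refine ⟨(∫ ξ, |k ξ| * ‖ξ‖) * (Real.sqrt R * C), fun t σ z ht h0' h1 => ?_⟩
  have h2 := abs_scaledConv_le_sqrt hk h0 (hF.cont_slice _) (hF.bound _) (L := C)
    (fun z z' => (hF.lip (t * (1 - σ)) z z').trans
      (mul_le_mul_of_nonneg_right (hC _ (abs_mul_one_sub_le ht h0' h1)) (norm_nonneg _)))
    (t * σ) z
  have h3 : 0 ≤ ∫ ξ, |k ξ| * ‖ξ‖ := integral_nonneg fun ξ => by positivity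
  have h4 : Real.sqrt (t * σ) ≤ Real.sqrt R * Real.sqrt σ := by
    rw [← Real.sqrt_mul ((abs_nonneg t).trans ht)]
    exact Real.sqrt_le_sqrt (by nlinarith [le_abs_self t])
  have hs : 0 < Real.sqrt σ := Real.sqrt_pos.2 h0'
  rw [abs_mul]
  calc |w σ| * |scaledConv k (t * σ) (F (t * (1 - σ))) z|
      ≤ σ⁻¹ * ((∫ ξ, |k ξ| * ‖ξ‖) * (Real.sqrt R * Real.sqrt σ * C)) := by
        refine mul_le_mul (hw σ h0' h1) (h2.trans ?_) (abs_nonneg _) (by positivity)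
        gcongr
    _ = (∫ ξ, |k ξ| * ‖ξ‖) * (Real.sqrt R * C) * (σ⁻¹ * Real.sqrt σ) := by ring
    _ = _ := by
      congr 1
      nth_rewrite 1 [← Real.mul_self_sqrt h0'.le]
      field_simp

theorem hasFDerivAt_duhInt {k' : Fin N → (Fin N → ℝ) → ℝ} (hw : Measurable w)
    (hk : IsRapidKernel k) (hk' : ∀ j, IsRapidKernel (k' j))
    (hd : ∀ ξ, HasFDerivAt k (gradCLM fun j => k' j ξ) ξ) (hF : IsSource F β)
    (hD : DuhDominated w k F)
    (hD' : ∀ j, DuhDominated (fun σ => w σ * (Real.sqrt σ)⁻¹) (k' j) F) (ht : 0 < t)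
    (z : Fin N → ℝ) :
    HasFDerivAt (duhInt w k F t) (gradCLM fun j =>
      -(Real.sqrt t)⁻¹ * duhInt (fun σ => w σ * (Real.sqrt σ)⁻¹) (k' j) F t z) z := by
  choose C hC using fun j => hD' j t
  have hw' : Measurable fun σ => w σ * (Real.sqrt σ)⁻¹ :=
    hw.mul (Real.continuous_sqrt.measurable.inv)
  have hmain := intervalIntegral.hasFDerivAt_integral_of_dominated_of_fderiv_le (𝕜 := ℝ)
    (μ := volume) (a := 0) (b := 1) (x₀ := z) (s := Set.univ)
    (F := fun z σ => w σ * scaledConv k (t * σ) (F (t * (1 - σ))) z)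
    (F' := fun z σ => gradCLM fun j => -(Real.sqrt t)⁻¹ *
      (w σ * (Real.sqrt σ)⁻¹ * scaledConv (k' j) (t * σ) (F (t * (1 - σ))) z))
    (bound := fun σ => ((Real.sqrt t)⁻¹ * ∑ j, C j) * (Real.sqrt σ)⁻¹)
    Filter.univ_mem (Filter.Eventually.of_forall fun z =>
      (measurable_duhInt_integrand hw hk hF t z).aestronglyMeasurable)
    (intervalIntegrable_duhInt hw hk hF hD t z) ?_
    (Filter.Eventually.of_forall fun σ hσ z' _ => ?_)
    ((intervalIntegrable_inv_sqrt 0 1 le_rfl zero_le_one).const_mul _)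
    (Filter.Eventually.of_forall fun σ hσ z' _ => ?_)
  · refine hmain.congr_fderiv ?_
    rw [intervalIntegral.integral_of_le zero_le_one, gradCLM_integral]
    · congr 1
      ext j
      rw [integral_const_mul, duhInt, intervalIntegral.integral_of_le zero_le_one]
    · intro j
      exact ((intervalIntegrable_iff_integrableOn_Ioc_of_le zero_le_one).1
        (intervalIntegrable_duhInt hw' (hk' j) hF (hD' j) t z)).const_mul _
  · refine (continuous_gradCLM.measurable.comp (measurable_pi_lambda _ fun j => ?_)).aestronglyMeasurable
    exact (measurable_duhInt_integrand hw' (hk' j) hF t z).const_mul _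
  · rw [Set.uIoc_of_le zero_le_one] at hσ
    refine (norm_gradCLM_le _).trans ?_
    rw [Finset.mul_sum, Finset.sum_mul]
    refine Finset.sum_le_sum fun j _ => ?_
    rw [abs_mul, abs_neg, abs_of_pos (inv_pos.2 (Real.sqrt_pos.2 ht)), mul_assoc _ (C j)]
    exact mul_le_mul_of_nonneg_left (hC j t σ z' (abs_of_pos ht).le hσ.1 hσ.2) (by positivity)
  · rw [Set.uIoc_of_le zero_le_one] at hσ
    have h1 := (hasFDerivAt_scaledConv hk hk' hd (hF.cont_slice (t * (1 - σ))) (hF.bound _)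
      (mul_pos ht hσ.1) z').const_mul (w σ)
    refine h1.congr_fderiv ?_
    ext v
    simp only [smul_apply, gradCLM_apply, smul_eq_mul, Finset.mul_sum]
    refine Finset.sum_congr rfl fun j _ => ?_
    rw [Real.sqrt_mul ht.le, mul_inv]
    ring

/-- Solution of the inhomogeneous heat equation with zero initial datum. -/
def duh (F : ℝ → (Fin N → ℝ) → ℝ) (t : ℝ) (z : Fin N → ℝ) : ℝ :=
  t * duhInt (fun _ => 1) heatK F t z

/-- First partial derivatives of `duh`. -/
def duh1 (i : Fin N) (F : ℝ → (Fin N → ℝ) → ℝ) (t : ℝ) (z : Fin N → ℝ) : ℝ :=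
  -Real.sqrt t * duhInt (fun σ => (Real.sqrt σ)⁻¹) (heatK1 i) F t z

/-- Second partial derivatives of `duh`. -/
def duh2 (i j : Fin N) (F : ℝ → (Fin N → ℝ) → ℝ) (t : ℝ) (z : Fin N → ℝ) : ℝ :=
  duhInt (fun σ => (Real.sqrt σ)⁻¹ * (Real.sqrt σ)⁻¹) (heatK2 i j) F t z

theorem measurable_inv_sqrt : Measurable fun σ => (Real.sqrt σ)⁻¹ :=
  Real.continuous_sqrt.measurable.inv

theorem duhDominated_one (hk : IsRapidKernel k) (hF : IsSource F β) :
    DuhDominated (fun _ => 1) k F :=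
  duhDominated_of_abs_le hk hF fun σ h0 h1 => by simpa using one_le_inv_sqrt h0 h1

theorem duhDominated_inv_sqrt (hk : IsRapidKernel k) (hF : IsSource F β) :
    DuhDominated (fun σ => (Real.sqrt σ)⁻¹) k F :=
  duhDominated_of_abs_le hk hF fun σ h0 h1 => by
    rw [abs_of_nonneg (by positivity)]

theorem duhDominated_inv_sqrt_sq (hk : IsRapidKernel k) (h0 : ∫ ξ, k ξ = 0)
    (hF : IsLipSource F β l) :
    DuhDominated (fun σ => (Real.sqrt σ)⁻¹ * (Real.sqrt σ)⁻¹) k F :=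
  duhDominated_of_lip hk h0 hF fun σ h0 h1 => by
    rw [abs_of_nonneg (by positivity), ← mul_inv, Real.mul_self_sqrt h0.le]

theorem continuous_duh (hF : IsSource F β) :
    Continuous fun p : ℝ × (Fin N → ℝ) => duh F p.1 p.2 :=
  continuous_fst.mul (continuous_duhInt measurable_const isRapidKernel_heatK hF
    (duhDominated_one isRapidKernel_heatK hF))

theorem continuous_duh1 (i : Fin N) (hF : IsSource F β) :
    Continuous fun p : ℝ × (Fin N → ℝ) => duh1 i F p.1 p.2 :=
  (Real.continuous_sqrt.comp continuous_fst).neg.mul (continuous_duhInt measurable_inv_sqrt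
    (isRapidKernel_heatK1 i) hF (duhDominated_inv_sqrt (isRapidKernel_heatK1 i) hF))

theorem continuous_duh2 (i j : Fin N) (hF : IsLipSource F β l) :
    Continuous fun p : ℝ × (Fin N → ℝ) => duh2 i j F p.1 p.2 :=
  continuous_duhInt (measurable_inv_sqrt.mul measurable_inv_sqrt) (isRapidKernel_heatK2 i j)
    hF.toIsSource (duhDominated_inv_sqrt_sq (isRapidKernel_heatK2 i j) (integral_heatK2 i j) hF)

theorem hasFDerivAt_duh (hF : IsSource F β) (ht : 0 < t) (z : Fin N → ℝ) :
    HasFDerivAt (duh F t) (gradCLM fun j => duh1 j F t z) z := by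
  have h := (hasFDerivAt_duhInt measurable_const isRapidKernel_heatK isRapidKernel_heatK1
    hasFDerivAt_heatK hF (duhDominated_one isRapidKernel_heatK hF) (fun j => by
      simpa only [one_mul] using duhDominated_inv_sqrt (isRapidKernel_heatK1 j) hF) ht z).const_mul t
  refine h.congr_fderiv ?_
  ext v
  have hs : Real.sqrt t ≠ 0 := (Real.sqrt_pos.2 ht).ne'
  simp only [smul_apply, gradCLM_apply, smul_eq_mul, Finset.mul_sum, duh1, one_mul]
  refine Finset.sum_congr rfl fun j _ => ?_
  nth_rewrite 1 [← Real.mul_self_sqrt ht.le]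
  field_simp

theorem hasFDerivAt_duh1 (i : Fin N) (hF : IsLipSource F β l) (ht : 0 < t) (z : Fin N → ℝ) :
    HasFDerivAt (duh1 i F t) (gradCLM fun j => duh2 i j F t z) z := by
  have h := (hasFDerivAt_duhInt measurable_inv_sqrt (isRapidKernel_heatK1 i)
    (isRapidKernel_heatK2 i) (hasFDerivAt_heatK1 i) hF.toIsSource
    (duhDominated_inv_sqrt (isRapidKernel_heatK1 i) hF.toIsSource)
    (fun j => duhDominated_inv_sqrt_sq (isRapidKernel_heatK2 i j) (integral_heatK2 i j) hF)
    ht z).const_mul (-Real.sqrt t)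
  refine h.congr_fderiv ?_
  ext v
  have hs : Real.sqrt t ≠ 0 := (Real.sqrt_pos.2 ht).ne'
  simp only [smul_apply, gradCLM_apply, smul_eq_mul, Finset.mul_sum, duh2]
  refine Finset.sum_congr rfl fun j _ => ?_
  field_simp

theorem contDiff_duh (hF : IsLipSource F β l) (ht : 0 < t) : ContDiff ℝ 2 (duh F t) := by
  have h0 : ∀ i j, ContDiff ℝ 0 (duh2 i j F t) := fun i j => contDiff_zero.2
    ((continuous_duh2 i j hF).comp (by fun_prop : Continuous fun z : Fin N → ℝ => (t, z)))
  have h1 : ∀ i, ContDiff ℝ ((0 : ℕ) + 1) (duh1 i F t) := fun i =>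
    contDiff_succ_of_hasFDerivAt_gradCLM (hasFDerivAt_duh1 i hF ht) (by simpa using h0 i)
  have h2 : ContDiff ℝ ((1 : ℕ) + 1) (duh F t) :=
    contDiff_succ_of_hasFDerivAt_gradCLM (hasFDerivAt_duh hF.toIsSource ht) (by simpa using h1)
  have : ((1 : ℕ) : WithTop ℕ∞) + 1 = 2 := by norm_num
  rwa [this] at h2

theorem pd_duh (hF : IsSource F β) (ht : 0 < t) (i : Fin N) (z : Fin N → ℝ) :
    pd i (duh F t) z = duh1 i F t z := by
  rw [(hasFDerivAt_duh hF ht z).pd_eq, gradCLM_single]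

theorem lap_duh (hF : IsLipSource F β l) (ht : 0 < t) (z : Fin N → ℝ) :
    lap (duh F t) z = ∑ i, duh2 i i F t z := by
  unfold lap
  refine Finset.sum_congr rfl fun i _ => ?_
  have h : pd i (duh F t) = duh1 i F t := funext fun z => pd_duh hF.toIsSource ht i z
  rw [h, (hasFDerivAt_duh1 i hF ht z).pd_eq, gradCLM_single]

end Duhamel

section DuhamelTime

variable {N : ℕ} {F : ℝ → (Fin N → ℝ) → ℝ} {β l : ℝ → ℝ} {t : ℝ}

/-- Time derivative of the heat evolution of the slice `F s`. -/
def heatRate (F : ℝ → (Fin N → ℝ) → ℝ) (z : Fin N → ℝ) (τ s : ℝ) : ℝ :=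
  τ⁻¹ * scaledConv heatKLap τ (F s) z

theorem heatRate_of_nonpos {τ : ℝ} (hτ : τ ≤ 0) (z : Fin N → ℝ) (s : ℝ) :
    heatRate F z τ s = 0 := by
  rw [heatRate, scaledConv_of_nonpos hτ, integral_heatKLap]
  simp

theorem measurable_heatRate (hF : IsSource F β) (z : Fin N → ℝ) :
    Measurable fun p : ℝ × ℝ => heatRate F z p.1 p.2 := by
  unfold heatRate
  refine measurable_fst.inv.mul (Continuous.measurable ?_)
  exact (continuous_scaledConv isRapidKernel_heatKLap hF.cont hF.cont_bound hF.bound).comp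
    (by fun_prop : Continuous fun p : ℝ × ℝ => (p.1, p.2, z))

theorem exists_abs_heatRate_le (hF : IsLipSource F β l) (z : Fin N → ℝ) (t : ℝ) :
    ∃ C, 0 ≤ C ∧ ∀ τ s, |s| ≤ t → |heatRate F z τ s| ≤ C * (Real.sqrt τ)⁻¹ := by
  obtain ⟨C, hC0, hC⟩ := exists_forall_abs_le_le hF.cont_lip t
  have h3 : 0 ≤ ∫ ξ : Fin N → ℝ, |heatKLap ξ| * ‖ξ‖ := integral_nonneg fun ξ => by positivity
  refine ⟨(∫ ξ : Fin N → ℝ, |heatKLap ξ| * ‖ξ‖) * C, by positivity, fun τ s hs => ?_⟩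
  rcases le_or_gt τ 0 with hτ | hτ
  · rw [heatRate_of_nonpos hτ, abs_zero]
    positivity
  · have h2 := abs_scaledConv_le_sqrt isRapidKernel_heatKLap integral_heatKLap (hF.cont_slice s)
      (hF.bound _) (L := C) (fun z z' => (hF.lip s z z').trans
        (mul_le_mul_of_nonneg_right (hC _ hs) (norm_nonneg _))) τ z
    have hs : 0 < Real.sqrt τ := Real.sqrt_pos.2 hτ
    rw [heatRate, abs_mul, abs_of_pos (inv_pos.2 hτ)]
    calc τ⁻¹ * |scaledConv heatKLap τ (F s) z|
        ≤ τ⁻¹ * ((∫ ξ : Fin N → ℝ, |heatKLap ξ| * ‖ξ‖) * (Real.sqrt τ * C)) := by gcongr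
      _ = _ := by
        nth_rewrite 1 [← Real.mul_self_sqrt hτ.le]
        field_simp

theorem intervalIntegrable_heatRate (hF : IsLipSource F β l) (z : Fin N → ℝ) {τ : ℝ}
    (hτ : 0 ≤ τ) (s : ℝ) : IntervalIntegrable (fun r => heatRate F z r s) volume 0 τ := by
  obtain ⟨C, -, hC⟩ := exists_abs_heatRate_le hF z |s|
  refine ((intervalIntegrable_inv_sqrt 0 τ le_rfl hτ).const_mul C).mono_fun'
    ((measurable_heatRate hF.toIsSource z).comp
      (measurable_id.prodMk measurable_const)).aestronglyMeasurable ?_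
  exact Filter.Eventually.of_forall fun r => hC r s le_rfl

theorem heat_sub_eq_integral_heatRate (hF : IsLipSource F β l) (z : Fin N → ℝ) {τ : ℝ}
    (hτ : 0 ≤ τ) (s : ℝ) :
    ∫ r in (0 : ℝ)..τ, heatRate F z r s = scaledConv heatK τ (F s) z - F s z := by
  have h0 : scaledConv heatK 0 (F s) z = F s z := by
    rw [scaledConv_of_nonpos le_rfl, integral_heatK, one_mul]
  have h := intervalIntegral.integral_eq_sub_of_hasDerivAt_of_le hτ
    (f := fun τ => scaledConv heatK τ (F s) z) (f' := fun r => heatRate F z r s) ?_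
    (fun r hr => hasDerivAt_heat (hF.cont_slice s) (hF.bound s) hr.1 z)
    (intervalIntegrable_heatRate hF z hτ s)
  · rw [h, h0]
  · exact ((continuous_scaledConv isRapidKernel_heatK hF.cont hF.cont_bound hF.bound).comp
      (by fun_prop : Continuous fun τ : ℝ => (τ, s, z))).continuousOn

theorem duh_eq_integral (F : ℝ → (Fin N → ℝ) → ℝ) (ht : 0 < t) (z : Fin N → ℝ) :
    duh F t z = ∫ s in (0 : ℝ)..t, scaledConv heatK (t - s) (F s) z := by
  have h1 := intervalIntegral.integral_comp_mul_left (a := 0) (b := 1)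
    (fun x => scaledConv heatK x (F (t - x)) z) ht.ne'
  have h2 := intervalIntegral.integral_comp_sub_left (a := 0) (b := t)
    (fun x => scaledConv heatK x (F (t - x)) z) t
  simp only [sub_sub_cancel, sub_zero, sub_self] at h2
  rw [h2, duh, duhInt]
  have h3 : ∀ σ, t * (1 - σ) = t - t * σ := fun σ => by ring
  simp only [one_mul, h3]
  rw [h1, mul_zero, mul_one, smul_eq_mul, mul_inv_cancel_left₀ ht.ne']

theorem integral_heatRate_diag (hF : IsLipSource F β l) (z : Fin N → ℝ) {r : ℝ}
    (hr : 0 < r) (hrt : r ≤ t) :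
    ∫ s in (0 : ℝ)..t, heatRate F z (r - s) s = ∑ i, duh2 i i F r z := by
  have hInt : IntervalIntegrable (fun s => heatRate F z (r - s) s) volume 0 r := by
    obtain ⟨C, -, hC⟩ := exists_abs_heatRate_le hF z r
    have h1 := ((intervalIntegrable_inv_sqrt 0 r le_rfl hr.le).comp_sub_left r).const_mul C
    simp only [sub_zero, sub_self] at h1
    refine h1.symm.mono_fun' ((measurable_heatRate hF.toIsSource z).comp
      ((measurable_const.sub measurable_id).prodMk measurable_id)).aestronglyMeasurable ?_
    refine (ae_restrict_iff' measurableSet_uIoc).2 (Filter.Eventually.of_forall fun s hs => ?_)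
    rw [Set.uIoc_of_le hr.le] at hs
    exact hC (r - s) s (by rw [abs_of_pos hs.1]; exact hs.2)
  have hzero : ∀ s ∈ Set.uIcc r t, heatRate F z (r - s) s = 0 := fun s hs => by
    rw [Set.uIcc_of_le hrt] at hs
    exact heatRate_of_nonpos (by linarith [hs.1]) z s
  have hInt2 : IntervalIntegrable (fun s => heatRate F z (r - s) s) volume r t :=
    (IntervalIntegrable.congr (f := fun _ => (0 : ℝ)) (fun s hs =>
      (hzero s (Set.uIoc_subset_uIcc hs)).symm) (by simp))
  rw [← intervalIntegral.integral_add_adjacent_intervals hInt hInt2,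
    intervalIntegral.integral_congr (g := fun _ => (0 : ℝ)) hzero]
  simp only [intervalIntegral.integral_zero, add_zero]
  have h2 := intervalIntegral.integral_comp_sub_left (a := 0) (b := r)
    (fun x => heatRate F z x (r - x)) r
  simp only [sub_sub_cancel, sub_zero, sub_self] at h2
  have h1 := intervalIntegral.integral_comp_mul_left (a := 0) (b := 1)
    (fun x => heatRate F z x (r - x)) hr.ne'
  rw [mul_zero, mul_one, smul_eq_mul, eq_inv_mul_iff_mul_eq₀ hr.ne'] at h1
  rw [h2, ← h1, ← intervalIntegral.integral_const_mul]
  have hI : ∀ i, IntervalIntegrable (fun σ => (Real.sqrt σ)⁻¹ * (Real.sqrt σ)⁻¹ *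
      scaledConv (heatK2 i i) (r * σ) (F (r * (1 - σ))) z) volume 0 1 := fun i =>
    intervalIntegrable_duhInt (measurable_inv_sqrt.mul measurable_inv_sqrt)
      (isRapidKernel_heatK2 i i) hF.toIsSource
      (duhDominated_inv_sqrt_sq (isRapidKernel_heatK2 i i) (integral_heatK2 i i) hF) r z
  unfold duh2 duhInt
  rw [← intervalIntegral.integral_finsetSum fun i _ => hI i]
  refine intervalIntegral.integral_congr fun σ hσ => ?_
  rw [Set.uIcc_of_le zero_le_one] at hσ
  simp only [heatRate]
  rw [scaledConv_heatKLap (hF.cont_slice _) (hF.bound _), ← Finset.mul_sum, ← mul_inv,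
    Real.mul_self_sqrt hσ.1]
  have h3 : r - r * σ = r * (1 - σ) := by ring
  rw [h3, mul_inv]
  field_simp

theorem duh_eq_integral_rate (hF : IsLipSource F β l) (ht : 0 < t) (z : Fin N → ℝ) :
    duh F t z = ∫ s in (0 : ℝ)..t, (F s z + ∑ i, duh2 i i F s z) := by
  obtain ⟨C, hC0, hC⟩ := exists_abs_heatRate_le hF z t
  have hFc : Continuous fun s => F s z :=
    hF.cont.comp (by fun_prop : Continuous fun s : ℝ => (s, z))
  have hDc : Continuous fun s => ∑ i, duh2 i i F s z :=
    continuous_finsetSum _ fun i _ => (continuous_duh2 i i hF).comp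
      (by fun_prop : Continuous fun s : ℝ => (s, z))
  have hPc : Continuous fun s => scaledConv heatK (t - s) (F s) z :=
    (continuous_scaledConv isRapidKernel_heatK hF.cont hF.cont_bound hF.bound).comp
      (by fun_prop : Continuous fun s : ℝ => (t - s, s, z))
  have hswap : ∫ s in Set.Ioc 0 t, ∫ r in Set.Ioc 0 t, heatRate F z (r - s) s
      = ∫ r in Set.Ioc 0 t, ∫ s in Set.Ioc 0 t, heatRate F z (r - s) s := by
    symm
    refine integral_integral_swap ?_
    have hφ : Integrable (Set.indicator (Set.Ioc 0 t) fun _ : ℝ => C) :=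
      (integrable_indicator_iff measurableSet_Ioc).2 (by simp)
    have hψ : Integrable (Set.indicator (Set.Ioc 0 t) fun σ => (Real.sqrt σ)⁻¹) :=
      (integrable_indicator_iff measurableSet_Ioc).2
        ((intervalIntegrable_iff_integrableOn_Ioc_of_le ht.le).1
          (intervalIntegrable_inv_sqrt 0 t le_rfl ht.le))
    have hG := hφ.convolution_integrand (ContinuousLinearMap.mul ℝ ℝ) hψ
    rw [Measure.prod_restrict]
    refine (hG.restrict (s := Set.Ioc 0 t ×ˢ Set.Ioc 0 t)).mono'
      ((measurable_heatRate hF.toIsSource z).comp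
        ((measurable_fst.sub measurable_snd).prodMk measurable_snd)).aestronglyMeasurable ?_
    refine (ae_restrict_iff' (measurableSet_Ioc.prod measurableSet_Ioc)).2
      (Filter.Eventually.of_forall fun p hp => ?_)
    obtain ⟨⟨h1, h2⟩, h3, h4⟩ := hp
    simp only [Function.uncurry, ContinuousLinearMap.mul_apply']
    rw [Set.indicator_of_mem (show p.2 ∈ Set.Ioc 0 t from ⟨h3, h4⟩)]
    rcases le_or_gt (p.1 - p.2) 0 with h | h
    · rw [heatRate_of_nonpos h, norm_zero]
      exact mul_nonneg hC0 (Set.indicator_nonneg (fun _ _ => by positivity) _)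
    · rw [Set.indicator_of_mem (show p.1 - p.2 ∈ Set.Ioc 0 t from ⟨h, by linarith⟩)]
      exact hC _ _ (by rw [abs_of_pos h3]; exact h4)
  have hinner : ∀ s ∈ Set.Ioc 0 t, ∫ r in Set.Ioc 0 t, heatRate F z (r - s) s
      = scaledConv heatK (t - s) (F s) z - F s z := by
    intro s hs
    rw [← heat_sub_eq_integral_heatRate hF z (sub_nonneg.2 hs.2) s,
      ← intervalIntegral.integral_of_le ht.le]
    have h1 := intervalIntegral.integral_comp_sub_right (a := s) (b := t)
      (fun x => heatRate F z x s) s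
    rw [sub_self] at h1
    rw [← h1]
    have hzero : ∀ r ∈ Set.uIcc 0 s, heatRate F z (r - s) s = 0 := fun r hr => by
      rw [Set.uIcc_of_le hs.1.le] at hr
      exact heatRate_of_nonpos (by linarith [hr.2]) z s
    have hInt : IntervalIntegrable (fun r => heatRate F z (r - s) s) volume 0 s :=
      (IntervalIntegrable.congr (f := fun _ => (0 : ℝ)) (fun r hr =>
        (hzero r (Set.uIoc_subset_uIcc hr)).symm) (by simp))
    have hInt2 : IntervalIntegrable (fun r => heatRate F z (r - s) s) volume s t := by
      have := (intervalIntegrable_heatRate hF z (sub_nonneg.2 hs.2) s).comp_sub_right s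
      simpa using this
    rw [← intervalIntegral.integral_add_adjacent_intervals hInt hInt2,
      intervalIntegral.integral_congr (g := fun _ => (0 : ℝ)) hzero]
    simp
  rw [setIntegral_congr_fun measurableSet_Ioc hinner,
    ← intervalIntegral.integral_of_le ht.le, ← intervalIntegral.integral_of_le ht.le,
    intervalIntegral.integral_sub (hPc.intervalIntegrable _ _) (hFc.intervalIntegrable _ _),
    ← duh_eq_integral F ht z] at hswap
  rw [intervalIntegral.integral_add (hFc.intervalIntegrable _ _) (hDc.intervalIntegrable _ _)]
  have h5 : ∫ r in (0 : ℝ)..t, ∫ s in Set.Ioc 0 t, heatRate F z (r - s) s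
      = ∫ r in (0 : ℝ)..t, ∑ i, duh2 i i F r z := by
    refine intervalIntegral.integral_congr_ae (Filter.Eventually.of_forall fun r hr => ?_)
    rw [Set.uIoc_of_le ht.le] at hr
    rw [← intervalIntegral.integral_of_le ht.le]
    exact integral_heatRate_diag hF z hr.1 hr.2
  linarith

theorem hasDerivAt_duh (hF : IsLipSource F β l) (ht : 0 < t) (z : Fin N → ℝ) :
    HasDerivAt (fun t => duh F t z) (F t z + ∑ i, duh2 i i F t z) t := by
  have hc : Continuous fun s => F s z + ∑ i, duh2 i i F s z :=
    (hF.cont.comp (by fun_prop : Continuous fun s : ℝ => (s, z))).add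
      (continuous_finsetSum _ fun i _ => (continuous_duh2 i i hF).comp
        (by fun_prop : Continuous fun s : ℝ => (s, z)))
  refine (intervalIntegral.integral_hasDerivAt_right (hc.intervalIntegrable 0 t)
    hc.aestronglyMeasurable.stronglyMeasurableAtFilter hc.continuousAt).congr_of_eventuallyEq ?_
  filter_upwards [lt_mem_nhds ht] with s hs
  exact duh_eq_integral_rate hF hs z

end DuhamelTime

section DuhamelBounds

variable {N : ℕ} {w : ℝ → ℝ} {k : (Fin N → ℝ) → ℝ} {F G : ℝ → (Fin N → ℝ) → ℝ} {β γ : ℝ → ℝ}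
  {B r : ℝ}

theorem duhInt_sub (hw : Measurable w) (hk : IsRapidKernel k) (hF : IsSource F β)
    (hG : IsSource G γ) (hDF : DuhDominated w k F) (hDG : DuhDominated w k G) (t : ℝ)
    (z : Fin N → ℝ) :
    duhInt w k (fun s z => F s z - G s z) t z = duhInt w k F t z - duhInt w k G t z := by
  unfold duhInt
  rw [← intervalIntegral.integral_sub (intervalIntegrable_duhInt hw hk hF hDF t z)
    (intervalIntegrable_duhInt hw hk hG hDG t z)]
  refine intervalIntegral.integral_congr fun σ _ => ?_
  simp only
  rw [scaledConv_sub hk (hF.cont_slice _) (hF.bound _) (hG.cont_slice _) (hG.bound _), mul_sub]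

theorem duhInt_translate (w : ℝ → ℝ) (k : (Fin N → ℝ) → ℝ) (F : ℝ → (Fin N → ℝ) → ℝ) (t : ℝ)
    (z v : Fin N → ℝ) : duhInt w k (fun s z => F s (z + v)) t z = duhInt w k F t (z + v) := by
  unfold duhInt scaledConv
  simp only [add_right_comm]

theorem duh_sub (hF : IsSource F β) (hG : IsSource G γ) (t : ℝ) (z : Fin N → ℝ) :
    duh (fun s z => F s z - G s z) t z = duh F t z - duh G t z := by
  unfold duh
  rw [duhInt_sub measurable_const isRapidKernel_heatK hF hG (duhDominated_one isRapidKernel_heatK hF)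
    (duhDominated_one isRapidKernel_heatK hG), mul_sub]

theorem duh1_sub (i : Fin N) (hF : IsSource F β) (hG : IsSource G γ) (t : ℝ) (z : Fin N → ℝ) :
    duh1 i (fun s z => F s z - G s z) t z = duh1 i F t z - duh1 i G t z := by
  unfold duh1
  rw [duhInt_sub measurable_inv_sqrt (isRapidKernel_heatK1 i) hF hG
    (duhDominated_inv_sqrt (isRapidKernel_heatK1 i) hF)
    (duhDominated_inv_sqrt (isRapidKernel_heatK1 i) hG), mul_sub]

theorem duh_translate (F : ℝ → (Fin N → ℝ) → ℝ) (t : ℝ) (z v : Fin N → ℝ) :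
    duh (fun s z => F s (z + v)) t z = duh F t (z + v) := by
  unfold duh
  rw [duhInt_translate]

theorem duh1_translate (i : Fin N) (F : ℝ → (Fin N → ℝ) → ℝ) (t : ℝ) (z v : Fin N → ℝ) :
    duh1 i (fun s z => F s (z + v)) t z = duh1 i F t (z + v) := by
  unfold duh1
  rw [duhInt_translate]

theorem IsSource.translate (hF : IsSource F β) (v : Fin N → ℝ) :
    IsSource (fun s z => F s (z + v)) β :=
  ⟨hF.cont.comp (by fun_prop : Continuous fun p : ℝ × (Fin N → ℝ) => (p.1, p.2 + v)),
    hF.cont_bound, fun s z => hF.bound s _⟩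

theorem IsSource.sub (hF : IsSource F β) (hG : IsSource G γ) :
    IsSource (fun s z => F s z - G s z) fun s => β s + γ s :=
  ⟨hF.cont.sub hG.cont, hF.cont_bound.add hG.cont_bound, fun s z =>
    (abs_sub _ _).trans (add_le_add (hF.bound s z) (hG.bound s z))⟩

theorem integral_mul_exp_le {T : ℝ} (hr : 0 < r) :
    ∫ σ in (0 : ℝ)..1, T * Real.exp (r * (T * (1 - σ))) ≤ Real.exp (r * T) / r := by
  have h := intervalIntegral.integral_eq_sub_of_hasDerivAt_of_le zero_le_one
    (f := fun σ => -(Real.exp (r * (T * (1 - σ))) / r))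
    (f' := fun σ => T * Real.exp (r * (T * (1 - σ)))) (by fun_prop) (fun σ _ => ?_)
    (by apply Continuous.intervalIntegrable; fun_prop)
  · rw [h]
    have := Real.exp_pos (r * (T * (1 - 1)))
    have h2 : 0 ≤ Real.exp (r * (T * (1 - 1))) / r := by positivity
    simp only [sub_zero, mul_one] at *
    linarith
  · have h1 : HasDerivAt (fun σ : ℝ => r * (T * (1 - σ))) (r * (T * (-1))) σ :=
      (((hasDerivAt_id σ).const_sub 1).const_mul T).const_mul r
    refine (h1.exp.div_const r).neg.congr_deriv ?_
    field_simp

theorem integral_inv_sqrt_mul_exp_le {T : ℝ} (hT : 0 < T) (hr : 0 < r) :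
    IntervalIntegrable (fun σ => (Real.sqrt σ)⁻¹ * Real.exp (-(r * T * σ))) volume 0 1 ∧
    Real.sqrt T * ∫ σ in (0 : ℝ)..1, (Real.sqrt σ)⁻¹ * Real.exp (-(r * T * σ))
      ≤ 4 / Real.sqrt r := by
  set s := Real.sqrt (r * T) with hs
  have hs0 : 0 < s := Real.sqrt_pos.2 (by positivity)
  have hss : s * s = r * T := Real.mul_self_sqrt (by positivity)
  have hInt : IntervalIntegrable (fun σ => (Real.sqrt σ)⁻¹ * Real.exp (-(r * T * σ))) volume 0 1 :=
    (intervalIntegrable_inv_sqrt 0 1 le_rfl zero_le_one).mul_continuousOn (by fun_prop)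
  have hden : Continuous fun σ => (1 + s * Real.sqrt σ) := by fun_prop
  have hne : ∀ σ, (1 + s * Real.sqrt σ) ≠ 0 := fun σ => by positivity
  have hInt' : IntervalIntegrable (fun σ => (Real.sqrt σ)⁻¹ * (2 / (1 + s * Real.sqrt σ) ^ 2))
      volume 0 1 :=
    (intervalIntegrable_inv_sqrt 0 1 le_rfl zero_le_one).mul_continuousOn
      (Continuous.div continuous_const (hden.pow 2) fun σ => pow_ne_zero 2 (hne σ)).continuousOn
  refine ⟨hInt, ?_⟩
  have hle : ∫ σ in (0 : ℝ)..1, (Real.sqrt σ)⁻¹ * Real.exp (-(r * T * σ))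
      ≤ ∫ σ in (0 : ℝ)..1, (Real.sqrt σ)⁻¹ * (2 / (1 + s * Real.sqrt σ) ^ 2) := by
    refine intervalIntegral.integral_mono_on zero_le_one hInt hInt' fun σ hσ => ?_
    refine mul_le_mul_of_nonneg_left ?_ (by positivity)
    have h1 : s * Real.sqrt σ * (s * Real.sqrt σ) = r * T * σ := by
      rw [mul_mul_mul_comm, hss, Real.mul_self_sqrt hσ.1]
    have h2 := Real.add_one_le_exp (r * T * σ)
    rw [Real.exp_neg, le_div_iff₀ (by positivity), inv_mul_le_iff₀ (Real.exp_pos _)]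
    nlinarith [sq_nonneg (1 - s * Real.sqrt σ)]
  have hval : ∫ σ in (0 : ℝ)..1, (Real.sqrt σ)⁻¹ * (2 / (1 + s * Real.sqrt σ) ^ 2)
      = 4 / (1 + s) := by
    have h := intervalIntegral.integral_eq_sub_of_hasDerivAt_of_le zero_le_one
      (f := fun σ => 4 * Real.sqrt σ / (1 + s * Real.sqrt σ))
      (f' := fun σ => (Real.sqrt σ)⁻¹ * (2 / (1 + s * Real.sqrt σ) ^ 2))
      (Continuous.div (by fun_prop) hden hne).continuousOn (fun σ hσ => ?_) hInt'
    · rw [h]; simp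
    · have h1 := Real.hasDerivAt_sqrt hσ.1.ne'
      have h2 := (h1.const_mul 4).div ((h1.const_mul s).const_add 1) (hne σ)
      refine h2.congr_deriv ?_
      have : 0 < Real.sqrt σ := Real.sqrt_pos.2 hσ.1
      field_simp
      ring
  rw [hval] at hle
  have hsT : s = Real.sqrt r * Real.sqrt T := Real.sqrt_mul hr.le T
  have hr' : 0 < Real.sqrt r := Real.sqrt_pos.2 hr
  calc Real.sqrt T * ∫ σ in (0 : ℝ)..1, (Real.sqrt σ)⁻¹ * Real.exp (-(r * T * σ))
      ≤ Real.sqrt T * (4 / (1 + s)) := by gcongr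
    _ ≤ 4 / Real.sqrt r := by
      rw [← mul_div_assoc, div_le_div_iff₀ (by positivity) hr', hsT]
      nlinarith

theorem abs_duh_le (hF : ∀ s z, |F s z| ≤ B * Real.exp (r * |s|)) (hr : 0 < r) (t : ℝ)
    (z : Fin N → ℝ) : |duh F t z| ≤ 1 / r * (B * Real.exp (r * |t|)) := by
  have hB : 0 ≤ B := by have := (abs_nonneg _).trans (hF 0 0); simpa using this
  have h1 : |duhInt (fun _ => 1) heatK F t z|
      ≤ ∫ σ in (0 : ℝ)..1, B * Real.exp (r * (|t| * (1 - σ))) := by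
    rw [← Real.norm_eq_abs, duhInt]
    refine intervalIntegral.norm_integral_le_of_norm_le zero_le_one
      (Filter.Eventually.of_forall fun σ hσ => ?_) (by apply Continuous.intervalIntegrable; fun_prop)
    have h2 := abs_scaledConv_le isRapidKernel_heatK (hF (t * (1 - σ))) (t * σ) z
    rw [integral_abs_heatK, one_mul, abs_mul, abs_of_nonneg (by linarith [hσ.2] : 0 ≤ 1 - σ)] at h2
    rwa [one_mul]
  rw [duh, abs_mul]
  have h3 : |t| * ∫ σ in (0 : ℝ)..1, B * Real.exp (r * (|t| * (1 - σ)))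
      = B * ∫ σ in (0 : ℝ)..1, |t| * Real.exp (r * (|t| * (1 - σ))) := by
    rw [← intervalIntegral.integral_const_mul, ← intervalIntegral.integral_const_mul]
    exact intervalIntegral.integral_congr fun σ _ => by ring
  calc |t| * |duhInt (fun _ => 1) heatK F t z| ≤ _ := mul_le_mul_of_nonneg_left h1 (abs_nonneg t)
    _ = _ := h3
    _ ≤ B * (Real.exp (r * |t|) / r) := mul_le_mul_of_nonneg_left (integral_mul_exp_le hr) hB
    _ = _ := by ring

theorem abs_duh1_le (i : Fin N) (hF : ∀ s z, |F s z| ≤ B * Real.exp (r * |s|)) (hr : 0 < r)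
    (t : ℝ) (z : Fin N → ℝ) :
    |duh1 i F t z| ≤ (∫ ξ, |heatK1 i ξ|) * (4 / Real.sqrt r) * (B * Real.exp (r * |t|)) := by
  have hB : 0 ≤ B := by have := (abs_nonneg _).trans (hF 0 0); simpa using this
  have hK : 0 ≤ ∫ ξ, |heatK1 i ξ| := integral_nonneg fun ξ => abs_nonneg _
  rcases le_or_gt t 0 with ht | ht
  · rw [duh1, Real.sqrt_eq_zero_of_nonpos ht]
    simp only [neg_zero, zero_mul, abs_zero]
    positivity
  obtain ⟨hI, hle⟩ := integral_inv_sqrt_mul_exp_le ht hr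
  have h1 : |duhInt (fun σ => (Real.sqrt σ)⁻¹) (heatK1 i) F t z|
      ≤ ∫ σ in (0 : ℝ)..1, ((∫ ξ, |heatK1 i ξ|) * B * Real.exp (r * t)) *
        ((Real.sqrt σ)⁻¹ * Real.exp (-(r * t * σ))) := by
    rw [← Real.norm_eq_abs, duhInt]
    refine intervalIntegral.norm_integral_le_of_norm_le zero_le_one
      (Filter.Eventually.of_forall fun σ hσ => ?_) (hI.const_mul _)
    have h2 := abs_scaledConv_le (isRapidKernel_heatK1 i) (hF (t * (1 - σ))) (t * σ) z
    rw [abs_mul t, abs_of_pos ht, abs_of_nonneg (by linarith [hσ.2] : 0 ≤ 1 - σ)] at h2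
    rw [norm_mul, Real.norm_of_nonneg (by positivity : 0 ≤ (Real.sqrt σ)⁻¹)]
    have h3 : r * (t * (1 - σ)) = r * t + -(r * t * σ) := by ring
    rw [h3, Real.exp_add] at h2
    calc (Real.sqrt σ)⁻¹ * ‖scaledConv (heatK1 i) (t * σ) (F (t * (1 - σ))) z‖
        ≤ (Real.sqrt σ)⁻¹ * ((∫ ξ, |heatK1 i ξ|) *
          (B * (Real.exp (r * t) * Real.exp (-(r * t * σ))))) := by gcongr; exact h2
      _ = _ := by ring
  rw [intervalIntegral.integral_const_mul] at h1
  rw [duh1, abs_mul, abs_neg, abs_of_nonneg (Real.sqrt_nonneg t), abs_of_pos ht]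
  calc Real.sqrt t * |duhInt (fun σ => (Real.sqrt σ)⁻¹) (heatK1 i) F t z|
      ≤ Real.sqrt t * (((∫ ξ, |heatK1 i ξ|) * B * Real.exp (r * t)) *
        ∫ σ in (0 : ℝ)..1, (Real.sqrt σ)⁻¹ * Real.exp (-(r * t * σ))) := by gcongr
    _ = ((∫ ξ, |heatK1 i ξ|) * B * Real.exp (r * t)) * (Real.sqrt t *
        ∫ σ in (0 : ℝ)..1, (Real.sqrt σ)⁻¹ * Real.exp (-(r * t * σ))) := by ring
    _ ≤ ((∫ ξ, |heatK1 i ξ|) * B * Real.exp (r * t)) * (4 / Real.sqrt r) := by gcongr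
    _ = _ := by ring

theorem abs_duh_sub_le {L : ℝ} (hs : IsSource F β)
    (hF : ∀ s z z', |F s z - F s z'| ≤ L * Real.exp (r * |s|) * ‖z - z'‖) (hr : 0 < r) (t : ℝ)
    (z z' : Fin N → ℝ) :
    |duh F t z - duh F t z'| ≤ 1 / r * (L * Real.exp (r * |t|)) * ‖z - z'‖ := by
  have h1 : duh F t z - duh F t z' = duh (fun s y => F s y - F s (y + (z' - z))) t z := by
    rw [duh_sub hs (hs.translate _), duh_translate, add_sub_cancel]
  rw [h1]
  refine (abs_duh_le (B := L * ‖z - z'‖) (fun s y => (hF s _ _).trans_eq ?_) hr t z).trans_eq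
    (by ring)
  rw [sub_add_cancel_left, norm_neg, norm_sub_rev]
  ring

theorem abs_duh1_sub_le {L : ℝ} (i : Fin N) (hs : IsSource F β)
    (hF : ∀ s z z', |F s z - F s z'| ≤ L * Real.exp (r * |s|) * ‖z - z'‖) (hr : 0 < r) (t : ℝ)
    (z z' : Fin N → ℝ) :
    |duh1 i F t z - duh1 i F t z'| ≤ (∫ ξ, |heatK1 i ξ|) * (4 / Real.sqrt r) *
      (L * Real.exp (r * |t|)) * ‖z - z'‖ := by
  have h1 : duh1 i F t z - duh1 i F t z' = duh1 i (fun s y => F s y - F s (y + (z' - z))) t z := by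
    rw [duh1_sub i hs (hs.translate _), duh1_translate, add_sub_cancel]
  rw [h1]
  refine (abs_duh1_le (B := L * ‖z - z'‖) i (fun s y => (hF s _ _).trans_eq ?_) hr t z).trans_eq
    (by ring)
  rw [sub_add_cancel_left, norm_neg, norm_sub_rev]
  ring

end DuhamelBounds

section MildSolution

open Set BoundedContinuousFunction

variable {N : ℕ}

/-- Regularity and growth of a right-hand side `Φ(z, (R, ∂_i R))`, periodic with respect to the
translations in `S`. -/
structure IsSemilinear (Φ : (Fin N → ℝ) → ℝ × ℝ → ℝ) (K : ℝ) (S : Set (Fin N → ℝ)) : Prop where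
  cont : Continuous fun p : (Fin N → ℝ) × (ℝ × ℝ) => Φ p.1 p.2
  lip : ∀ z v v', |Φ z v - Φ z v'| ≤ K * ‖v - v'‖
  lip_space : ∀ z z' v, |Φ z v - Φ z' v| ≤ K * (1 + ‖v‖) * ‖z - z'‖
  zero : ∀ z, |Φ z 0| ≤ K
  periodic : ∀ a ∈ S, ∀ z, Φ (z + a) = Φ z

/-- The Duhamel integral together with its derivative in direction `i`, with exponential weight. -/
def duhPair (i : Fin N) (r : ℝ) (F : ℝ → (Fin N → ℝ) → ℝ) (p : ℝ × (Fin N → ℝ)) : ℝ × ℝ :=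
  (Real.exp (-(r * |p.1|)) * duh F p.1 p.2, Real.exp (-(r * |p.1|)) * duh1 i F p.1 p.2)

variable {F G : ℝ → (Fin N → ℝ) → ℝ} {β γ : ℝ → ℝ} {B r κ : ℝ} {i : Fin N}

theorem continuous_duhPair (hF : IsSource F β) : Continuous (duhPair i r F) := by
  have h1 := continuous_duh hF
  have h2 := continuous_duh1 i hF
  unfold duhPair
  fun_prop

theorem exp_neg_mul_le_of_le {x e C : ℝ} (h : x ≤ κ * (C * Real.exp e)) :
    Real.exp (-e) * x ≤ κ * C := by
  calc Real.exp (-e) * x ≤ Real.exp (-e) * (κ * (C * Real.exp e)) := by gcongr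
    _ = κ * C * (Real.exp (-e) * Real.exp e) := by ring
    _ = κ * C := by rw [← Real.exp_add, neg_add_cancel, Real.exp_zero, mul_one]

theorem norm_duhPair_le (hr : 0 < r) (h0 : 1 / r ≤ κ)
    (h1 : (∫ ξ, |heatK1 i ξ|) * (4 / Real.sqrt r) ≤ κ)
    (hF : ∀ s z, |F s z| ≤ B * Real.exp (r * |s|)) (p : ℝ × (Fin N → ℝ)) :
    ‖duhPair i r F p‖ ≤ κ * B := by
  have hB : 0 ≤ B := by have := (abs_nonneg _).trans (hF 0 0); simpa using this
  refine max_le ?_ ?_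
  · simp only [duhPair]
    rw [norm_mul, Real.norm_of_nonneg (Real.exp_nonneg _)]
    refine exp_neg_mul_le_of_le ((abs_duh_le hF hr _ _).trans ?_)
    gcongr
  · simp only [duhPair]
    rw [norm_mul, Real.norm_of_nonneg (Real.exp_nonneg _)]
    refine exp_neg_mul_le_of_le ((abs_duh1_le i hF hr _ _).trans ?_)
    gcongr

theorem norm_duhPair_sub_le (hr : 0 < r) (h0 : 1 / r ≤ κ)
    (h1 : (∫ ξ, |heatK1 i ξ|) * (4 / Real.sqrt r) ≤ κ) (hs : IsSource F β) {L : ℝ} (hL : 0 ≤ L)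
    (hF : ∀ s z z', |F s z - F s z'| ≤ L * Real.exp (r * |s|) * ‖z - z'‖) (t : ℝ)
    (z z' : Fin N → ℝ) :
    ‖duhPair i r F (t, z) - duhPair i r F (t, z')‖ ≤ κ * L * ‖z - z'‖ := by
  have h3 : κ * L * ‖z - z'‖ = κ * (L * ‖z - z'‖) := by ring
  rw [h3]
  refine max_le ?_ ?_
  · simp only [duhPair, Prod.mk_sub_mk]
    rw [← mul_sub, norm_mul, Real.norm_of_nonneg (Real.exp_nonneg _)]
    refine exp_neg_mul_le_of_le ((abs_duh_sub_le hs hF hr _ _ _).trans ?_)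
    calc 1 / r * (L * Real.exp (r * |t|)) * ‖z - z'‖
        ≤ κ * (L * Real.exp (r * |t|)) * ‖z - z'‖ := by gcongr
      _ = _ := by ring
  · simp only [duhPair, Prod.mk_sub_mk]
    rw [← mul_sub, norm_mul, Real.norm_of_nonneg (Real.exp_nonneg _)]
    refine exp_neg_mul_le_of_le ((abs_duh1_sub_le i hs hF hr _ _ _).trans ?_)
    calc (∫ ξ, |heatK1 i ξ|) * (4 / Real.sqrt r) * (L * Real.exp (r * |t|)) * ‖z - z'‖
        ≤ κ * (L * Real.exp (r * |t|)) * ‖z - z'‖ := by gcongr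
      _ = _ := by ring

theorem duhPair_sub (hF : IsSource F β) (hG : IsSource G γ) (p : ℝ × (Fin N → ℝ)) :
    duhPair i r F p - duhPair i r G p = duhPair i r (fun s z => F s z - G s z) p := by
  simp only [duhPair, duh_sub hF hG, duh1_sub i hF hG, Prod.mk_sub_mk, mul_sub]

theorem duhPair_periodic {a : Fin N → ℝ} (hF : ∀ s z, F s (z + a) = F s z) (t : ℝ)
    (z : Fin N → ℝ) : duhPair i r F (t, z + a) = duhPair i r F (t, z) := by
  simp only [duhPair, ← duh_translate F t z a, ← duh1_translate i F t z a, hF]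

theorem exists_rate (C K : ℝ) (hC : 0 ≤ C) (hK : 0 ≤ K) :
    ∃ r κ : ℝ, 0 < r ∧ 0 ≤ κ ∧ 1 / r ≤ κ ∧ C * (4 / Real.sqrt r) ≤ κ ∧ κ * (3 * K) ≤ 1 := by
  refine ⟨((4 * (C + 1)) * (3 * K + 1)) ^ 2, 1 / (3 * K + 1), by positivity, by positivity, ?_, ?_,
    ?_⟩
  · refine one_div_le_one_div_of_le (by positivity) ?_
    nlinarith [mul_nonneg hC hK, mul_nonneg hK hK, mul_nonneg hC hC,
      mul_nonneg (mul_nonneg hC hC) hK, mul_nonneg (mul_nonneg hC hK) hK,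
      mul_nonneg (mul_nonneg hC hC) (mul_nonneg hK hK)]
  · rw [Real.sqrt_sq (by positivity), ← mul_div_assoc, div_le_div_iff₀ (by positivity)
      (by positivity)]
    nlinarith [mul_nonneg hC hK]
  · rw [one_div, inv_mul_le_iff₀ (by positivity)]
    linarith

theorem exists_mild_solution {Φ : (Fin N → ℝ) → ℝ × ℝ → ℝ} {K : ℝ} {S : Set (Fin N → ℝ)}
    (hΦ : IsSemilinear Φ K S) (i : Fin N) :
    ∃ (F : ℝ → (Fin N → ℝ) → ℝ) (β l : ℝ → ℝ) (r : ℝ), IsLipSource F β l ∧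
      (∀ s z, F s z = Φ z (duh F s z, duh1 i F s z)) ∧
      (∀ t z, |duh F t z| ≤ Real.exp (r * |t|)) ∧
      (∀ a ∈ S, ∀ t z, duh F t (z + a) = duh F t z) := by
  have hK : 0 ≤ K := (abs_nonneg _).trans (hΦ.zero 0)
  obtain ⟨r, κ, hr, hκ, h0, h1, h3⟩ := exists_rate (∫ ξ, |heatK1 i ξ|) K
    (integral_nonneg fun ξ => abs_nonneg _) hK
  set e : ℝ → ℝ := fun s => Real.exp (r * |s|) with he
  have hec : Continuous e := by fun_prop
  have he1 : ∀ s, 1 ≤ e s := fun s => Real.one_le_exp (by positivity)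
  have he0 : ∀ s, 0 ≤ e s := fun s => zero_le_one.trans (he1 s)
  let src : (ℝ × (Fin N → ℝ) →ᵇ ℝ × ℝ) → ℝ → (Fin N → ℝ) → ℝ := fun X s z => Φ z (e s • X (s, z))
  have hne : ∀ (s : ℝ) (v : ℝ × ℝ), ‖e s • v‖ = e s * ‖v‖ := fun s v => by
    rw [norm_smul, Real.norm_of_nonneg (he0 s)]
  have hbd : ∀ X s z, |src X s z| ≤ K * (1 + ‖X‖) * e s := fun X s z => by
    have h4 := hΦ.lip z (e s • X (s, z)) 0
    rw [sub_zero, hne] at h4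
    have h5 : |src X s z| ≤ |src X s z - Φ z 0| + |Φ z 0| := by
      simpa using abs_add_le (src X s z - Φ z 0) (Φ z 0)
    have h6 : K * (e s * ‖X (s, z)‖) ≤ K * (e s * ‖X‖) := by
      gcongr
      exact X.norm_coe_le_norm _
    nlinarith [hΦ.zero z, he1 s, mul_nonneg hK (sub_nonneg.2 (he1 s))]
  have hsrc : ∀ X, IsSource (src X) fun s => K * (1 + ‖X‖) * e s := fun X =>
    ⟨hΦ.cont.comp (by fun_prop : Continuous fun p : ℝ × (Fin N → ℝ) => (p.2, e p.1 • X (p.1, p.2))),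
      by fun_prop, hbd X⟩
  have hex : ∀ X, ∃ Y : ℝ × (Fin N → ℝ) →ᵇ ℝ × ℝ, ∀ p, Y p = duhPair i r (src X) p := fun X =>
    ⟨ofNormedAddCommGroup (duhPair i r (src X)) (continuous_duhPair (hsrc X)) _
      (norm_duhPair_le hr h0 h1 (hbd X)), fun p => rfl⟩
  choose Γ hΓ using hex
  let D : Set (ℝ × (Fin N → ℝ) →ᵇ ℝ × ℝ) := {X | (∀ p, ‖X p‖ ≤ 1) ∧
    (∀ t z z', ‖X (t, z) - X (t, z')‖ ≤ ‖z - z'‖) ∧ ∀ a ∈ S, ∀ t z, X (t, z + a) = X (t, z)}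
  have hDc : IsClosed D := by
    have hev : ∀ p : ℝ × (Fin N → ℝ), Continuous fun X : ℝ × (Fin N → ℝ) →ᵇ ℝ × ℝ => X p :=
      fun p => continuous_eval_const p
    have h4 : IsClosed {X : ℝ × (Fin N → ℝ) →ᵇ ℝ × ℝ | ∀ p, ‖X p‖ ≤ 1} := by
      simp only [ofPred_forall]
      exact isClosed_iInter fun p => isClosed_le (hev p).norm continuous_const
    have h5 : IsClosed {X : ℝ × (Fin N → ℝ) →ᵇ ℝ × ℝ |
        ∀ t z z', ‖X (t, z) - X (t, z')‖ ≤ ‖z - z'‖} := by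
      simp only [ofPred_forall]
      exact isClosed_iInter fun t => isClosed_iInter fun z => isClosed_iInter fun z' =>
        isClosed_le ((hev _).sub (hev _)).norm continuous_const
    have h6 : IsClosed {X : ℝ × (Fin N → ℝ) →ᵇ ℝ × ℝ |
        ∀ a ∈ S, ∀ t z, X (t, z + a) = X (t, z)} := by
      simp only [ofPred_forall]
      exact isClosed_iInter fun a => isClosed_iInter fun _ => isClosed_iInter fun t =>
        isClosed_iInter fun z => isClosed_eq (hev _) (hev _)
    exact h4.inter (h5.inter h6)
  have hlip : ∀ X ∈ D, ∀ s z z', |src X s z - src X s z'| ≤ 3 * K * e s * ‖z - z'‖ := by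
    intro X hX s z z'
    have h4 := hΦ.lip z' (e s • X (s, z)) (e s • X (s, z'))
    rw [← smul_sub, hne] at h4
    have h5 := hΦ.lip_space z z' (e s • X (s, z))
    rw [hne] at h5
    have h6 := abs_sub_le (src X s z) (Φ z' (e s • X (s, z))) (src X s z')
    have h7 : K * (e s * ‖X (s, z) - X (s, z')‖) ≤ K * (e s * ‖z - z'‖) := by
      gcongr
      exact hX.2.1 _ _ _
    have h8 : K * (1 + e s * ‖X (s, z)‖) * ‖z - z'‖ ≤ K * (e s + e s * 1) * ‖z - z'‖ := by
      gcongr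
      · exact he1 s
      · exact hX.1 _
    calc _ ≤ _ := h6
      _ ≤ K * (e s + e s * 1) * ‖z - z'‖ + K * (e s * ‖z - z'‖) :=
        add_le_add (h5.trans h8) (h4.trans h7)
      _ = _ := by ring
  have hper : ∀ X ∈ D, ∀ a ∈ S, ∀ s z, src X s (z + a) = src X s z := fun X hX a ha s z => by
    simp only [src, hX.2.2 a ha, hΦ.periodic a ha]
  have hmaps : MapsTo Γ D D := by
    intro X hX
    refine ⟨fun p => ?_, fun t z z' => ?_, fun a ha t z => ?_⟩
    · rw [hΓ]
      have hX1 : ‖X‖ ≤ 1 := (norm_le zero_le_one).2 hX.1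
      refine (norm_duhPair_le hr h0 h1 (hbd X) p).trans (le_trans ?_ h3)
      exact mul_le_mul_of_nonneg_left (by nlinarith) hκ
    · rw [hΓ, hΓ]
      refine (norm_duhPair_sub_le hr h0 h1 (hsrc X) (by positivity) (hlip X hX) t z z').trans ?_
      nlinarith [norm_nonneg (z - z')]
    · rw [hΓ, hΓ, duhPair_periodic (hper X hX a ha)]
  have hdist : ∀ X Y, dist (Γ X) (Γ Y) ≤ (1 / 2 : NNReal) * dist X Y := fun X Y => by
    refine (dist_le (by positivity)).2 fun p => ?_
    rw [hΓ, hΓ, dist_eq_norm, duhPair_sub (hsrc X) (hsrc Y)]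
    have h4 : ∀ s z, |src X s z - src Y s z| ≤ K * dist X Y * e s := fun s z => by
      have h5 := hΦ.lip z (e s • X (s, z)) (e s • Y (s, z))
      rw [← smul_sub, hne, ← dist_eq_norm] at h5
      have h6 : K * (e s * dist (X (s, z)) (Y (s, z))) ≤ K * (e s * dist X Y) := by
        gcongr
        exact dist_coe_le_dist _
      calc _ ≤ _ := h5.trans h6
        _ = _ := by ring
    refine (norm_duhPair_le hr h0 h1 h4 p).trans ?_
    have h7 : κ * K ≤ 1 / 2 := by nlinarith
    have h8 : ((1 / 2 : NNReal) : ℝ) = 1 / 2 := by push_cast; rfl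
    rw [h8, ← mul_assoc]
    gcongr
  have hcontr : ContractingWith (1 / 2) (hmaps.restrict Γ D D) :=
    ⟨NNReal.half_lt_self one_ne_zero, LipschitzWith.of_dist_le_mul fun X Y => hdist X Y⟩
  obtain ⟨X, hX, hfix, -⟩ := hcontr.exists_fixedPoint' hDc.isComplete hmaps (x := 0)
    ⟨fun p => by simp, fun t z z' => by simp, fun a _ t z => rfl⟩ (edist_ne_top _ _)
  have hX' : ∀ s z, e s • X (s, z) = (duh (src X) s z, duh1 i (src X) s z) := fun s z => by
    have h4 : X (s, z) = duhPair i r (src X) (s, z) := by rw [← hΓ, hfix]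
    have h5 : e s * Real.exp (-(r * |s|)) = 1 := by
      rw [he, ← Real.exp_add, add_neg_cancel, Real.exp_zero]
    rw [h4]
    simp only [duhPair, Prod.smul_mk, smul_eq_mul, ← mul_assoc, h5, one_mul]
  refine ⟨src X, _, fun s => 3 * K * e s, r, ⟨hsrc X, by fun_prop, hlip X hX⟩, fun s z => ?_,
    fun t z => ?_, fun a ha t z => ?_⟩
  · rw [← hX']
  · have h4 : duh (src X) t z = (e t • X (t, z)).1 := by rw [hX']
    have h5 : |duh (src X) t z| ≤ ‖e t • X (t, z)‖ := by rw [h4]; exact norm_fst_le (e t • X (t, z))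
    rw [hne] at h5
    exact h5.trans (mul_le_of_le_one_right (he0 t) (hX.1 _))
  · rw [← duh_translate]
    simp only [hper X hX a ha]

end MildSolution

section PdCalculus

variable {N : ℕ} {f g : (Fin N → ℝ) → ℝ} {z : Fin N → ℝ}

theorem pd_add (i : Fin N) (hf : DifferentiableAt ℝ f z) (hg : DifferentiableAt ℝ g z) :
    pd i (fun z => f z + g z) z = pd i f z + pd i g z :=
  (hf.hasFDerivAt.add hg.hasFDerivAt).pd_eq i

theorem pd_mul (i : Fin N) (hf : DifferentiableAt ℝ f z) (hg : DifferentiableAt ℝ g z) :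
    pd i (fun z => f z * g z) z = f z * pd i g z + g z * pd i f z := by
  exact (hf.hasFDerivAt.mul hg.hasFDerivAt).pd_eq i

theorem pd_const_mul (i : Fin N) (c : ℝ) (hf : DifferentiableAt ℝ f z) :
    pd i (fun z => c * f z) z = c * pd i f z := by
  rw [(hf.hasFDerivAt.const_mul c).pd_eq i]
  rfl

theorem pd_const (i : Fin N) (c : ℝ) : pd i (fun _ => c) z = 0 :=
  (hasFDerivAt_const c z).pd_eq i

theorem pd_comp (i : Fin N) {ψ : ℝ → ℝ} (hψ : DifferentiableAt ℝ ψ (g z))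
    (hg : DifferentiableAt ℝ g z) :
    pd i (fun z => ψ (g z)) z = deriv ψ (g z) * pd i g z := by
  exact (hψ.hasDerivAt.comp_hasFDerivAt z hg.hasFDerivAt).pd_eq i

theorem lap_add (hf : ContDiff ℝ 2 f) (hg : ContDiff ℝ 2 g) (z : Fin N → ℝ) :
    lap (fun z => f z + g z) z = lap f z + lap g z := by
  unfold lap
  rw [← Finset.sum_add_distrib]
  refine Finset.sum_congr rfl fun i _ => ?_
  have h1 : pd i (fun z => f z + g z) = fun z => pd i f z + pd i g z := funext fun z =>
    pd_add i (hf.differentiable two_ne_zero z) (hg.differentiable two_ne_zero z)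
  rw [h1]
  exact pd_add i ((contDiff_pd hf i).differentiable one_ne_zero z)
    ((contDiff_pd hg i).differentiable one_ne_zero z)

theorem lap_const_mul (c : ℝ) (hf : ContDiff ℝ 2 f) (z : Fin N → ℝ) :
    lap (fun z => c * f z) z = c * lap f z := by
  unfold lap
  rw [Finset.mul_sum]
  refine Finset.sum_congr rfl fun i _ => ?_
  have h1 : pd i (fun z => c * f z) = fun z => c * pd i f z := funext fun z =>
    pd_const_mul i c (hf.differentiable two_ne_zero z)
  rw [h1]
  exact pd_const_mul i c ((contDiff_pd hf i).differentiable one_ne_zero z)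

theorem lap_const (c : ℝ) (z : Fin N → ℝ) : lap (fun _ => c) z = 0 := by
  unfold lap
  refine Finset.sum_eq_zero fun i _ => ?_
  have h1 : pd i (fun _ : Fin N → ℝ => c) = fun _ => 0 := funext fun z => pd_const i c
  rw [h1, pd_const]

theorem lap_comp {ψ : ℝ → ℝ} (hψ : ContDiff ℝ 2 ψ) (hg : ContDiff ℝ 2 g) (z : Fin N → ℝ) :
    lap (fun z => ψ (g z)) z
      = deriv (deriv ψ) (g z) * ∑ i, pd i g z ^ 2 + deriv ψ (g z) * lap g z := by
  unfold lap
  rw [Finset.mul_sum, Finset.mul_sum, ← Finset.sum_add_distrib]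
  refine Finset.sum_congr rfl fun i _ => ?_
  have hψ' : ContDiff ℝ 1 (deriv ψ) := by
    rw [show (2 : WithTop ℕ∞) = 1 + 1 by norm_num, contDiff_succ_iff_deriv] at hψ
    exact hψ.2.2
  have hg' := hg.differentiable two_ne_zero
  have h1 : pd i (fun z => ψ (g z)) = fun z => deriv ψ (g z) * pd i g z := funext fun z =>
    pd_comp i (hψ.differentiable two_ne_zero _) (hg' z)
  have h2 := hψ'.differentiable one_ne_zero
  have h3 : DifferentiableAt ℝ (fun z => deriv ψ (g z)) z := (h2 _).comp z (hg' z)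
  rw [h1, pd_mul i h3 ((contDiff_pd hg i).differentiable one_ne_zero z),
    pd_comp i (h2 _) (hg' z)]
  ring

theorem pd_coord (i j : Fin N) : pd i (fun z : Fin N → ℝ => z j) z = if i = j then 1 else 0 := by
  refine ((ContinuousLinearMap.proj (R := ℝ) (φ := fun _ : Fin N => ℝ) j).hasFDerivAt.pd_eq i).trans
    ?_
  simp [Pi.single_apply, eq_comm]

theorem lap_coord (j : Fin N) (z : Fin N → ℝ) : lap (fun z : Fin N → ℝ => z j) z = 0 := by
  unfold lap
  refine Finset.sum_eq_zero fun i _ => ?_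
  have h1 : pd i (fun z : Fin N → ℝ => z j) = fun _ => if i = j then 1 else 0 :=
    funext fun z => pd_coord i j
  rw [h1, pd_const]

end PdCalculus

section Periodic

variable {N m : ℕ} {h : ℝ} {Y : Type*}

/-- A function periodic in the coordinates selected by `e` takes all its values on points whose
selected coordinates lie in `[0,h]`. -/
theorem exists_eq_of_periodic (hh : 0 < h) {e : Fin m → Fin N} (he : Function.Injective e)
    {g : (Fin N → ℝ) → Y} (hg : ∀ z j, g (z + Pi.single (e j) h) = g z) (z : Fin N → ℝ) :
    ∃ z', g z' = g z ∧ (∀ j, z' (e j) ∈ Set.Icc 0 h) ∧ ∀ i, (∀ j, e j ≠ i) → z' i = z i := by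
  classical
  have key : ∀ s : Finset (Fin m), ∃ z', g z' = g z ∧ (∀ j ∈ s, z' (e j) ∈ Set.Icc 0 h) ∧
      ∀ i, (∀ j ∈ s, e j ≠ i) → z' i = z i := by
    intro s
    induction s using Finset.induction_on with
    | empty => exact ⟨z, rfl, by simp, by simp⟩
    | insert a s ha ih =>
      obtain ⟨z', h1, h2, h3⟩ := ih
      have hper : Function.Periodic (fun r => g (Function.update z' (e a) r)) h := fun r => by
        simp only
        rw [← hg (Function.update z' (e a) r) a]
        congr 1
        ext i
        by_cases hi : i = e a
        · subst hi; simp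
        · simp [Function.update_of_ne hi, Pi.single_eq_of_ne hi]
      obtain ⟨r, hr, hr'⟩ := hper.exists_mem_Ico₀ hh (z' (e a))
      simp only [Function.update_eq_self] at hr'
      refine ⟨Function.update z' (e a) r, hr'.symm.trans h1, fun j hj => ?_, fun i hi => ?_⟩
      · rcases Finset.mem_insert.1 hj with rfl | hj
        · simpa using ⟨hr.1, hr.2.le⟩
        · rw [Function.update_of_ne]
          · exact h2 j hj
          · intro hja
            exact ha (he hja ▸ hj)
      · rw [Function.update_of_ne]
        · exact h3 i fun j hj => hi j (Finset.mem_insert_of_mem hj)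
        · exact fun h => hi a (Finset.mem_insert_self _ _) h.symm
  obtain ⟨z', h1, h2, h3⟩ := key Finset.univ
  exact ⟨z', h1, fun j => h2 j (Finset.mem_univ _), fun i hi => h3 i fun j _ => hi j⟩

/-- Periodicity with period `h` in every coordinate. -/
def IsCellPeriodic (h : ℝ) (g : (Fin m → ℝ) → Y) : Prop :=
  ∀ y, ∀ j : Fin m, g (y + Pi.single j h) = g y

theorem IsCellPeriodic.exists_eq (hh : 0 < h) {g : (Fin m → ℝ) → Y} (hg : IsCellPeriodic h g)
    (y : Fin m → ℝ) : ∃ y' ∈ Set.Icc (0 : Fin m → ℝ) (fun _ => h), g y' = g y := by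
  obtain ⟨y', h1, h2, -⟩ := exists_eq_of_periodic hh Function.injective_id hg y
  exact ⟨y', ⟨fun j => (h2 j).1, fun j => (h2 j).2⟩, h1⟩

theorem IsCellPeriodic.exists_norm_le [NormedAddCommGroup Y] (hh : 0 < h) {g : (Fin m → ℝ) → Y}
    (hg : IsCellPeriodic h g) (hc : Continuous g) : ∃ B, 0 ≤ B ∧ ∀ y, ‖g y‖ ≤ B := by
  obtain ⟨B, hB⟩ := (isCompact_Icc (a := (0 : Fin m → ℝ)) (b := fun _ => h)).exists_bound_of_continuousOn
    hc.continuousOn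
  refine ⟨max B 0, le_max_right _ _, fun y => ?_⟩
  obtain ⟨y', hy', he⟩ := hg.exists_eq hh y
  rw [← he]
  exact le_max_of_le_left (hB y' hy')

/-- Bounded and Lipschitz real functions. -/
def IsBddLip {E : Type*} [NormedAddCommGroup E] (g : E → ℝ) (C : ℝ) : Prop :=
  (∀ z, |g z| ≤ C) ∧ ∀ z z', |g z - g z'| ≤ C * ‖z - z'‖

theorem IsCellPeriodic.exists_isBddLip (hh : 0 < h) {g : (Fin m → ℝ) → ℝ} (hg : IsCellPeriodic h g)
    (hc : ContDiff ℝ 1 g) : ∃ C, IsBddLip g C := by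
  obtain ⟨B, hB0, hB⟩ := hg.exists_norm_le hh hc.continuous
  have hg' : IsCellPeriodic h (fderiv ℝ g) := fun y j => by
    rw [← fderiv_comp_add_right]
    congr 1
    exact funext fun y => hg y j
  obtain ⟨B', hB0', hB'⟩ := hg'.exists_norm_le hh (hc.continuous_fderiv one_ne_zero)
  refine ⟨max B B', fun z => le_max_of_le_left (hB z), fun z z' => ?_⟩
  refine (convex_univ.norm_image_sub_le_of_norm_fderiv_le
    (fun x _ => hc.differentiable one_ne_zero x) (fun x _ => hB' x) (Set.mem_univ z')
    (Set.mem_univ z)).trans ?_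
  gcongr
  exact le_max_right _ _

section BddLip

variable {E : Type*} [NormedAddCommGroup E] {f g : E → ℝ} {C D : ℝ}

theorem IsBddLip.nonneg (hf : IsBddLip f C) : 0 ≤ C := (abs_nonneg _).trans (hf.1 0)

theorem IsBddLip.continuous (hf : IsBddLip f C) : Continuous f :=
  (LipschitzWith.of_dist_le_mul (K := ⟨C, hf.nonneg⟩) fun z z' => by
    rw [Real.dist_eq, dist_eq_norm]; exact hf.2 z z').continuous

theorem IsBddLip.add (hf : IsBddLip f C) (hg : IsBddLip g D) :
    IsBddLip (fun z => f z + g z) (C + D) :=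
  ⟨fun z => (abs_add_le _ _).trans (add_le_add (hf.1 z) (hg.1 z)), fun z z' => by
    rw [add_sub_add_comm, add_mul]
    exact (abs_add_le _ _).trans (add_le_add (hf.2 z z') (hg.2 z z'))⟩

theorem IsBddLip.mul (hf : IsBddLip f C) (hg : IsBddLip g D) :
    IsBddLip (fun z => f z * g z) (2 * (C * D)) := by
  have hC := hf.nonneg
  have hD := hg.nonneg
  refine ⟨fun z => ?_, fun z z' => ?_⟩
  · rw [abs_mul]
    have := mul_le_mul (hf.1 z) (hg.1 z) (abs_nonneg _) hC
    nlinarith [mul_nonneg hC hD]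
  · have h1 : f z * g z - f z' * g z' = f z * (g z - g z') + (f z - f z') * g z' := by ring
    have h2 := mul_le_mul (hf.1 z) (hg.2 z z') (abs_nonneg _) hC
    have h3 := mul_le_mul (hf.2 z z') (hg.1 z') (abs_nonneg _) (by positivity)
    rw [h1]
    refine (abs_add_le _ _).trans ?_
    rw [abs_mul, abs_mul]
    linarith

theorem IsBddLip.const (E : Type*) [NormedAddCommGroup E] (c : ℝ) :
    IsBddLip (fun _ : E => c) |c| :=
  ⟨fun _ => le_rfl, fun _ _ => by rw [sub_self, abs_zero]; positivity⟩

theorem IsBddLip.comp {F : Type*} [NormedAddCommGroup F] (hf : IsBddLip f C) {φ : F → E}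
    (hφ : ∀ x y, ‖φ x - φ y‖ ≤ ‖x - y‖) : IsBddLip (fun z => f (φ z)) C :=
  ⟨fun _ => hf.1 _, fun z z' => (hf.2 _ _).trans
    (mul_le_mul_of_nonneg_left (hφ z z') hf.nonneg)⟩

end BddLip

end Periodic

section ExistenceShear

open Set

theorem isSemilinear_affine {N : ℕ} {g₁ g₂ g₃ : (Fin N → ℝ) → ℝ} {φ : ℝ → ℝ} {C₁ C₂ C₃ D : ℝ}
    {S : Set (Fin N → ℝ)} (h₁ : IsBddLip g₁ C₁) (h₂ : IsBddLip g₂ C₂) (h₃ : IsBddLip g₃ C₃)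
    (hφ : IsBddLip φ D) (hS : ∀ a ∈ S, ∀ z, g₁ (z + a) = g₁ z ∧ g₂ (z + a) = g₂ z ∧
      g₃ (z + a) = g₃ z) :
    IsSemilinear (fun z v => g₁ z + g₂ z * v.2 + φ (g₃ z + v.1)) (C₁ + C₂ + D * (1 + C₃)) S := by
  have hC₁ := h₁.nonneg
  have hC₂ := h₂.nonneg
  have hC₃ := h₃.nonneg
  have hD := hφ.nonneg
  have hDC := mul_nonneg hD hC₃
  have hn : ∀ v : ℝ × ℝ, |v.1| ≤ ‖v‖ ∧ |v.2| ≤ ‖v‖ := fun v => ⟨norm_fst_le v, norm_snd_le v⟩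
  refine ⟨?_, fun z v v' => ?_, fun z z' v => ?_, fun z => ?_, fun a ha z => ?_⟩
  · have := h₁.continuous
    have := h₂.continuous
    have := h₃.continuous
    have := hφ.continuous
    fun_prop
  · have h4 : g₁ z + g₂ z * v.2 + φ (g₃ z + v.1) - (g₁ z + g₂ z * v'.2 + φ (g₃ z + v'.1))
        = g₂ z * (v - v').2 + (φ (g₃ z + v.1) - φ (g₃ z + v'.1)) := by
      rw [Prod.snd_sub]; ring
    have h5 := hφ.2 (g₃ z + v.1) (g₃ z + v'.1)
    rw [add_sub_add_left_eq_sub, ← Prod.fst_sub, Real.norm_eq_abs] at h5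
    have h6 := mul_le_mul (h₂.1 z) (hn (v - v')).2 (abs_nonneg _) hC₂
    have h7 := mul_le_mul_of_nonneg_left (hn (v - v')).1 hD
    rw [h4]
    refine (abs_add_le _ _).trans ?_
    rw [abs_mul]
    nlinarith [norm_nonneg (v - v'), mul_nonneg hC₁ (norm_nonneg (v - v')),
      mul_nonneg hDC (norm_nonneg (v - v'))]
  · have h4 : g₁ z + g₂ z * v.2 + φ (g₃ z + v.1) - (g₁ z' + g₂ z' * v.2 + φ (g₃ z' + v.1))
        = (g₁ z - g₁ z') + (g₂ z - g₂ z') * v.2 + (φ (g₃ z + v.1) - φ (g₃ z' + v.1)) := by ring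
    have h5 := hφ.2 (g₃ z + v.1) (g₃ z' + v.1)
    rw [add_sub_add_right_eq_sub, Real.norm_eq_abs] at h5
    have h6 := mul_le_mul (h₂.2 z z') (hn v).2 (abs_nonneg _) (by positivity)
    have h7 := mul_le_mul_of_nonneg_left (h₃.2 z z') hD
    have hd := norm_nonneg (z - z')
    rw [h4]
    refine (abs_add_three _ _ _).trans ?_
    rw [abs_mul]
    nlinarith [h₁.2 z z', mul_nonneg hC₁ (mul_nonneg (norm_nonneg v) hd), mul_nonneg hC₂ hd,
      mul_nonneg hD hd, mul_nonneg hD (mul_nonneg (norm_nonneg v) hd),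
      mul_nonneg hDC (mul_nonneg (norm_nonneg v) hd)]
  · have h4 := h₁.1 z
    have h5 := hφ.1 (g₃ z + 0)
    simp only [Prod.snd_zero, mul_zero, Prod.fst_zero, add_zero] at h5 ⊢
    refine (abs_add_le _ _).trans ?_
    nlinarith
  · obtain ⟨e1, e2, e3⟩ := hS a ha z
    simp only [e1, e2, e3]

theorem HasCompactSupport.exists_isBddLip {ψ : ℝ → ℝ} (hψ : ContDiff ℝ 1 ψ)
    (hs : HasCompactSupport ψ) : ∃ C, IsBddLip ψ C := by
  obtain ⟨B, hB⟩ := hs.exists_bound_of_continuous hψ.continuous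
  obtain ⟨L, hL⟩ := hψ.lipschitzWith_of_hasCompactSupport hs one_ne_zero
  refine ⟨max B L, fun z => le_max_of_le_left (hB z), fun z z' => ?_⟩
  have h1 := hL.dist_le_mul z z'
  rw [Real.dist_eq, dist_eq_norm] at h1
  refine h1.trans ?_
  gcongr
  exact le_max_right _ _

/-- Extension of a function on `[0,1]` by its boundary values. -/
def clampExtend (f : ℝ → ℝ) (s : ℝ) : ℝ := f (projIcc (0 : ℝ) 1 zero_le_one s)

theorem clampExtend_of_mem {f : ℝ → ℝ} {s : ℝ} (hs : s ∈ Icc (0 : ℝ) 1) :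
    clampExtend f s = f s := by
  rw [clampExtend, projIcc_of_mem _ hs]

theorem isBddLip_clampExtend {f : ℝ → ℝ} {K : NNReal} (hf : LipschitzOnWith K f (Icc 0 1))
    (hf0 : f 0 = 0) : IsBddLip (clampExtend f) K := by
  refine ⟨fun s => ?_, fun s s' => ?_⟩
  · have h1 := hf.dist_le_mul _ (projIcc (0 : ℝ) 1 zero_le_one s).2 0 ⟨le_rfl, zero_le_one⟩
    rw [Real.dist_eq, hf0, sub_zero] at h1
    refine h1.trans (mul_le_of_le_one_right K.2 ?_)
    have h2 := (projIcc (0 : ℝ) 1 zero_le_one s).2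
    rw [Real.dist_eq, sub_zero, abs_of_nonneg h2.1]
    exact h2.2
  · have h1 := hf.dist_le_mul _ (projIcc (0 : ℝ) 1 zero_le_one s).2 _
      (projIcc (0 : ℝ) 1 zero_le_one s').2
    rw [Real.dist_eq] at h1
    refine h1.trans (mul_le_mul_of_nonneg_left ?_ K.2)
    have h2 := (LipschitzWith.projIcc (a := (0 : ℝ)) zero_le_one).dist_le_mul s s'
    rwa [NNReal.coe_one, one_mul, Subtype.dist_eq, dist_eq_norm s] at h2

theorem norm_tail_sub_le {m : ℕ} (z z' : Fin (m + 1) → ℝ) :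
    ‖(fun j : Fin m => z j.succ) - fun j => z' j.succ‖ ≤ ‖z - z'‖ :=
  (pi_norm_le_iff_of_nonneg (norm_nonneg _)).2 fun j => norm_le_pi_norm (z - z') j.succ

theorem tail_add_single_succ {m : ℕ} (h : ℝ) (z : Fin (m + 1) → ℝ) (j : Fin m) :
    (fun i : Fin m => (z + Pi.single j.succ h : Fin (m + 1) → ℝ) i.succ) = (fun i => z i.succ) + Pi.single j h := by
  ext i
  simp [Pi.single_apply]

theorem add_single_succ_zero {m : ℕ} (h : ℝ) (z : Fin (m + 1) → ℝ) (j : Fin m) :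
    (z + Pi.single j.succ h : Fin (m + 1) → ℝ) 0 = z 0 := by
  simp

theorem exists_isShearSol {m : ℕ} {h : ℝ} (M A : ℝ) (hh : 0 < h) {f : ℝ → ℝ}
    (hf : ∃ K, LipschitzOnWith K f (Icc 0 1)) (hf0 : f 0 = 0) (hf1 : f 1 = 0)
    {u : (Fin m → ℝ) → ℝ} (hu : ContDiff ℝ 1 u) (hper : IsCellPeriodic h u)
    {ψ : ℝ → ℝ} (hψ : ContDiff ℝ 3 ψ) (hs : HasCompactSupport ψ) (h01 : ∀ x, ψ x ∈ Icc (0 : ℝ) 1) :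
    ∃ T, IsShearSol m h M A u f (fun z => ψ (z 0)) T := by
  obtain ⟨K, hK⟩ := hf
  have hψ1 : ContDiff ℝ 2 (deriv ψ) := by
    rw [show (3 : WithTop ℕ∞) = 2 + 1 by norm_num, contDiff_succ_iff_deriv] at hψ
    exact hψ.2.2
  have hψ2 : ContDiff ℝ 1 (deriv (deriv ψ)) := by
    rw [show (2 : WithTop ℕ∞) = 1 + 1 by norm_num, contDiff_succ_iff_deriv] at hψ1
    exact hψ1.2.2
  have hψ' : ContDiff ℝ 2 ψ := hψ.of_le (by norm_num)
  obtain ⟨C₀, hC₀⟩ := hs.exists_isBddLip (hψ.of_le (by norm_num))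
  obtain ⟨C₁, hC₁⟩ := hs.deriv.exists_isBddLip (hψ1.of_le (by norm_num))
  obtain ⟨C₂, hC₂⟩ := hs.deriv.deriv.exists_isBddLip hψ2
  obtain ⟨U, hU⟩ := hper.exists_isBddLip hh hu
  have hx : ∀ z z' : Fin (m + 1) → ℝ, ‖z 0 - z' 0‖ ≤ ‖z - z'‖ := fun z z' =>
    norm_le_pi_norm (z - z') 0
  have hb := (IsBddLip.const (Fin (m + 1) → ℝ) (-A)).mul (hU.comp norm_tail_sub_le)
  have hφ := (IsBddLip.const ℝ M).mul (isBddLip_clampExtend hK hf0)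
  have hsem := isSemilinear_affine (S := range fun j : Fin m => Pi.single j.succ h)
    ((hC₂.comp hx).add (hb.mul (hC₁.comp hx))) hb (hC₀.comp hx) hφ (by
      rintro _ ⟨j, rfl⟩ z
      simp only [add_single_succ_zero, tail_add_single_succ, hper _ j, and_self])
  obtain ⟨F, β, l, r, hF, hFe, hR, hRp⟩ := exists_mild_solution hsem 0
  set T : ℝ → (Fin (m + 1) → ℝ) → ℝ := fun t z => ψ (z 0) + duh F t z with hT
  have hψz : ContDiff ℝ 2 fun z : Fin (m + 1) → ℝ => ψ (z 0) := hψ'.comp (contDiff_apply ℝ ℝ 0)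
  have hcont : Continuous fun p : ℝ × (Fin (m + 1) → ℝ) => T p.1 p.2 := by
    have h1 := continuous_duh hF.toIsSource
    have h2 := hψ.continuous
    fun_prop
  have hC2 : ∀ t, 0 < t → ContDiff ℝ 2 (T t) := fun t ht => hψz.add (contDiff_duh hF ht)
  have hdt : ∀ t z, 0 < t → HasDerivAt (fun s => T s z) (F t z + lap (duh F t) z) t :=
    fun t z ht => by
      rw [lap_duh hF ht]
      exact (hasDerivAt_duh hF ht z).const_add _
  have heq : ∀ t z, 0 < t → deriv (fun s => T s z) t + A * u (fun j => z j.succ) * pd 0 (T t) z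
      = lap (T t) z + M * clampExtend f (T t z) := fun t z ht => by
    have h1 : pd 0 (T t) z = deriv ψ (z 0) + duh1 0 F t z := by
      rw [hT, pd_add 0 (hψz.differentiable two_ne_zero z)
        ((contDiff_duh hF ht).differentiable two_ne_zero z), pd_duh hF.toIsSource ht,
        pd_comp 0 (hψ'.differentiable two_ne_zero _) (differentiableAt_apply _ _), pd_coord]
      simp
    have h2 : lap (T t) z = deriv (deriv ψ) (z 0) + lap (duh F t) z := by
      rw [hT, lap_add hψz (contDiff_duh hF ht), lap_comp hψ' (contDiff_apply ℝ ℝ 0), lap_coord]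
      simp only [pd_coord]
      simp
    rw [(hdt t z ht).deriv, h1, h2, hFe]
    simp only [hT]
    ring
  obtain ⟨b₀, hb₀⟩ : ∃ b₀, ∀ z : Fin (m + 1) → ℝ, |A * u fun j => z j.succ| ≤ b₀ :=
    ⟨|A| * U, fun z => by rw [abs_mul]; exact mul_le_mul_of_nonneg_left (hU.1 _) (abs_nonneg _)⟩
  have hbd : ∀ t₁ t, t ∈ Icc (0 : ℝ) t₁ → ∀ z, |T t z| ≤ 1 + Real.exp (|r| * t₁) := fun t₁ t ht z => by
    refine (abs_add_le _ _).trans (add_le_add ?_ ((hR t z).trans (Real.exp_le_exp.2 ?_)))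
    · rw [abs_of_nonneg (h01 _).1]; exact (h01 _).2
    · rw [abs_of_nonneg ht.1]
      exact mul_le_mul (le_abs_self r) ht.2 ht.1 (abs_nonneg _)
  have hT0 : ∀ z, T 0 z = ψ (z 0) := fun z => by simp [hT, duh]
  have hle : ∀ t z, 0 ≤ t → T t z ≤ 1 := by
    intro t z ht
    have := parabolic_max_principle (w := fun t z => T t z + -1) (t₀ := 0) (t₁ := t)
      (b := fun z => A * u fun j => z j.succ) (B := 1 + Real.exp (|r| * t)) hb₀
      (by fun_prop) (fun s hs z => by linarith [(abs_le.1 (hbd t s hs z)).2])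
      (fun z => by rw [hT0]; linarith [(h01 (z 0)).2])
      (fun s hs z => ((hdt s z hs.1).add_const (-1)).differentiableAt)
      (fun s hs => (hC2 s hs.1).add contDiff_const) (fun s hs z hw => ?_) t ⟨ht, le_rfl⟩ z
    · linarith
    · have h1 := heq s z hs.1
      have h2 : clampExtend f (T s z) = 0 := by
        rw [clampExtend, projIcc_of_right_le _ (by linarith : (1 : ℝ) ≤ T s z), hf1]
      rw [h2, mul_zero, add_zero] at h1
      rw [lap_add (hC2 s hs.1) contDiff_const, lap_const, add_zero, ← h1,
        pd_add 0 ((hC2 s hs.1).differentiable two_ne_zero z) (differentiableAt_const _), pd_const,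
        add_zero, deriv_add_const]
  have hge : ∀ t z, 0 ≤ t → 0 ≤ T t z := by
    intro t z ht
    have := parabolic_max_principle (w := fun t z => (-1) * T t z) (t₀ := 0) (t₁ := t)
      (b := fun z => A * u fun j => z j.succ) (B := 1 + Real.exp (|r| * t)) hb₀
      (by fun_prop) (fun s hs z => by linarith [(abs_le.1 (hbd t s hs z)).1])
      (fun z => by rw [hT0]; linarith [(h01 (z 0)).1])
      (fun s hs z => ((hdt s z hs.1).const_mul (-1)).differentiableAt)
      (fun s hs => contDiff_const.mul (hC2 s hs.1)) (fun s hs z hw => ?_) t ⟨ht, le_rfl⟩ z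
    · linarith
    · have h1 := heq s z hs.1
      have h2 : clampExtend f (T s z) = 0 := by
        rw [clampExtend, projIcc_of_le_left _ (by linarith : T s z ≤ 0), hf0]
      rw [h2, mul_zero, add_zero] at h1
      rw [lap_const_mul _ (hC2 s hs.1), pd_const_mul 0 _ ((hC2 s hs.1).differentiable two_ne_zero z),
        deriv_const_mul _ (hdt s z hs.1).differentiableAt, ← h1]
      exact le_of_eq (by ring)
  refine ⟨T, hcont.continuousOn, fun t z ht => ⟨hge t z ht, hle t z ht⟩, fun t z _ j => ?_,
    fun t z ht => (hdt t z ht).differentiableAt, hC2, fun t z ht => ?_, hT0⟩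
  · simp only [hT, add_single_succ_zero, hRp _ ⟨j, rfl⟩]
  · rw [heq t z ht, clampExtend_of_mem ⟨hge t z ht.le, hle t z ht.le⟩]

end ExistenceShear

section Poisson

open Set

variable {m : ℕ} {h : ℝ} {g v : (Fin m → ℝ) → ℝ} {B C ρ : ℝ}

/-- The heat semigroup at time one. -/
def heatStep (g : (Fin m → ℝ) → ℝ) : (Fin m → ℝ) → ℝ := scaledConv heatK 1 g

theorem abs_heatStep_le (hB : ∀ z, |g z| ≤ B) (z : Fin m → ℝ) : |heatStep g z| ≤ B := by
  have := abs_scaledConv_le isRapidKernel_heatK hB 1 z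
  rwa [integral_abs_heatK, one_mul] at this

theorem continuous_heatStep (hg : Continuous g) (hB : ∀ z, |g z| ≤ B) : Continuous (heatStep g) :=
  continuous_iff_continuousAt.2 fun z => (hasFDerivAt_heat hg hB one_pos z).continuousAt

theorem IsCellPeriodic.heatStep (hg : IsCellPeriodic h g) : IsCellPeriodic h (heatStep g) :=
  fun y j => scaledConv_periodic (fun z => hg z j) y

theorem heatStep_sub_const (hg : Continuous g) (hB : ∀ z, |g z| ≤ B) (a : ℝ) (z : Fin m → ℝ) :
    heatStep (fun z => g z - a) z = heatStep g z - a := by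
  rw [heatStep, scaledConv_sub isRapidKernel_heatK hg hB continuous_const (fun _ => le_rfl),
    scaledConv_const, integral_heatK, one_mul, heatStep]

theorem heatStep_const_sub (hg : Continuous g) (hB : ∀ z, |g z| ≤ B) (a : ℝ) (z : Fin m → ℝ) :
    heatStep (fun z => a - g z) z = a - heatStep g z := by
  rw [heatStep, scaledConv_sub isRapidKernel_heatK continuous_const (fun _ => le_rfl) hg hB,
    scaledConv_const, integral_heatK, one_mul, heatStep]

theorem heatStep_nonneg (h0 : ∀ z, 0 ≤ g z) (z : Fin m → ℝ) : 0 ≤ heatStep g z :=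
  integral_nonneg fun ξ => mul_nonneg (heatK_pos ξ).le (h0 _)

theorem exists_isBddLip_heatStep (hg : Continuous g) (hB : ∀ z, |g z| ≤ B) :
    ∃ C, IsBddLip (heatStep g) C := by
  set L := ∑ j : Fin m, (∫ ξ, |heatK1 j ξ|) * B with hL
  refine ⟨max B L, fun z => le_max_of_le_left (abs_heatStep_le hB z), fun z z' => ?_⟩
  refine (convex_univ.norm_image_sub_le_of_norm_hasFDerivWithin_le (C := L)
    (fun x _ => (hasFDerivAt_heat hg hB one_pos x).hasFDerivWithinAt) (fun x _ => ?_) (mem_univ z')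
    (mem_univ z)).trans (mul_le_mul_of_nonneg_right (le_max_right _ _) (norm_nonneg _))
  refine (norm_gradCLM_le _).trans (Finset.sum_le_sum fun j _ => ?_)
  rw [Real.sqrt_one, inv_one, neg_one_mul, abs_neg]
  exact abs_scaledConv_le (isRapidKernel_heatK1 j) hB 1 x

theorem heatStep_eq_integral (g : (Fin m → ℝ) → ℝ) (z : Fin m → ℝ) :
    heatStep g z = ∫ ξ, heatK (ξ - z) * g ξ := by
  rw [heatStep, scaledConv, ← integral_add_left_eq_self (fun ξ => heatK (ξ - z) * g ξ) z]
  simp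

/-- A Doeblin minorization for the heat semigroup acting on periodic functions. -/
theorem exists_minorization (m : ℕ) (hh : 0 < h) :
    ∃ c : ℝ, 0 < c ∧ c * volume.real (Icc (0 : Fin m → ℝ) fun _ => h) ≤ 1 / 2 ∧
      ∀ (g : (Fin m → ℝ) → ℝ) (B : ℝ), Continuous g → (∀ z, |g z| ≤ B) → (∀ z, 0 ≤ g z) →
        IsCellPeriodic h g → ∀ z, c * ∫ ξ in Icc (0 : Fin m → ℝ) fun _ => h, g ξ ≤ heatStep g z := by
  obtain ⟨ξ₀, -, hmin⟩ := (isCompact_Icc (a := fun _ : Fin m => -h) (b := fun _ => h)).exists_isMinOn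
    ⟨0, fun _ => (neg_nonpos.2 hh.le), fun _ => hh.le⟩
    isRapidKernel_heatK.cont.continuousOn
  set Q := Icc (0 : Fin m → ℝ) fun _ => h with hQ
  refine ⟨min (heatK ξ₀) (1 / (2 * (volume.real Q + 1))), lt_min (heatK_pos _) (by positivity), ?_,
    fun g B hg hB h0 hper z => ?_⟩
  · calc min (heatK ξ₀) (1 / (2 * (volume.real Q + 1))) * volume.real Q
        ≤ 1 / (2 * (volume.real Q + 1)) * (volume.real Q + 1) := by
          gcongr
          · exact min_le_right _ _
          · linarith
      _ = 1 / 2 := by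
        have : (0 : ℝ) < volume.real Q + 1 := by positivity
        field_simp
  · obtain ⟨y, hy, hyz⟩ := hper.heatStep.exists_eq hh z
    rw [← hyz, heatStep_eq_integral, ← integral_const_mul]
    have hInt : Integrable fun ξ => heatK (ξ - y) * g ξ := by
      have := (integrable_scaledConv isRapidKernel_heatK hg hB 1 y).comp_sub_right y
      simpa using this
    refine (setIntegral_mono_on ?_ hInt.integrableOn measurableSet_Icc fun ξ hξ => ?_).trans
      (setIntegral_le_integral hInt (Filter.Eventually.of_forall fun ξ =>
        mul_nonneg (heatK_pos _).le (h0 ξ)))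
    · exact (continuous_const.mul hg).continuousOn.integrableOn_compact isCompact_Icc
    · refine mul_le_mul_of_nonneg_right ((min_le_left _ _).trans (hmin ⟨fun j => ?_, fun j => ?_⟩))
        (h0 ξ)
      · have h1 := hξ.1 j
        have h2 := hy.2 j
        simp only [Pi.zero_apply, Pi.sub_apply] at h1 h2 ⊢
        linarith
      · have h1 := hξ.2 j
        have h2 := hy.1 j
        simp only [Pi.zero_apply, Pi.sub_apply] at h1 h2 ⊢
        linarith

theorem exists_contraction_osc (m : ℕ) (hh : 0 < h) :
    ∃ ρ : ℝ, 0 ≤ ρ ∧ ρ < 1 ∧ ∀ (g : (Fin m → ℝ) → ℝ) (B a C : ℝ), Continuous g →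
      (∀ z, |g z| ≤ B) → IsCellPeriodic h g → (∀ z, a ≤ g z ∧ g z ≤ a + C) →
      ∃ a', ∀ z, a' ≤ heatStep g z ∧ heatStep g z ≤ a' + ρ * C := by
  obtain ⟨c, hc, hc2, hmin⟩ := exists_minorization m hh
  set Q := Icc (0 : Fin m → ℝ) fun _ => h with hQ
  have hQ0 : 0 < volume.real Q := by
    rw [measureReal_def, hQ, Real.volume_Icc_pi]
    refine ENNReal.toReal_pos ?_ ?_
    · refine (Finset.prod_ne_zero_iff.2 fun i _ => ?_)
      simpa using hh
    · exact ENNReal.prod_ne_top fun i _ => ENNReal.ofReal_ne_top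
  refine ⟨1 - c * volume.real Q, by linarith, by nlinarith, fun g B a C hg hB hper hgC => ?_⟩
  have h1 : ∀ z, |g z - a| ≤ B + |a| := fun z => (abs_sub _ _).trans (by linarith [hB z])
  have h2 : ∀ z, |a + C - g z| ≤ |a + C| + B := fun z => (abs_sub _ _).trans (by linarith [hB z])
  have h3 := hmin (fun z => g z - a) _ (by fun_prop) h1 (fun z => by linarith [(hgC z).1])
    fun y j => by simp only [hper y j]
  have h4 := hmin (fun z => a + C - g z) _ (by fun_prop) h2 (fun z => by linarith [(hgC z).2])
    fun y j => by simp only [hper y j]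
  have hi : IntegrableOn g Q := hg.continuousOn.integrableOn_compact isCompact_Icc
  have hconst : ∀ r : ℝ, IntegrableOn (fun _ : Fin m → ℝ => r) Q := fun r =>
    continuous_const.continuousOn.integrableOn_compact isCompact_Icc
  rw [integral_sub hi (hconst _), setIntegral_const, smul_eq_mul] at h3
  rw [integral_sub (hconst _) hi, setIntegral_const, smul_eq_mul] at h4
  refine ⟨a + c * ((∫ ξ in Q, g ξ) - volume.real Q * a), fun z => ⟨?_, ?_⟩⟩
  · have := h3 z
    rw [heatStep_sub_const hg hB] at this
    linarith
  · have := h4 z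
    rw [heatStep_const_sub hg hB] at this
    nlinarith

theorem iterate_heatStep_spec (hg : Continuous g) (hB : ∀ z, |g z| ≤ B) (hper : IsCellPeriodic h g)
    (n : ℕ) : Continuous (heatStep^[n] g) ∧ (∀ z, |heatStep^[n] g z| ≤ B) ∧
      IsCellPeriodic h (heatStep^[n] g) := by
  induction n with
  | zero => exact ⟨hg, hB, hper⟩
  | succ n ih =>
    rw [Function.iterate_succ_apply']
    exact ⟨continuous_heatStep ih.1 ih.2.1, abs_heatStep_le ih.2.1, ih.2.2.heatStep⟩

/-- Exponential convergence of the heat semigroup on the torus. -/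
theorem exists_limit_iterate_heatStep (hh : 0 < h) (hg : Continuous g) (hB : ∀ z, |g z| ≤ B)
    (hper : IsCellPeriodic h g) :
    ∃ (a : ℝ) (D ρ : ℝ), 0 ≤ ρ ∧ ρ < 1 ∧ ∀ n z, |heatStep^[n] g z - a| ≤ D * ρ ^ n := by
  obtain ⟨ρ, hρ0, hρ1, hρ⟩ := exists_contraction_osc m hh
  have hB0 : 0 ≤ B := (abs_nonneg _).trans (hB 0)
  have key : ∀ n, ∃ b, ∀ z, b ≤ heatStep^[n] g z ∧ heatStep^[n] g z ≤ b + 2 * B * ρ ^ n := by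
    intro n
    induction n with
    | zero => exact ⟨-B, fun z => by
        have := abs_le.1 (hB z)
        simp only [Function.iterate_zero, id_eq, pow_zero, mul_one]
        constructor <;> linarith⟩
    | succ n ih =>
      obtain ⟨b, hb⟩ := ih
      obtain ⟨h1, h2, h3⟩ := iterate_heatStep_spec hg hB hper n
      obtain ⟨a', ha'⟩ := hρ _ B b _ h1 h2 h3 hb
      refine ⟨a', fun z => ?_⟩
      rw [Function.iterate_succ_apply', pow_succ]
      exact ⟨(ha' z).1, (ha' z).2.trans (le_of_eq (by ring))⟩
  have hstep : ∀ n z z', |heatStep^[n] g z - heatStep^[n] g z'| ≤ 2 * B * ρ ^ n := fun n z z' => by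
    obtain ⟨b, hb⟩ := key n
    rw [abs_le]
    constructor <;> linarith [(hb z).1, (hb z).2, (hb z').1, (hb z').2]
  have hstep' : ∀ n, dist (heatStep^[n] g 0) (heatStep^[n + 1] g 0) ≤ 2 * B * ρ ^ n := fun n => by
    obtain ⟨b, hb⟩ := key n
    obtain ⟨h1, h2, h3⟩ := iterate_heatStep_spec hg hB hper n
    have h4 := heatStep_nonneg (fun z => sub_nonneg.2 (hb z).1) 0
    have h5 := heatStep_nonneg (fun z => sub_nonneg.2 (hb z).2) 0
    rw [heatStep_sub_const h1 h2] at h4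
    rw [heatStep_const_sub h1 h2] at h5
    rw [Function.iterate_succ_apply', Real.dist_eq, abs_le]
    constructor <;> linarith [(hb 0).1, (hb 0).2]
  obtain ⟨a, ha⟩ := cauchySeq_tendsto_of_complete (cauchySeq_of_le_geometric ρ _ hρ1 hstep')
  refine ⟨a, 2 * B + 2 * B / (1 - ρ), ρ, hρ0, hρ1, fun n z => ?_⟩
  have h1 := dist_le_of_le_geometric_of_tendsto ρ _ hρ1 hstep' ha n
  rw [Real.dist_eq] at h1
  calc _ ≤ |heatStep^[n] g z - heatStep^[n] g 0| + |heatStep^[n] g 0 - a| := abs_sub_le _ _ _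
    _ ≤ 2 * B * ρ ^ n + 2 * B * ρ ^ n / (1 - ρ) := add_le_add (hstep n z 0) h1
    _ = _ := by ring

/-- Solution of the discrete Poisson equation for the heat semigroup. -/
theorem exists_sub_heatStep_eq (hh : 0 < h) (hv : IsBddLip v B) (hper : IsCellPeriodic h v) :
    ∃ (w : (Fin m → ℝ) → ℝ) (a C : ℝ), IsBddLip w C ∧ IsCellPeriodic h w ∧
      (∀ z, heatStep w z - w z = a - v z) ∧ ∀ c, (∀ z, c ≤ v z) → c ≤ a := by
  obtain ⟨a, D, ρ, hρ0, hρ1, hD⟩ := exists_limit_iterate_heatStep hh hv.continuous hv.1 hper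
  have hsum : Summable fun n : ℕ => D * ρ ^ n := (summable_geometric_of_lt_one hρ0 hρ1).mul_left D
  set G : ℕ → (Fin m → ℝ) → ℝ := fun n z => heatStep^[n] v z - a with hG
  have hGs := iterate_heatStep_spec hv.continuous hv.1 hper
  have hsz : ∀ z, Summable fun n => G n z := fun z =>
    Summable.of_norm_bounded hsum fun n => hD n z
  set w : (Fin m → ℝ) → ℝ := fun z => ∑' n, G n z with hw
  have hwc : Continuous w :=
    continuous_tsum (fun n => (hGs n).1.sub continuous_const) hsum fun n z => hD n z
  have hwb : ∀ z, |w z| ≤ ∑' n : ℕ, D * ρ ^ n := fun z =>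
    tsum_of_norm_bounded (f := fun n => G n z) hsum.hasSum fun n => hD n z
  have hstep : ∀ n z, heatStep (G n) z = G (n + 1) z := fun n z => by
    simp only [hG]
    rw [heatStep_sub_const (hGs n).1 (hGs n).2.1, Function.iterate_succ_apply']
  have hPw : ∀ z, heatStep w z = ∑' n, G (n + 1) z := fun z => by
    have hGi : ∀ n, Integrable fun ξ => heatK ξ * G n (z + Real.sqrt 1 • ξ) := fun n =>
      integrable_scaledConv isRapidKernel_heatK ((hGs n).1.sub continuous_const) (hD n) 1 z
    have h1 := hasSum_integral_of_summable_integral_norm hGi (Summable.of_nonneg_of_le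
      (fun n => integral_nonneg fun ξ => norm_nonneg _) (fun n => ?_) hsum)
    · simp only [tsum_mul_left] at h1
      simp only [← hstep]
      exact h1.tsum_eq.symm
    · have h2 : ∫ ξ : Fin m → ℝ, |heatK ξ| * (D * ρ ^ n) = D * ρ ^ n := by
        rw [integral_mul_const, integral_abs_heatK, one_mul]
      rw [← h2]
      refine integral_mono (hGi n).norm (isRapidKernel_heatK.integrable.abs.mul_const _) fun ξ => ?_
      simp only
      rw [norm_mul]
      exact mul_le_mul_of_nonneg_left (hD n _) (abs_nonneg _)
  have heq : ∀ z, heatStep w z - w z = a - v z := fun z => by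
    rw [hPw, hw]
    simp only
    rw [(hsz z).tsum_eq_zero_add]
    simp [hG]
  obtain ⟨C, hC⟩ := exists_isBddLip_heatStep hwc hwb
  have hwL := hC.add (hv.add (IsBddLip.const _ (-a)))
  rw [show (fun z => heatStep w z + (v z + -a)) = w from funext fun z => by linarith [heq z]] at hwL
  refine ⟨w, a, _, hwL, fun y j => ?_, heq, fun c hc => ?_⟩
  · simp only [hw, hG, (hGs _).2.2 y j]
  · have h1 : ∀ n z, c ≤ heatStep^[n] v z := fun n => by
      induction n with
      | zero => exact hc
      | succ n ih =>
        intro z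
        have h2 := heatStep_nonneg (fun z => sub_nonneg.2 (ih z)) z
        rw [heatStep_sub_const (hGs n).1 (hGs n).2.1] at h2
        rw [Function.iterate_succ_apply']
        linarith
    have h2 : Filter.Tendsto (fun n => G n 0) Filter.atTop (nhds 0) :=
      squeeze_zero_norm (fun n => hD n 0) hsum.tendsto_atTop_zero
    have h3 : Filter.Tendsto (fun n => heatStep^[n] v 0) Filter.atTop (nhds a) := by
      have := h2.add_const a
      simpa [hG] using this
    exact ge_of_tendsto' h3 fun n => h1 n 0

/-- The Laplacian of a time-integrated heat flow. -/
theorem lap_duh_const {l : ℝ} (hg : IsBddLip g l) (z : Fin m → ℝ) :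
    lap (duh (fun _ => g) 1) z = heatStep g z - g z := by
  have hgc := hg.continuous
  have hF : IsLipSource (fun _ : ℝ => g) (fun _ => l) fun _ => l :=
    ⟨⟨by fun_prop, continuous_const, fun _ => hg.1⟩, continuous_const, fun _ => hg.2⟩
  have h1 := hasDerivAt_duh hF one_pos z
  rw [← lap_duh hF one_pos] at h1
  have hc : Continuous fun τ => scaledConv heatK τ g z := by
    have := continuous_scaledConv (X := ℝ) isRapidKernel_heatK (F := fun _ => g) (β := fun _ => l)
      (by fun_prop) continuous_const fun _ => hg.1
    exact this.comp (by fun_prop : Continuous fun τ : ℝ => (τ, (0 : ℝ), z))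
  have h2 : HasDerivAt (fun t => duh (fun _ => g) t z) (heatStep g z) 1 := by
    refine (intervalIntegral.integral_hasDerivAt_right (hc.intervalIntegrable 0 1)
      (hc.stronglyMeasurableAtFilter _ _) hc.continuousAt).congr_of_eventuallyEq ?_
    filter_upwards [lt_mem_nhds (zero_lt_one' ℝ)] with t ht
    rw [duh_eq_integral _ ht]
    have := intervalIntegral.integral_comp_sub_left (a := 0) (b := t)
      (fun τ => scaledConv heatK τ g z) t
    simpa using this
  linarith [h1.unique h2]

/-- Solvability of the Poisson equation on the torus. -/
theorem exists_poisson (hh : 0 < h) (hv : IsBddLip v B) (hper : IsCellPeriodic h v) :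
    ∃ (χ : (Fin m → ℝ) → ℝ) (a : ℝ), ContDiff ℝ 2 χ ∧ IsCellPeriodic h χ ∧
      (∀ z, lap χ z = v z - a) ∧ ∀ c, (∀ z, c ≤ v z) → c ≤ a := by
  obtain ⟨w, a, C, hw, hwp, hwe, ha⟩ := exists_sub_heatStep_eq hh hv hper
  have hwc := hw.continuous
  have hF : IsLipSource (fun _ : ℝ => w) (fun _ => C) fun _ => C :=
    ⟨⟨by fun_prop, continuous_const, fun _ => hw.1⟩, continuous_const, fun _ => hw.2⟩
  have hC2 := contDiff_duh hF one_pos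
  refine ⟨fun z => (-1) * duh (fun _ => w) 1 z, a, contDiff_const.mul hC2, fun y j => ?_,
    fun z => ?_, ha⟩
  · simp only [← duh_translate, hwp _ j]
  · rw [lap_const_mul _ hC2, lap_duh_const hw, hwe]
    ring

end Poisson

section Positivity

variable {N m : ℕ}

theorem contDiff_sum_sq_sub (c : Fin N → ℝ) (n : WithTop ℕ∞) :
    ContDiff ℝ n fun z : Fin N → ℝ => ∑ j, (z j - c j) ^ 2 := by
  fun_prop

theorem pd_sum_sq_sub (c : Fin N → ℝ) (i : Fin N) (z : Fin N → ℝ) :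
    pd i (fun z => ∑ j, (z j - c j) ^ 2) z = 2 * (z i - c i) := by
  have h1 : ∀ j ∈ Finset.univ, HasFDerivAt (fun z : Fin N → ℝ => (z j - c j) ^ 2)
      ((2 * (z j - c j)) • ContinuousLinearMap.proj (R := ℝ) (φ := fun _ : Fin N => ℝ) j) z := by
    intro j _
    have := ((ContinuousLinearMap.proj (R := ℝ) (φ := fun _ : Fin N => ℝ) j).hasFDerivAt
      (x := z)).sub_const (c j) |>.pow 2
    simpa using this
  refine ((HasFDerivAt.fun_sum h1).pd_eq i).trans ?_
  simp [Pi.single_apply]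

theorem lap_sum_sq_sub (c z : Fin N → ℝ) :
    lap (fun z => ∑ j, (z j - c j) ^ 2) z = 2 * N := by
  unfold lap
  have h1 : ∀ i, pd i (pd i fun z : Fin N → ℝ => ∑ j, (z j - c j) ^ 2) z = 2 := fun i => by
    rw [show (pd i fun z : Fin N → ℝ => ∑ j, (z j - c j) ^ 2) = fun z => 2 * (z i + -c i) from
      funext fun z => by rw [pd_sum_sq_sub, sub_eq_add_neg]]
    rw [pd_const_mul i 2 (by fun_prop), pd_add i (by fun_prop) (by fun_prop), pd_coord, pd_const]
    simp
  rw [Finset.sum_congr rfl fun i _ => h1 i]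
  simp [mul_comm]

theorem gaussian_barrier_le {k B r η d Λ s e : ℝ} (hk1 : 1 ≤ k) (hkB : B ≤ k * r ^ 2) (hB0 : 0 ≤ B)
    (hd0 : 0 < d) (hη : η = Real.exp (-k * r ^ 2)) (hd : d = Real.exp (-k * (r ^ 2 / 2)) - η)
    (hΛ : Λ = k * B / d) (hs0 : 0 ≤ s) (hsr : s < r ^ 2) (he : Real.exp (-k * s) = e) :
    -Λ * (e - η) + k * e * (B + 2 * s - 4 * k * s) ≤ 0 := by
  have hk0 : 0 < k := by linarith
  have hΛ0 : 0 ≤ Λ := by rw [hΛ]; positivity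
  have he0 : 0 < e := he ▸ Real.exp_pos _
  have he1 : e ≤ 1 := by
    rw [← he]
    exact Real.exp_le_one_iff.2 (by nlinarith)
  have hks : s ≤ k * s := le_mul_of_one_le_left hs0 hk1
  have hke : 0 < k * e := by positivity
  have heη : η ≤ e := by
    rw [hη, ← he]
    exact Real.exp_le_exp.2 (by nlinarith)
  rcases le_or_gt (r ^ 2 / 2) s with hs | hs
  · have h1 : B + 2 * s - 4 * k * s ≤ 0 := by nlinarith
    have h2 := mul_nonneg hΛ0 (sub_nonneg.2 heη)
    have h3 := mul_nonpos_of_nonneg_of_nonpos hke.le h1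
    linarith
  · have h1 : d ≤ e - η := by
      rw [hd, ← he]
      have : Real.exp (-k * (r ^ 2 / 2)) ≤ Real.exp (-k * s) := Real.exp_le_exp.2 (by nlinarith)
      linarith
    have h2 : Λ * d = k * B := by rw [hΛ, div_mul_cancel₀ _ hd0.ne']
    have h3 : Λ * d ≤ Λ * (e - η) := mul_le_mul_of_nonneg_left h1 hΛ0
    have h4 : k * e * (B + 2 * s - 4 * k * s) ≤ k * e * B :=
      mul_le_mul_of_nonneg_left (by linarith) hke.le
    have h5 : k * B * e ≤ k * B := mul_le_of_le_one_right (mul_nonneg hk0.le hB0) he1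
    linarith

set_option maxHeartbeats 1000000 in
/-- Strong maximum principle: a nonnegative supersolution which is positive somewhere initially is
positive everywhere at later times. -/
theorem supersolution_pos {T : ℝ → (Fin (m + 1) → ℝ) → ℝ} {b : (Fin (m + 1) → ℝ) → ℝ} {β t₁ : ℝ}
    (hb : ∀ z, |b z| ≤ β) (ht₁ : 0 < t₁)
    (hcont : ContinuousOn (fun p : ℝ × (Fin (m + 1) → ℝ) => T p.1 p.2)
      (Set.Icc 0 t₁ ×ˢ Set.univ))
    (hT : ∀ t ∈ Set.Icc 0 t₁, ∀ z, 0 ≤ T t z)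
    (hd : ∀ t ∈ Set.Ioc 0 t₁, ∀ z, DifferentiableAt ℝ (fun s => T s z) t)
    (hC : ∀ t ∈ Set.Ioc 0 t₁, ContDiff ℝ 2 (T t))
    (hL : ∀ t ∈ Set.Ioc 0 t₁, ∀ z,
      lap (T t) z ≤ deriv (fun s => T s z) t + b z * pd 0 (T t) z)
    {z₀ : Fin (m + 1) → ℝ} (hz₀ : 0 < T 0 z₀) (z₁ : Fin (m + 1) → ℝ) : 0 < T t₁ z₁ := by
  have hc0 : Continuous fun z => T 0 z := by
    have h2 : ContinuousOn (fun z : Fin (m + 1) → ℝ => T 0 z) Set.univ :=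
      hcont.comp (f := fun z : Fin (m + 1) → ℝ => ((0 : ℝ), z)) (by fun_prop)
        fun z _ => ⟨⟨le_rfl, ht₁.le⟩, trivial⟩
    exact continuousOn_univ.1 h2
  obtain ⟨r, hr, hball⟩ := Metric.eventually_nhds_iff.1
    (hc0.continuousAt.eventually (lt_mem_nhds (half_lt_self hz₀)))
  set δ := T 0 z₀ / 2 with hδ
  have hδ0 : 0 < δ := half_pos hz₀
  obtain ⟨v, hv⟩ : ∃ v : Fin (m + 1) → ℝ, v = fun i => (z₁ i - z₀ i) / t₁ := ⟨_, rfl⟩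
  obtain ⟨B, hB⟩ : ∃ B : ℝ, B = ∑ i, v i ^ 2 + β ^ 2 + 2 * ((m + 1 : ℕ) : ℝ) := ⟨_, rfl⟩
  have hB0 : 0 ≤ B := by rw [hB]; positivity
  obtain ⟨k, hk1, hkB⟩ : ∃ k : ℝ, 1 ≤ k ∧ B ≤ k * r ^ 2 :=
    ⟨max 1 (B / r ^ 2), le_max_left _ _, by
      have := le_max_right 1 (B / r ^ 2)
      rwa [div_le_iff₀ (by positivity)] at this⟩
  have hk0 : 0 < k := by linarith
  obtain ⟨η, hη⟩ : ∃ η : ℝ, η = Real.exp (-k * r ^ 2) := ⟨_, rfl⟩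
  obtain ⟨d, hdd⟩ : ∃ d : ℝ, d = Real.exp (-k * (r ^ 2 / 2)) - η := ⟨_, rfl⟩
  have hkr : 0 < k * r ^ 2 := by positivity
  have hd0 : 0 < d := by
    rw [hdd, hη, sub_pos, Real.exp_lt_exp]
    linarith
  have hη1 : η < 1 := by
    rw [hη, Real.exp_lt_one_iff]
    linarith
  have hη0 : 0 < η := hη ▸ Real.exp_pos _
  obtain ⟨Λ, hΛ⟩ : ∃ Λ : ℝ, Λ = k * B / d := ⟨_, rfl⟩
  have hΛ0 : 0 ≤ Λ := by rw [hΛ]; positivity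
  let γ : ℝ → Fin (m + 1) → ℝ := fun t i => z₀ i + t * v i
  let S : ℝ → (Fin (m + 1) → ℝ) → ℝ := fun t z => ∑ j, (z j - γ t j) ^ 2
  let w : ℝ → (Fin (m + 1) → ℝ) → ℝ := fun t z =>
    δ * Real.exp (-Λ * t) * (Real.exp (-k * S t z) + -η)
  have hS0 : ∀ t z, 0 ≤ S t z := fun t z => Finset.sum_nonneg fun j _ => sq_nonneg _
  have hSC : ∀ t, ContDiff ℝ 2 (S t) := fun t => contDiff_sum_sq_sub _ _
  have hψ : ContDiff ℝ 2 fun s : ℝ => Real.exp (-k * s) := by fun_prop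
  have hψ1 : ∀ s : ℝ, HasDerivAt (fun s : ℝ => Real.exp (-k * s)) (-k * Real.exp (-k * s)) s :=
    fun s => by
      have := ((hasDerivAt_id s).const_mul (-k)).exp
      simp only [id, mul_one] at this
      rwa [mul_comm] at this
  have hψd : deriv (fun s : ℝ => Real.exp (-k * s)) = fun s => -k * Real.exp (-k * s) :=
    funext fun s => (hψ1 s).deriv
  have hEC : ∀ t, ContDiff ℝ 2 fun z => Real.exp (-k * S t z) := fun t => hψ.comp (hSC t)
  have hwC : ∀ t, ContDiff ℝ 2 (w t) := fun t => contDiff_const.mul ((hEC t).add contDiff_const)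
  have hwpd : ∀ t z, pd 0 (w t) z = δ * Real.exp (-Λ * t) *
      (-k * Real.exp (-k * S t z) * (2 * (z 0 - γ t 0))) := fun t z => by
    simp only [w]
    rw [pd_const_mul 0 _ (((hEC t).add contDiff_const).differentiable two_ne_zero z),
      pd_add 0 ((hEC t).differentiable two_ne_zero z) (by fun_prop), pd_const,
      pd_comp 0 (hψ1 _).differentiableAt ((hSC t).differentiable two_ne_zero z), hψd,
      pd_sum_sq_sub, add_zero]
  have hwlap : ∀ t z, lap (w t) z = δ * Real.exp (-Λ * t) *
      (k ^ 2 * Real.exp (-k * S t z) * (4 * S t z)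
        - k * Real.exp (-k * S t z) * (2 * ((m + 1 : ℕ) : ℝ))) := fun t z => by
    simp only [w]
    rw [lap_const_mul _ ((hEC t).add contDiff_const), lap_add (hEC t) contDiff_const, lap_const,
      lap_comp hψ (hSC t), hψd]
    have h1 : deriv (fun s : ℝ => -k * Real.exp (-k * s)) (S t z)
        = -k * (-k * Real.exp (-k * S t z)) := ((hψ1 _).const_mul (-k)).deriv
    have h2 : ∑ i, pd i (S t) z ^ 2 = 4 * S t z := by
      simp only [S]
      rw [Finset.mul_sum]
      refine Finset.sum_congr rfl fun i _ => ?_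
      rw [pd_sum_sq_sub]
      ring
    have h3 : lap (S t) z = 2 * ((m + 1 : ℕ) : ℝ) := lap_sum_sq_sub _ _
    rw [h1, h2, h3]
    ring
  have hwt : ∀ t z, HasDerivAt (fun s => w s z) (δ * Real.exp (-Λ * t) *
      (-Λ * (Real.exp (-k * S t z) - η)
        + k * Real.exp (-k * S t z) * ∑ j, 2 * v j * (z j - γ t j))) t := fun t z => by
    have h1 : HasDerivAt (fun s => S s z) (-∑ j, 2 * v j * (z j - γ t j)) t := by
      have : ∀ j ∈ Finset.univ, HasDerivAt (fun s => (z j - γ s j) ^ 2)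
          (-(2 * v j * (z j - γ t j))) t := fun j _ => by
        have := ((((hasDerivAt_id t).mul_const (v j)).const_add (z₀ j)).const_sub (z j)).pow 2
        refine this.congr_deriv ?_
        simp [γ]
        ring
      have := HasDerivAt.fun_sum this
      rwa [Finset.sum_neg_distrib] at this
    have h2 := ((h1.const_mul (-k)).exp).add_const (-η)
    have h3 := (((hasDerivAt_id t).const_mul (-Λ)).exp).const_mul δ
    refine (h3.mul h2).congr_deriv ?_
    simp only [id]
    ring
  have key : ∀ t ∈ Set.Icc 0 t₁, ∀ z, w t z - T t z ≤ 0 := by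
    have hwcont : Continuous fun p : ℝ × (Fin (m + 1) → ℝ) => w p.1 p.2 := by
      simp only [w, S, γ]
      fun_prop
    have hwpos : ∀ t z, 0 < w t z → S t z < r ^ 2 := fun t z hw => by
      have h1 : 0 < Real.exp (-k * S t z) + -η :=
        (pos_iff_pos_of_mul_pos hw).1 (by positivity)
      rw [← sub_eq_add_neg, hη, sub_pos, Real.exp_lt_exp] at h1
      nlinarith
    have hwle : ∀ t, 0 ≤ t → ∀ z, w t z ≤ δ := fun t ht z => by
      have h1 : Real.exp (-k * S t z) ≤ 1 := Real.exp_le_one_iff.2 (by nlinarith [hS0 t z])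
      have h2 : Real.exp (-Λ * t) ≤ 1 := Real.exp_le_one_iff.2 (by nlinarith)
      have h3 : δ * Real.exp (-Λ * t) ≤ δ := mul_le_of_le_one_right hδ0.le h2
      exact (mul_le_of_le_one_right (by positivity) (by linarith)).trans h3
    refine parabolic_max_principle (B := δ) hb (hwcont.continuousOn.sub hcont)
      (fun t ht z => by linarith [hwle t ht.1 z, hT t ht z]) (fun z => ?_)
      (fun t ht z => (hwt t z).differentiableAt.sub (hd t ht z))
      (fun t ht => (hwC t).sub (hC t ht)) fun t ht z hpos => ?_
    · rcases le_or_gt (w 0 z) 0 with hw | hw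
      · linarith [hT 0 ⟨le_rfl, ht₁.le⟩ z]
      · have h1 := hwpos 0 z hw
        have h2 : ‖z - z₀‖ ^ 2 ≤ S 0 z := by
          have := norm_sq_le_sum_sq (z - z₀)
          simpa [S, γ] using this
        have h3 : ‖z - z₀‖ < r := lt_of_pow_lt_pow_left₀ 2 hr.le (h2.trans_lt h1)
        have h4 := hball (y := z) (by rwa [dist_eq_norm])
        linarith [hwle 0 le_rfl z]
    · have hw : 0 < w t z := by linarith [hT t ⟨ht.1.le, ht.2⟩ z]
      have hSr := hwpos t z hw
      have hdsub : deriv (fun s => w s z - T s z) t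
          = deriv (fun s => w s z) t - deriv (fun s => T s z) t :=
        deriv_fun_sub (hwt t z).differentiableAt (hd t ht z)
      have hTC : ContDiff ℝ 2 fun z => (-1) * T t z := contDiff_const.mul (hC t ht)
      have hpsub : pd 0 (fun z => w t z - T t z) z = pd 0 (w t) z - pd 0 (T t) z := by
        rw [show (fun z => w t z - T t z) = fun z => w t z + (-1) * T t z from
          funext fun z => by ring,
          pd_add 0 ((hwC t).differentiable two_ne_zero z) (hTC.differentiable two_ne_zero z),
          pd_const_mul 0 _ ((hC t ht).differentiable two_ne_zero z)]
        ring
      have hlsub : lap (fun z => w t z - T t z) z = lap (w t) z - lap (T t) z := by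
        rw [show (fun z => w t z - T t z) = fun z => w t z + (-1) * T t z from
          funext fun z => by ring, lap_add (hwC t) hTC, lap_const_mul _ (hC t ht)]
        ring
      rw [hdsub, hpsub, hlsub]
      suffices h : deriv (fun s => w s z) t + b z * pd 0 (w t) z ≤ lap (w t) z by
        have := hL t ht z
        linarith
      rw [(hwt t z).deriv, hwpd, hwlap]
      have hδt : 0 < δ * Real.exp (-Λ * t) := by positivity
      have hEpos : 0 < Real.exp (-k * S t z) := Real.exp_pos _
      have hSt0 := hS0 t z
      have hcross : ∑ j, 2 * v j * (z j - γ t j) - 2 * b z * (z 0 - γ t 0)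
          ≤ ∑ i, v i ^ 2 + β ^ 2 + 2 * S t z := by
        have h1 : ∑ j, 2 * v j * (z j - γ t j) ≤ ∑ i, v i ^ 2 + S t z := by
          simp only [S]
          rw [← Finset.sum_add_distrib]
          exact Finset.sum_le_sum fun j _ => by nlinarith [sq_nonneg (v j - (z j - γ t j))]
        have h2 : (z 0 - γ t 0) ^ 2 ≤ S t z :=
          Finset.single_le_sum (f := fun j => (z j - γ t j) ^ 2) (fun j _ => sq_nonneg _)
            (Finset.mem_univ 0)
        have h3 : b z ^ 2 ≤ β ^ 2 := sq_le_sq' (abs_le.1 (hb z)).1 (abs_le.1 (hb z)).2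
        nlinarith [sq_nonneg (b z + (z 0 - γ t 0))]
      obtain ⟨s, hSg⟩ : ∃ s, S t z = s := ⟨_, rfl⟩
      obtain ⟨e, hEg⟩ : ∃ e, Real.exp (-k * s) = e := ⟨_, rfl⟩
      rw [hSg] at hcross hSr hSt0 hEpos ⊢
      rw [hEg] at hEpos ⊢
      have hmain := gaussian_barrier_le hk1 hkB hB0 hd0 hη hdd hΛ hSt0 hSr hEg
      have hke : 0 < k * e := by positivity
      have h6 := mul_le_mul_of_nonneg_left hcross hke.le
      have h7 : δ * Real.exp (-Λ * t) * (-Λ * (e - η) + k * e * (∑ j, 2 * v j * (z j - γ t j))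
          - 2 * b z * k * e * (z 0 - γ t 0) - 4 * k ^ 2 * e * s
          + k * e * (2 * ((m + 1 : ℕ) : ℝ))) ≤ 0 := by
        refine mul_nonpos_of_nonneg_of_nonpos hδt.le ?_
        rw [hB] at hmain
        linarith
      linarith
  have h1 := key t₁ ⟨ht₁.le, le_rfl⟩ z₁
  have h2 : S t₁ z₁ = 0 := by
    refine Finset.sum_eq_zero fun j _ => ?_
    simp only [γ, hv]
    rw [mul_div_cancel₀ _ ht₁.ne']
    ring
  have h3 : 0 < w t₁ z₁ := by
    simp only [w, h2, mul_zero, Real.exp_zero]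
    exact mul_pos (by positivity) (by linarith)
  linarith

end Positivity

section ChainRule

variable {N m : ℕ}

/-- On the region `U`, the function `H` of two real variables obeys the chain rule along curves
with partial derivatives `H₁` and `H₂`. -/
def HasPartials (U : ℝ → ℝ → Prop) (H H₁ H₂ : ℝ → ℝ → ℝ) : Prop :=
  ∀ ⦃s x : ℝ → ℝ⦄ ⦃s' x' r : ℝ⦄, HasDerivAt s s' r → HasDerivAt x x' r → U (s r) (x r) →
    HasDerivAt (fun r => H (s r) (x r)) (H₁ (s r) (x r) * s' + H₂ (s r) (x r) * x') r

variable {U : ℝ → ℝ → Prop} {H H₁ H₂ H₁₁ H₁₂ H₂₂ : ℝ → ℝ → ℝ} {S X : (Fin N → ℝ) → ℝ}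

theorem pd_eq_of_hasDerivAt_line {g : (Fin N → ℝ) → ℝ} {z : Fin N → ℝ} {d : ℝ} (i : Fin N)
    (hg : DifferentiableAt ℝ g z)
    (hd : HasDerivAt (fun r : ℝ => g (z + r • Pi.single i 1)) d 0) : pd i g z = d := by
  have h1 := hasDerivAt_line i z 0 (by simpa using hg)
  rw [zero_smul, add_zero] at h1
  exact h1.unique hd

theorem HasPartials.pd_comp (hH : HasPartials U H H₁ H₂) (i : Fin N) {z : Fin N → ℝ}
    (hS : DifferentiableAt ℝ S z) (hX : DifferentiableAt ℝ X z) (hU : U (S z) (X z))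
    (hc : DifferentiableAt ℝ (fun z => H (S z) (X z)) z) :
    pd i (fun z => H (S z) (X z)) z = H₁ (S z) (X z) * pd i S z + H₂ (S z) (X z) * pd i X z := by
  refine pd_eq_of_hasDerivAt_line i hc ?_
  have := hH (hasDerivAt_line i z 0 (by simpa using hS)) (hasDerivAt_line i z 0 (by simpa using hX))
    (by simpa using hU)
  simpa using this

theorem HasPartials.lap_comp (hH : HasPartials U H H₁ H₂) (hH₁ : HasPartials U H₁ H₁₁ H₁₂)
    (hH₂ : HasPartials U H₂ H₁₂ H₂₂) (hS : ContDiff ℝ 2 S) (hX : ContDiff ℝ 2 X)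
    (hU : ∀ z, U (S z) (X z)) (hc : ContDiff ℝ 2 fun z => H (S z) (X z)) (z : Fin N → ℝ) :
    lap (fun z => H (S z) (X z)) z
      = H₁₁ (S z) (X z) * ∑ i, pd i S z ^ 2 + 2 * H₁₂ (S z) (X z) * ∑ i, pd i S z * pd i X z
        + H₂₂ (S z) (X z) * ∑ i, pd i X z ^ 2 + H₁ (S z) (X z) * lap S z
        + H₂ (S z) (X z) * lap X z := by
  unfold lap
  simp only [Finset.mul_sum, ← Finset.sum_add_distrib]
  refine Finset.sum_congr rfl fun i _ => ?_
  have hSd := hS.differentiable two_ne_zero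
  have hXd := hX.differentiable two_ne_zero
  have h1 : pd i (fun z => H (S z) (X z))
      = fun z => H₁ (S z) (X z) * pd i S z + H₂ (S z) (X z) * pd i X z := funext fun z =>
    hH.pd_comp i (hSd z) (hXd z) (hU z) (hc.differentiable two_ne_zero z)
  have h2 := (contDiff_pd hc i).differentiable one_ne_zero z
  rw [h1] at h2 ⊢
  refine pd_eq_of_hasDerivAt_line i h2 ?_
  have hSl := hasDerivAt_line i z 0 (hSd _)
  have hXl := hasDerivAt_line i z 0 (hXd _)
  have hSl' := hasDerivAt_line i z 0 ((contDiff_pd hS i).differentiable one_ne_zero _)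
  have hXl' := hasDerivAt_line i z 0 ((contDiff_pd hX i).differentiable one_ne_zero _)
  have := ((hH₁ hSl hXl (hU _)).mul hSl').add ((hH₂ hSl hXl (hU _)).mul hXl')
  refine this.congr_deriv ?_
  simp only [zero_smul, add_zero]
  ring

theorem contDiff_tail {n : WithTop ℕ∞} {g : (Fin m → ℝ) → ℝ} (hg : ContDiff ℝ n g) :
    ContDiff ℝ n fun z : Fin (m + 1) → ℝ => g fun j => z j.succ :=
  hg.comp (by fun_prop)

theorem pd_zero_tail {g : (Fin m → ℝ) → ℝ} (hg : Differentiable ℝ g) (z : Fin (m + 1) → ℝ) :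
    pd 0 (fun z : Fin (m + 1) → ℝ => g fun j => z j.succ) z = 0 := by
  have hd : Differentiable ℝ fun z : Fin (m + 1) → ℝ => g fun j => z j.succ :=
    hg.comp (by fun_prop)
  refine pd_eq_of_hasDerivAt_line 0 (hd z) ?_
  refine (hasDerivAt_const (0 : ℝ) (g fun j => z j.succ)).congr_of_eventuallyEq
    (Filter.Eventually.of_forall fun r => ?_)
  simp

theorem pd_succ_tail {g : (Fin m → ℝ) → ℝ} (hg : Differentiable ℝ g) (i : Fin m)
    (z : Fin (m + 1) → ℝ) :
    pd i.succ (fun z : Fin (m + 1) → ℝ => g fun j => z j.succ) z = pd i g fun j => z j.succ := by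
  have hd : Differentiable ℝ fun z : Fin (m + 1) → ℝ => g fun j => z j.succ :=
    hg.comp (by fun_prop)
  refine pd_eq_of_hasDerivAt_line i.succ (hd z) ?_
  have h1 := hasDerivAt_line i (fun j => z j.succ) 0 (hg _)
  rw [zero_smul, add_zero] at h1
  refine h1.congr_of_eventuallyEq (Filter.Eventually.of_forall fun r => ?_)
  simp only
  congr 1
  funext j
  simp [Pi.single_apply]

theorem lap_tail {g : (Fin m → ℝ) → ℝ} (hg : ContDiff ℝ 2 g) (z : Fin (m + 1) → ℝ) :
    lap (fun z : Fin (m + 1) → ℝ => g fun j => z j.succ) z = lap g fun j => z j.succ := by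
  unfold lap
  have hd := hg.differentiable two_ne_zero
  rw [Fin.sum_univ_succ, show pd 0 (fun z : Fin (m + 1) → ℝ => g fun j => z j.succ) = fun _ => 0
    from funext (pd_zero_tail hd), pd_const, zero_add]
  refine Finset.sum_congr rfl fun i _ => ?_
  rw [show pd i.succ (fun z : Fin (m + 1) → ℝ => g fun j => z j.succ)
    = fun z => pd i g fun j => z j.succ from funext (pd_succ_tail hd i)]
  exact pd_succ_tail ((contDiff_pd hg i).differentiable one_ne_zero) i z

theorem IsCellPeriodic.pd {h : ℝ} {g : (Fin m → ℝ) → ℝ} (hg : IsCellPeriodic h g) (i : Fin m) :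
    IsCellPeriodic h (pd i g) := fun y j => by
  simp only [_root_.pd]
  rw [← fderiv_comp_add_right]
  congr 2
  exact funext fun y => hg y j

end ChainRule

section GaussianProfile

variable {α E η D : ℝ}

/-- A spreading Gaussian, decaying like `s ^ (-α)` and cut off at relative height `η`. -/
def gaussProfile (α E η s x : ℝ) : ℝ := s ^ (-α) * (Real.exp (-(x ^ 2 / (4 * E * s))) - η)

theorem hasDerivAt_gauss_comp (hE : 0 < E) {s x : ℝ → ℝ} {s' x' r : ℝ} (hs : HasDerivAt s s' r)
    (hx : HasDerivAt x x' r) (h0 : 0 < s r) :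
    HasDerivAt (fun r => Real.exp (-(x r ^ 2 / (4 * E * s r))))
      (Real.exp (-(x r ^ 2 / (4 * E * s r)))
        * (x r ^ 2 / (4 * E * s r ^ 2) * s' - x r / (2 * E * s r) * x')) r := by
  have h1 := ((hx.pow 2).div (hs.const_mul (4 * E)) (by positivity)).neg.exp
  refine h1.congr_deriv ?_
  simp only [Pi.pow_apply, Pi.neg_apply, Pi.div_apply]
  field_simp
  ring

theorem hasDerivAt_rpow_comp {s : ℝ → ℝ} {s' r : ℝ} (hs : HasDerivAt s s' r) (h0 : 0 < s r) :
    HasDerivAt (fun r => s r ^ (-α)) (s r ^ (-α) * (-α / s r) * s') r := by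
  refine (hs.rpow_const (p := -α) (Or.inl h0.ne')).congr_deriv ?_
  rw [Real.rpow_sub_one h0.ne']
  ring

theorem hasPartials_gaussProfile (hE : 0 < E) :
    HasPartials (fun s _ => 0 < s) (gaussProfile α E η)
      (fun s x => s ^ (-α) * (-α / s * (Real.exp (-(x ^ 2 / (4 * E * s))) - η)
        + Real.exp (-(x ^ 2 / (4 * E * s))) * (x ^ 2 / (4 * E * s ^ 2))))
      (fun s x => s ^ (-α) * (Real.exp (-(x ^ 2 / (4 * E * s))) * -(x / (2 * E * s)))) := by
  intro s x s' x' r hs hx h0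
  refine ((hasDerivAt_rpow_comp hs h0).mul ((hasDerivAt_gauss_comp hE hs hx h0).sub_const η)
    ).congr_deriv ?_
  simp only
  ring

theorem hasPartials_gaussProfile_fst (hE : 0 < E) :
    HasPartials (fun s _ => 0 < s)
      (fun s x => s ^ (-α) * (-α / s * (Real.exp (-(x ^ 2 / (4 * E * s))) - η)
        + Real.exp (-(x ^ 2 / (4 * E * s))) * (x ^ 2 / (4 * E * s ^ 2))))
      (fun s x => s ^ (-α) * (α * (α + 1) / s ^ 2 * (Real.exp (-(x ^ 2 / (4 * E * s))) - η)
        + Real.exp (-(x ^ 2 / (4 * E * s)))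
          * (x ^ 4 / (16 * E ^ 2 * s ^ 4) - (α + 1) * x ^ 2 / (2 * E * s ^ 3))))
      (fun s x => s ^ (-α) * (Real.exp (-(x ^ 2 / (4 * E * s)))
        * ((α + 1) * x / (2 * E * s ^ 2) - x ^ 3 / (8 * E ^ 2 * s ^ 3)))) := by
  intro s x s' x' r hs hx h0
  have hG := hasDerivAt_gauss_comp hE hs hx h0
  have h1 := ((hasDerivAt_const r (-α)).div hs h0.ne').mul (hG.sub_const η)
  have h2 := hG.mul ((hx.pow 2).div ((hs.pow 2).const_mul (4 * E))
    (by simp only [Pi.pow_apply]; positivity))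
  refine ((hasDerivAt_rpow_comp hs h0).mul (h1.add h2)).congr_deriv ?_
  simp only [Pi.pow_apply, Pi.add_apply, Pi.mul_apply, Pi.div_apply]
  field_simp
  ring

theorem hasPartials_gaussProfile_snd (hE : 0 < E) :
    HasPartials (fun s _ => 0 < s)
      (fun s x => s ^ (-α) * (Real.exp (-(x ^ 2 / (4 * E * s))) * -(x / (2 * E * s))))
      (fun s x => s ^ (-α) * (Real.exp (-(x ^ 2 / (4 * E * s)))
        * ((α + 1) * x / (2 * E * s ^ 2) - x ^ 3 / (8 * E ^ 2 * s ^ 3))))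
      (fun s x => s ^ (-α) * (Real.exp (-(x ^ 2 / (4 * E * s)))
        * (x ^ 2 / (4 * E ^ 2 * s ^ 2) - 1 / (2 * E * s)))) := by
  intro s x s' x' r hs hx h0
  have hG := hasDerivAt_gauss_comp hE hs hx h0
  have h1 := hG.mul (hx.div (hs.const_mul (2 * E)) (by positivity)).neg
  refine ((hasDerivAt_rpow_comp hs h0).mul h1).congr_deriv ?_
  simp only [Pi.neg_apply, Pi.mul_apply, Pi.div_apply]
  field_simp
  ring

/-- Choice of the width and of the cut-off height of the Gaussian profile. -/
theorem exists_gaussProfile_params (hα : 1 / 2 < α) (hD : 0 < D) :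
    ∃ E η R : ℝ, 0 < E ∧ 0 < η ∧ η < 1 ∧ 0 ≤ R ∧ ∀ ξ, 0 ≤ ξ → η < Real.exp (-(ξ / (4 * E))) →
      ξ ≤ R ^ 2 ∧
      α * η - Real.exp (-(ξ / (4 * E))) * (α - D / (2 * E) + (D - E) / (4 * E ^ 2) * ξ)
        ≤ -(α * η) := by
  have hα0 : 0 < α := by linarith
  obtain ⟨E, hE1, hE2⟩ : ∃ E, D / (2 * α) < E ∧ E < D :=
    exists_between ((div_lt_iff₀ (by positivity)).2 (by nlinarith))
  have hE : 0 < E := lt_trans (by positivity) hE1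
  obtain ⟨α', hα'⟩ : ∃ α', α' = α - D / (2 * E) := ⟨_, rfl⟩
  obtain ⟨β, hβ⟩ : ∃ β, β = (D - E) / (4 * E ^ 2) := ⟨_, rfl⟩
  have hα'0 : 0 < α' := by
    rw [hα', sub_pos, div_lt_iff₀ (by positivity)]
    rw [div_lt_iff₀ (by positivity)] at hE1
    linarith
  have hβ0 : 0 < β := by
    rw [hβ]
    exact div_pos (by linarith) (by positivity)
  obtain ⟨e, he⟩ : ∃ e, e = Real.exp (-(2 * α / β / (4 * E))) := ⟨_, rfl⟩
  have he0 : 0 < e := he ▸ Real.exp_pos _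
  have he1 : e ≤ 1 := by
    rw [he]
    exact Real.exp_le_one_iff.2 (neg_nonpos.2 (by positivity))
  obtain ⟨η, hη⟩ : ∃ η, η = α' * e / (2 * α) := ⟨_, rfl⟩
  have hη0 : 0 < η := by rw [hη]; positivity
  have hη2 : 2 * α * η = α' * e := by rw [hη]; field_simp
  have hα'α : α' ≤ α := by
    rw [hα']
    have : 0 ≤ D / (2 * E) := by positivity
    linarith
  have hη1 : η < 1 := by
    by_contra! hcon
    nlinarith
  have hlog : 0 ≤ 4 * E * -Real.log η :=
    mul_nonneg (by positivity) (neg_nonneg.2 (Real.log_nonpos hη0.le hη1.le))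
  refine ⟨E, η, Real.sqrt (4 * E * -Real.log η), hE, hη0, hη1, Real.sqrt_nonneg _,
    fun ξ hξ hG => ⟨?_, ?_⟩⟩
  · rw [Real.sq_sqrt hlog]
    have := (Real.log_lt_log hη0 hG).le
    rw [Real.log_exp] at this
    have h2 : ξ / (4 * E) ≤ -Real.log η := by linarith
    rw [div_le_iff₀ (by positivity)] at h2
    linarith
  · rw [← hα', ← hβ]
    have hG0 := Real.exp_pos (-(ξ / (4 * E)))
    rcases le_or_gt (2 * α / β) ξ with h | h
    · rw [div_le_iff₀ hβ0] at h
      have h1 : η * (2 * α) ≤ Real.exp (-(ξ / (4 * E))) * (β * ξ) :=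
        mul_le_mul hG.le (by linarith) (by positivity) hG0.le
      nlinarith
    · have h1 : e ≤ Real.exp (-(ξ / (4 * E))) := by
        rw [he]
        refine Real.exp_le_exp.2 (neg_le_neg ?_)
        exact div_le_div_of_nonneg_right h.le (by positivity)
      have h2 : e * α' ≤ Real.exp (-(ξ / (4 * E))) * (α' + β * ξ) :=
        mul_le_mul h1 (by nlinarith) hα'0.le hG0.le
      nlinarith

end GaussianProfile

section ProfileInequality

set_option maxHeartbeats 800000 in
/-- For large times the diffusive decay of the Gaussian profile dominates the corrector errors. -/
theorem gaussProfile_sub_le {α E η R D k₀ P Q G r y k p q : ℝ} (hα : 0 < α) (hE : 0 < E)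
    (hη : 0 < η) (hP : 0 ≤ P) (hk₀ : 0 ≤ k₀) (hGη : η < G) (hG1 : G ≤ 1)
    (hy : |y| ≤ R)
    (hmain : α * η - G * (α - D / (2 * E) + (D - E) / (4 * E ^ 2) * y ^ 2) ≤ -(α * η))
    (hr1 : 1 ≤ r)
    (hr : P * (α * (α + 1) + (α + 1) * R ^ 2 / (2 * E) + R ^ 4 / (16 * E ^ 2))
      + 2 * Q * ((α + 1) * R / (2 * E) + R ^ 3 / (8 * E ^ 2)) ≤ k₀ * (α * η) * r)
    (hk : k₀ ≤ k) (hp : |p| ≤ P) (hq : |q| ≤ Q) :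
    k * (-α / r ^ 2 * (G - η) + G * ((r * y) ^ 2 / (4 * E * (r ^ 2) ^ 2))
        - D * (G * ((r * y) ^ 2 / (4 * E ^ 2 * (r ^ 2) ^ 2) - 1 / (2 * E * r ^ 2))))
      - (α * (α + 1) / (r ^ 2) ^ 2 * (G - η) + G * ((r * y) ^ 4 / (16 * E ^ 2 * (r ^ 2) ^ 4)
        - (α + 1) * (r * y) ^ 2 / (2 * E * (r ^ 2) ^ 3))) * p
      - 2 * (G * ((α + 1) * (r * y) / (2 * E * (r ^ 2) ^ 2)
        - (r * y) ^ 3 / (8 * E ^ 2 * (r ^ 2) ^ 3))) * q ≤ 0 := by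
  have hr0 : 0 < r := by linarith
  have hG0 : 0 < G := hη.trans hGη
  obtain ⟨A, hA⟩ : ∃ A, A = α * η - G * (α - D / (2 * E) + (D - E) / (4 * E ^ 2) * y ^ 2) :=
    ⟨_, rfl⟩
  obtain ⟨B, hB⟩ : ∃ B, B = α * (α + 1) * (G - η)
    + G * (y ^ 4 / (16 * E ^ 2) - (α + 1) * y ^ 2 / (2 * E)) := ⟨_, rfl⟩
  obtain ⟨C, hC⟩ : ∃ C, C = G * ((α + 1) * y / (2 * E) - y ^ 3 / (8 * E ^ 2)) := ⟨_, rfl⟩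
  have hscale : k * (-α / r ^ 2 * (G - η) + G * ((r * y) ^ 2 / (4 * E * (r ^ 2) ^ 2))
        - D * (G * ((r * y) ^ 2 / (4 * E ^ 2 * (r ^ 2) ^ 2) - 1 / (2 * E * r ^ 2))))
      - (α * (α + 1) / (r ^ 2) ^ 2 * (G - η) + G * ((r * y) ^ 4 / (16 * E ^ 2 * (r ^ 2) ^ 4)
        - (α + 1) * (r * y) ^ 2 / (2 * E * (r ^ 2) ^ 3))) * p
      - 2 * (G * ((α + 1) * (r * y) / (2 * E * (r ^ 2) ^ 2)
        - (r * y) ^ 3 / (8 * E ^ 2 * (r ^ 2) ^ 3))) * q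
      = (k * A * r ^ 2 - B * p - 2 * C * q * r) / r ^ 4 := by
    rw [hA, hB, hC]
    field_simp
    ring
  rw [hscale]
  clear hscale
  refine div_nonpos_of_nonpos_of_nonneg ?_ (by positivity)
  have hy2 : y ^ 2 ≤ R ^ 2 := by
    rw [← sq_abs y]
    exact pow_le_pow_left₀ (abs_nonneg _) hy 2
  have hB' : |B| ≤ α * (α + 1) + (α + 1) * R ^ 2 / (2 * E) + R ^ 4 / (16 * E ^ 2) := by
    have h1 : G * (y ^ 4 / (16 * E ^ 2)) ≤ R ^ 4 / (16 * E ^ 2) := by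
      have : y ^ 4 / (16 * E ^ 2) ≤ R ^ 4 / (16 * E ^ 2) := by
        refine div_le_div_of_nonneg_right ?_ (by positivity)
        nlinarith [pow_le_pow_left₀ (sq_nonneg y) hy2 2]
      exact (mul_le_of_le_one_left (by positivity) hG1).trans this
    have h2 : G * ((α + 1) * y ^ 2 / (2 * E)) ≤ (α + 1) * R ^ 2 / (2 * E) := by
      have : (α + 1) * y ^ 2 / (2 * E) ≤ (α + 1) * R ^ 2 / (2 * E) := by gcongr
      exact (mul_le_of_le_one_left (by positivity) hG1).trans this
    have h3 : 0 ≤ G * (y ^ 4 / (16 * E ^ 2)) := by positivity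
    have h4 : 0 ≤ G * ((α + 1) * y ^ 2 / (2 * E)) := by positivity
    have h5 : α * (α + 1) * (G - η) ≤ α * (α + 1) :=
      mul_le_of_le_one_right (by positivity) (by linarith)
    have h6 : 0 ≤ α * (α + 1) * (G - η) := mul_nonneg (by positivity) (by linarith)
    have h7 : B = α * (α + 1) * (G - η) + G * (y ^ 4 / (16 * E ^ 2))
        - G * ((α + 1) * y ^ 2 / (2 * E)) := by rw [hB]; ring
    have h8 : 0 ≤ (α + 1) * R ^ 2 / (2 * E) := by positivity
    rw [h7, abs_le]
    constructor <;> linarith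
  have hC' : |C| ≤ (α + 1) * R / (2 * E) + R ^ 3 / (8 * E ^ 2) := by
    rw [hC, abs_mul, abs_of_pos hG0]
    refine (mul_le_of_le_one_left (abs_nonneg _) hG1).trans ((abs_sub _ _).trans ?_)
    rw [abs_div, abs_div, abs_mul, abs_pow, abs_of_pos (by positivity : 0 < 2 * E),
      abs_of_pos (by positivity : 0 < 8 * E ^ 2), abs_of_pos (by linarith : 0 < α + 1)]
    gcongr
  obtain ⟨K₁, hK₁⟩ : ∃ K₁, K₁ = α * (α + 1) + (α + 1) * R ^ 2 / (2 * E) + R ^ 4 / (16 * E ^ 2) :=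
    ⟨_, rfl⟩
  obtain ⟨K₂, hK₂⟩ : ∃ K₂, K₂ = (α + 1) * R / (2 * E) + R ^ 3 / (8 * E ^ 2) := ⟨_, rfl⟩
  rw [← hK₁] at hB' hr
  rw [← hK₂] at hC' hr
  rw [← hA] at hmain
  have hBp : -(B * p) ≤ P * K₁ := by
    refine (neg_le_abs _).trans ?_
    rw [abs_mul, mul_comm P]
    exact mul_le_mul hB' hp (abs_nonneg _) ((abs_nonneg _).trans hB')
  have hCq : -(C * q) ≤ Q * K₂ := by
    refine (neg_le_abs _).trans ?_
    rw [abs_mul, mul_comm Q]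
    exact mul_le_mul hC' hq (abs_nonneg _) ((abs_nonneg _).trans hC')
  have hkA : k * A ≤ -(k₀ * (α * η)) := by
    have hαη : 0 < α * η := by positivity
    nlinarith
  have hPK : 0 ≤ P * K₁ := mul_nonneg hP ((abs_nonneg _).trans hB')
  have h1 : k * A * r ^ 2 ≤ -(k₀ * (α * η)) * r ^ 2 := mul_le_mul_of_nonneg_right hkA (sq_nonneg r)
  have h2 : -(C * q) * r ≤ Q * K₂ * r := mul_le_mul_of_nonneg_right hCq hr0.le
  have h3 : (P * K₁ + 2 * Q * K₂) * r ≤ k₀ * (α * η) * r * r := mul_le_mul_of_nonneg_right hr hr0.le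
  have h4 : P * K₁ ≤ P * K₁ * r := le_mul_of_one_le_right hPK hr1
  nlinarith

end ProfileInequality

section Subsolution

variable {m : ℕ} {h α : ℝ} {b : (Fin m → ℝ) → ℝ}

theorem gaussProfile_continuousOn (E η : ℝ) (hE : 0 < E) :
    ContinuousOn (fun p : ℝ × ℝ => gaussProfile α E η p.1 p.2) {p | 0 < p.1} := by
  unfold gaussProfile
  refine ContinuousOn.mul (fun p hp => ?_) (ContinuousOn.sub (ContinuousOn.rexp
    (ContinuousOn.neg (ContinuousOn.div (by fun_prop) (by fun_prop) fun p hp => ?_)))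
    continuousOn_const)
  · exact (continuousAt_fst.rpow_const (Or.inl (ne_of_gt hp))).continuousWithinAt
  · have : 0 < p.1 := hp
    positivity

theorem contDiff_gaussProfile_comp {E η : ℝ} (hE : 0 < E) {N : ℕ} {S X : (Fin N → ℝ) → ℝ}
    (hS : ContDiff ℝ 2 S) (hX : ContDiff ℝ 2 X) (h0 : ∀ z, 0 < S z) :
    ContDiff ℝ 2 fun z => gaussProfile α E η (S z) (X z) := by
  unfold gaussProfile
  refine (hS.rpow_const_of_ne fun z => (h0 z).ne').mul (ContDiff.sub (ContDiff.exp
    ((hX.pow 2).div (contDiff_const.mul hS) fun z => ?_).neg) contDiff_const)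
  have := h0 z
  positivity

set_option maxHeartbeats 1000000 in
/-- Correctors for the drift and for the effective diffusivity turn the Gaussian profile into a
subsolution, on its positivity set, of the linear equation with shear drift. -/
theorem exists_shear_subsolution (hh : 0 < h) (hb : ContDiff ℝ 1 b) (hper : IsCellPeriodic h b)
    (hα : 1 / 2 < α) :
    ∃ (φ : ℝ → (Fin (m + 1) → ℝ) → ℝ) (t₁ τ c : ℝ), 0 < c ∧ 0 < t₁ + τ ∧
      ContinuousOn (fun p : ℝ × (Fin (m + 1) → ℝ) => φ p.1 p.2) (Set.Ici t₁ ×ˢ Set.univ) ∧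
      ∀ t, t₁ ≤ t → ContDiff ℝ 2 (φ t) ∧ (∃ z, c * (t + τ) ^ (-α) ≤ φ t z) ∧
        (∃ L, ∀ z, 0 < φ t z → |z 0| ≤ L) ∧ ∀ z, DifferentiableAt ℝ (fun s => φ s z) t ∧
          φ t z ≤ 1 ∧ (0 < φ t z →
            deriv (fun s => φ s z) t + b (fun j => z j.succ) * pd 0 (φ t) z ≤ lap (φ t) z) := by
  have hα0 : 0 < α := by linarith
  obtain ⟨_, hbB⟩ := hper.exists_isBddLip hh hb
  obtain ⟨χ, b₀, hχ, hχp, hχl, -⟩ := exists_poisson hh hbB hper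
  have hac : ContDiff ℝ 1 fun y => 1 + ∑ i, pd i χ y ^ 2 :=
    contDiff_const.add (ContDiff.sum fun i _ => (contDiff_pd hχ i).pow 2)
  have hap : IsCellPeriodic h fun y => 1 + ∑ i, pd i χ y ^ 2 := fun y j => by
    simp only [hχp.pd _ y j]
  obtain ⟨_, haB⟩ := hap.exists_isBddLip hh hac
  obtain ⟨ρ, D, hρ, hρp, hρl, hD⟩ := exists_poisson hh haB hap
  have hD1 : 1 ≤ D := hD 1 fun y => by
    have : 0 ≤ ∑ i, pd i χ y ^ 2 := Finset.sum_nonneg fun i _ => sq_nonneg _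
    linarith
  have hD0 : 0 < D := by linarith
  obtain ⟨σ, hσdef⟩ : ∃ σ : (Fin m → ℝ) → ℝ, σ = fun y => -D⁻¹ * ρ y := ⟨_, rfl⟩
  have hσ : ContDiff ℝ 2 σ := hσdef ▸ contDiff_const.mul hρ
  have hσp : IsCellPeriodic h σ := fun y j => by rw [hσdef]; simp only [hρp y j]
  have hσl : ∀ y, lap σ y = 1 - (1 + ∑ i, pd i χ y ^ 2) * D⁻¹ := fun y => by
    rw [hσdef, lap_const_mul _ hρ, hρl]
    field_simp
    ring
  obtain ⟨Bσ, hBσ0, hBσ⟩ := hσp.exists_norm_le hh hσ.continuous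
  obtain ⟨Bχ, hBχ0, hBχ⟩ := hχp.exists_norm_le hh hχ.continuous
  have hσd := hσ.differentiable two_ne_zero
  have hχd := hχ.differentiable two_ne_zero
  obtain ⟨P, hP0, hP⟩ := IsCellPeriodic.exists_norm_le hh
    (g := fun y => ∑ i, pd i σ y ^ 2) (fun y j => by simp only [hσp.pd _ y j])
    (continuous_finsetSum _ fun i _ => (contDiff_pd hσ i).continuous.pow 2)
  obtain ⟨Q, hQ0, hQ⟩ := IsCellPeriodic.exists_norm_le hh
    (g := fun y => ∑ i, pd i σ y * pd i χ y)
    (fun y j => by simp only [hσp.pd _ y j, hχp.pd _ y j])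
    (continuous_finsetSum _ fun i _ =>
      (contDiff_pd hσ i).continuous.mul (contDiff_pd hχ i).continuous)
  obtain ⟨E, η, R, hE, hη0, hη1, hR, hpar⟩ := exists_gaussProfile_params hα hD0
  obtain ⟨K, hK⟩ : ∃ K, K = P * (α * (α + 1) + (α + 1) * R ^ 2 / (2 * E) + R ^ 4 / (16 * E ^ 2))
      + 2 * Q * ((α + 1) * R / (2 * E) + R ^ 3 / (8 * E ^ 2)) := ⟨_, rfl⟩
  obtain ⟨C, hC⟩ : ∃ C, C = K / (D⁻¹ * (α * η)) := ⟨_, rfl⟩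
  let S : ℝ → (Fin (m + 1) → ℝ) → ℝ := fun t z => t + σ fun j => z j.succ
  let X : ℝ → (Fin (m + 1) → ℝ) → ℝ := fun t z => z 0 + (-b₀ * t + χ fun j => z j.succ)
  have hS1 : ∀ t, Bσ + 1 + C ^ 2 ≤ t → ∀ z, 1 + C ^ 2 ≤ S t z := fun t ht z => by
    have := (abs_le.1 (hBσ fun j => z j.succ)).1
    simp only [S]
    linarith
  have hS0 : ∀ t, Bσ + 1 + C ^ 2 ≤ t → ∀ z, 0 < S t z := fun t ht z => by
    nlinarith [hS1 t ht z]
  have hσt := contDiff_tail hσ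
  have hχt := contDiff_tail hχ
  have hSC : ∀ t, ContDiff ℝ 2 (S t) := fun t => contDiff_const.add hσt
  have hx : ContDiff ℝ 2 fun z : Fin (m + 1) → ℝ => z 0 := by fun_prop
  have hXC : ∀ t, ContDiff ℝ 2 (X t) := fun t => hx.add (contDiff_const.add hχt)
  have hSpd : ∀ t z i, pd i (S t) z = pd i (fun z : Fin (m + 1) → ℝ => σ fun j => z j.succ) z :=
    fun t z i => by
      simp only [S]
      rw [pd_add i (by fun_prop) (hσt.differentiable two_ne_zero z), pd_const, zero_add]
  have hXpd : ∀ t z i, pd i (X t) z = (if i = 0 then 1 else 0)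
      + pd i (fun z : Fin (m + 1) → ℝ => χ fun j => z j.succ) z := fun t z i => by
    simp only [X]
    rw [pd_add i (by fun_prop) ((contDiff_const.add hχt).differentiable two_ne_zero z), pd_coord,
      pd_add i (by fun_prop) (hχt.differentiable two_ne_zero z), pd_const, zero_add]
  have hSlap : ∀ t z, lap (S t) z = lap σ fun j => z j.succ := fun t z => by
    simp only [S]
    rw [lap_add contDiff_const hσt, lap_const, lap_tail hσ, zero_add]
  have hXlap : ∀ t z, lap (X t) z = lap χ fun j => z j.succ := fun t z => by
    simp only [X]
    rw [lap_add hx (contDiff_const.add hχt), lap_add contDiff_const hχt, lap_const, lap_tail hχ,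
      lap_coord, zero_add, zero_add]
  have hφC : ∀ t, Bσ + 1 + C ^ 2 ≤ t → ContDiff ℝ 2 fun z => gaussProfile α E η (S t z) (X t z) :=
    fun t ht => contDiff_gaussProfile_comp hE (hSC t) (hXC t) (hS0 t ht)
  refine ⟨fun t z => gaussProfile α E η (S t z) (X t z), Bσ + 1 + C ^ 2, σ 0, 1 - η, by linarith,
    ?_, ?_, fun t ht => ⟨hφC t ht, ?_, ?_, fun z => ?_⟩⟩
  · have := (abs_le.1 (hBσ 0)).1
    nlinarith
  · refine (gaussProfile_continuousOn E η hE).comp (f := fun p : ℝ × (Fin (m + 1) → ℝ) =>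
      (S p.1 p.2, X p.1 p.2)) (Continuous.continuousOn ?_) fun p hp => hS0 _ hp.1 _
    have h1 : Continuous fun p : ℝ × (Fin (m + 1) → ℝ) => σ fun j => p.2 j.succ :=
      hσ.continuous.comp (by fun_prop)
    have h2 : Continuous fun p : ℝ × (Fin (m + 1) → ℝ) => χ fun j => p.2 j.succ :=
      hχ.continuous.comp (by fun_prop)
    simp only [S, X]
    fun_prop
  · refine ⟨Pi.single 0 (b₀ * t - χ 0), ?_⟩
    have h1 : (fun j : Fin m => (Pi.single 0 (b₀ * t - χ 0) : Fin (m + 1) → ℝ) j.succ) = 0 :=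
      funext fun j => by simp
    simp only [S, X, gaussProfile, h1, Pi.single_eq_same]
    rw [show b₀ * t - χ 0 + (-b₀ * t + χ 0) = 0 by ring]
    simp [mul_comm]
  · refine ⟨R * (t + Bσ + 1) + |b₀ * t| + Bχ, fun z hz => ?_⟩
    have hSz := hS1 t ht z
    have hG : η < Real.exp (-(X t z ^ 2 / S t z / (4 * E))) := by
      have := (pos_iff_pos_of_mul_pos hz).1 (Real.rpow_pos_of_pos (hS0 t ht z) _)
      rw [div_div, mul_comm (S t z)]
      linarith
    have h1 := (hpar _ (div_nonneg (sq_nonneg _) (hS0 t ht z).le) hG).1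
    rw [div_le_iff₀ (hS0 t ht z)] at h1
    have h2 : S t z ≤ t + Bσ + 1 := by
      have := (abs_le.1 (hBσ fun j => z j.succ)).2
      simp only [S]
      linarith
    have h3 : |X t z| ≤ R * (t + Bσ + 1) := by
      refine abs_le_of_sq_le_sq (h1.trans ?_) (mul_nonneg hR (by nlinarith [hS0 t ht z]))
      rw [mul_pow]
      refine mul_le_mul_of_nonneg_left ?_ (sq_nonneg R)
      nlinarith [sq_nonneg C]
    have h4 : z 0 = X t z + b₀ * t + -χ fun j => z j.succ := by simp only [X]; ring
    rw [h4]
    refine (abs_add_le _ _).trans (add_le_add ((abs_add_le _ _).trans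
      (add_le_add_left h3 _)) ?_)
    rw [abs_neg]
    exact hBχ _
  have hSz := hS0 t ht z
  have hSz1 := hS1 t ht z
  have hSt : HasDerivAt (fun s => S s z) 1 t := (hasDerivAt_id t).add_const _
  have hXt : HasDerivAt (fun s => X s z) (-b₀) t :=
    ((((hasDerivAt_id t).const_mul (-b₀)).add_const (χ fun j => z j.succ)).const_add
      (z 0)).congr_deriv (mul_one _)
  have hφt := hasPartials_gaussProfile (α := α) (η := η) hE hSt hXt hSz
  refine ⟨hφt.differentiableAt, ?_, fun hpos => ?_⟩
  · have h1 : S t z ^ (-α) ≤ 1 := Real.rpow_le_one_of_one_le_of_nonpos (by nlinarith) (by linarith)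
    have h2 : Real.exp (-(X t z ^ 2 / (4 * E * S t z))) ≤ 1 :=
      Real.exp_le_one_iff.2 (neg_nonpos.2 (by positivity))
    exact (mul_le_of_le_one_right (by positivity) (by linarith)).trans h1
  rw [hφt.deriv, (hasPartials_gaussProfile hE).pd_comp 0 ((hSC t).differentiable two_ne_zero z)
    ((hXC t).differentiable two_ne_zero z) hSz ((hφC t ht).differentiable two_ne_zero z),
    (hasPartials_gaussProfile hE).lap_comp (hasPartials_gaussProfile_fst hE)
      (hasPartials_gaussProfile_snd hE) (hSC t) (hXC t) (hS0 t ht) (hφC t ht)]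
  simp only [hSpd, hXpd, hSlap, hXlap, Fin.sum_univ_succ, pd_zero_tail hσd, pd_zero_tail hχd,
    pd_succ_tail hσd, pd_succ_tail hχd, hσl, hχl, if_true, Fin.succ_ne_zero, if_false]
  obtain ⟨y', hy'⟩ : ∃ y' : Fin m → ℝ, y' = fun j => z j.succ := ⟨_, rfl⟩
  rw [← hy']
  obtain ⟨p, hp⟩ : ∃ p, p = ∑ i, pd i σ y' ^ 2 := ⟨_, rfl⟩
  obtain ⟨q, hq⟩ : ∃ q, q = ∑ i, pd i σ y' * pd i χ y' := ⟨_, rfl⟩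
  obtain ⟨a, ha⟩ : ∃ a, a = ∑ i, pd i χ y' ^ 2 := ⟨_, rfl⟩
  have ha0 : 0 ≤ a := ha ▸ Finset.sum_nonneg fun i _ => sq_nonneg _
  have hpP : |p| ≤ P := hp ▸ hP y'
  have hqQ : |q| ≤ Q := hq ▸ hQ y'
  simp only [zero_add, add_zero, ne_eq, OfNat.ofNat_ne_zero, not_false_eq_true, zero_pow,
    one_pow, mul_one, mul_zero]
  rw [← hp, ← hq, ← ha]
  obtain ⟨r, hr⟩ : ∃ r, r = Real.sqrt (S t z) := ⟨_, rfl⟩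
  have hrS : S t z = r ^ 2 := by rw [hr, Real.sq_sqrt hSz.le]
  have hr1 : 1 ≤ r := hr ▸ Real.one_le_sqrt.2 (by nlinarith)
  have hr0 : 0 < r := by linarith
  have hrC : C ≤ r := by
    rw [hr]
    exact Real.le_sqrt_of_sq_le (by linarith)
  obtain ⟨y, hy⟩ : ∃ y, X t z = r * y := ⟨X t z / r, by field_simp⟩
  have hξ : (r * y) ^ 2 / (4 * E * r ^ 2) = y ^ 2 / (4 * E) := by field_simp
  have hG : η < Real.exp (-(y ^ 2 / (4 * E))) := by
    have := (pos_iff_pos_of_mul_pos hpos).1 (Real.rpow_pos_of_pos hSz _)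
    rw [hrS, hy, hξ] at this
    linarith
  obtain ⟨hyR, hmain⟩ := hpar _ (sq_nonneg y) hG
  have hkη : 0 < D⁻¹ * (α * η) := by positivity
  have hKr : K ≤ D⁻¹ * (α * η) * r := by
    rw [hC, div_le_iff₀ hkη] at hrC
    linarith
  rw [hK] at hKr
  have hkk : D⁻¹ ≤ (1 + a) * D⁻¹ := le_mul_of_one_le_left (by positivity) (by linarith)
  have hG1 : Real.exp (-(y ^ 2 / (4 * E))) ≤ 1 :=
    Real.exp_le_one_iff.2 (neg_nonpos.2 (by positivity))
  have hfin := gaussProfile_sub_le hα0 hE hη0 hP0 (by positivity : 0 ≤ D⁻¹) hG hG1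
    (abs_le_of_sq_le_sq hyR hR) hmain hr1 hKr hkk hpP hqQ
  have hpow : 0 ≤ (r ^ 2) ^ (-α) := by positivity
  have hfin' := mul_nonpos_of_nonneg_of_nonpos hpow hfin
  rw [hrS, hy, hξ]
  rw [← sub_nonpos]
  refine le_of_eq_of_le ?_ hfin'
  have hDD : D * D⁻¹ = 1 := mul_inv_cancel₀ hD0.ne'
  obtain ⟨d, hd⟩ : ∃ d, d = D⁻¹ := ⟨_, rfl⟩
  rw [← hd] at hDD ⊢
  generalize (r ^ 2) ^ (-α) = w
  generalize Real.exp (-(y ^ 2 / (4 * E))) = G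
  linear_combination (1 + a) * w * (G * ((r * y) ^ 2 / (4 * E ^ 2 * (r ^ 2) ^ 2)
    - 1 / (2 * E * r ^ 2))) * hDD

end Subsolution

section PowerFlow

variable {q κ : ℝ}

/-- The inverse of the time-`τ` flow of `s' = (κ / q) * s ^ (q + 1)`. -/
def powerFlow (q κ s τ : ℝ) : ℝ := (s ^ (-q) + κ * τ) ^ (-(1 / q))

theorem powerFlow_base_pos (hκ : 0 < κ) {s τ : ℝ} (hs : 0 < s) (hτ : 0 ≤ τ) :
    0 < s ^ (-q) + κ * τ :=
  add_pos_of_pos_of_nonneg (Real.rpow_pos_of_pos hs _) (by positivity)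

theorem powerFlow_zero (hq : 0 < q) {s : ℝ} (hs : 0 < s) : powerFlow q κ s 0 = s := by
  rw [powerFlow, mul_zero, add_zero, ← Real.rpow_mul hs.le]
  rw [show -q * -(1 / q) = 1 by field_simp, Real.rpow_one]

theorem powerFlow_le (hq : 0 < q) (hκ : 0 < κ) {s τ : ℝ} (hs : 0 < s) (hτ : 0 < τ) :
    powerFlow q κ s τ ≤ (κ * τ) ^ (-(1 / q)) :=
  Real.rpow_le_rpow_of_nonpos (by positivity)
    (le_add_of_nonneg_left (Real.rpow_nonneg hs.le _)) (neg_nonpos.2 (by positivity))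

theorem hasPartials_powerFlow (hq : 0 < q) (hκ : 0 < κ) :
    HasPartials (fun s τ => 0 < s ∧ 0 ≤ τ) (powerFlow q κ)
      (fun s τ => (s ^ (-q) + κ * τ) ^ (-(1 / q) - 1) * s ^ (-q - 1))
      (fun s τ => -(κ / q) * (s ^ (-q) + κ * τ) ^ (-(1 / q) - 1)) := by
  intro s x s' x' r hs hx h0
  have h1 := (hs.rpow_const (p := -q) (Or.inl h0.1.ne')).add (hx.const_mul κ)
  refine (h1.rpow_const (p := -(1 / q))
    (Or.inl (powerFlow_base_pos hκ h0.1 h0.2).ne')).congr_deriv ?_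
  simp only [Pi.add_apply]
  field_simp
  ring

theorem hasPartials_powerFlow_fst (hq : 0 < q) (hκ : 0 < κ) {τ : ℝ} (hτ : 0 ≤ τ) :
    HasPartials (fun s _ => 0 < s)
      (fun s _ => (s ^ (-q) + κ * τ) ^ (-(1 / q) - 1) * s ^ (-q - 1))
      (fun s _ => -((q + 1) * (κ * τ) * ((s ^ (-q) + κ * τ) ^ (-(1 / q) - 1 - 1)
        * s ^ (-q - 1 - 1)))) (fun _ _ => 0) := by
  intro s x s' x' r hs _ h0
  have hω := powerFlow_base_pos (q := q) hκ h0 hτ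
  have h1 := (hs.rpow_const (p := -q) (Or.inl h0.ne')).add_const (κ * τ)
  refine ((h1.rpow_const (p := -(1 / q) - 1) (Or.inl hω.ne')).mul
    (hs.rpow_const (p := -q - 1) (Or.inl h0.ne'))).congr_deriv ?_
  simp only [zero_mul, add_zero]
  have h2 : s r ^ (-q - 1) = s r ^ (-q - 1 - 1) * s r := by
    rw [Real.rpow_sub_one h0.ne' (-q - 1), div_mul_cancel₀ _ h0.ne']
  have h3 : s r ^ (-q) = s r ^ (-q - 1 - 1) * s r * s r := by
    rw [← h2, Real.rpow_sub_one h0.ne' (-q), div_mul_cancel₀ _ h0.ne']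
  have h4 : (s r ^ (-q) + κ * τ) ^ (-(1 / q) - 1)
      = (s r ^ (-q) + κ * τ) ^ (-(1 / q) - 1 - 1) * (s r ^ (-q) + κ * τ) := by
    rw [Real.rpow_sub_one hω.ne' (-(1 / q) - 1), div_mul_cancel₀ _ hω.ne']
  have h5 : (-(1 / q) - 1) * -q = 1 + q := by field_simp; ring
  rw [h4, h2]
  generalize (s r ^ (-q) + κ * τ) ^ (-(1 / q) - 1 - 1) = v
  rw [h3]
  generalize s r ^ (-q - 1 - 1) = w
  linear_combination s' * w * s r * v * w * s r * h5

end PowerFlow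

section NoQuenching

variable {m : ℕ} {h M A : ℝ} {u : (Fin m → ℝ) → ℝ} {f : ℝ → ℝ} {T0 : (Fin (m + 1) → ℝ) → ℝ}
  {T : ℝ → (Fin (m + 1) → ℝ) → ℝ}

theorem IsShearSol.pos (hT : IsShearSol m h M A u f T0 T) (hh : 0 < h) (hM : 0 < M)
    (hf : ∀ s ∈ Set.Icc (0 : ℝ) 1, 0 ≤ f s) (hu : Continuous u) (hper : IsCellPeriodic h u)
    (h0 : ∃ z, T0 z ≠ 0) {t : ℝ} (ht : 0 < t) (z : Fin (m + 1) → ℝ) : 0 < T t z := by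
  obtain ⟨z₀, hz₀⟩ := h0
  obtain ⟨B, _, hB⟩ := hper.exists_norm_le hh hu
  rw [← hT.init] at hz₀
  refine supersolution_pos (b := fun z => A * u fun j => z j.succ) (β := |A| * B) (fun z => ?_) ht
    (hT.cont.mono fun p hp => hp.1.1) (fun s hs z => (hT.mem_Icc s z hs.1).1)
    (fun s hs z => hT.timeDiff s z hs.1) (fun s hs => hT.spaceC2 s hs.1) (fun s hs z => ?_)
    (lt_of_le_of_ne (hT.mem_Icc 0 z₀ le_rfl).1 hz₀.symm) z
  · rw [abs_mul]
    exact mul_le_mul_of_nonneg_left (hB _) (abs_nonneg _)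
  · rw [hT.eqn s z hs.1]
    exact le_add_of_nonneg_right (mul_nonneg hM.le (hf _ (hT.mem_Icc s z hs.1.le)))

theorem IsShearSol.exists_lower_bound (hT : IsShearSol m h M A u f T0 T) (hh : 0 < h) {t : ℝ}
    (ht : 0 < t) (hpos : ∀ z, 0 < T t z) (L : ℝ) :
    ∃ ε > 0, ∀ z, |z 0| ≤ L → ε ≤ T t z := by
  obtain ⟨ε, hε, hle⟩ := (isCompact_Icc (a := (Fin.cons (-L) fun _ => 0 : Fin (m + 1) → ℝ))
    (b := (Fin.cons L fun _ => h : Fin (m + 1) → ℝ))).exists_forall_le'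
    (hT.spaceC2 t ht).continuous.continuousOn fun z _ => hpos z
  refine ⟨ε, hε, fun z hz => ?_⟩
  obtain ⟨z', hz', hm', h0⟩ := exists_eq_of_periodic hh (e := Fin.succ) (Fin.succ_injective m)
    (fun z j => hT.periodic t z ht.le j) z
  rw [← hz']
  have h1 : z' 0 = z 0 := h0 0 fun j => Fin.succ_ne_zero j
  refine hle z' ⟨fun i => ?_, fun i => ?_⟩
  · refine Fin.cases ?_ (fun j => ?_) i
    · simpa [h1] using (abs_le.1 hz).1
    · simpa using (hm' j).1
  · refine Fin.cases ?_ (fun j => ?_) i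
    · simpa [h1] using (abs_le.1 hz).2
    · simpa using (hm' j).2

theorem exists_rpow_lt_rpow {α γ c κ τ t₀ : ℝ} (hα : 0 < α) (hαγ : α < γ) (hc : 0 < c)
    (hκ : 0 < κ) (hτ : 0 < t₀ + τ) :
    ∃ t, t₀ < t ∧ (κ * (t - t₀)) ^ (-γ) < c * (t + τ) ^ (-α) := by
  have h1 := (tendsto_rpow_atTop (sub_pos.2 hαγ)).eventually_gt_atTop
    (κ ^ (-γ) / (c * 2 ^ (-α)))
  obtain ⟨x, hx, hx1, hx0⟩ := (h1.and ((Filter.eventually_ge_atTop (t₀ + τ)).and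
    (Filter.eventually_gt_atTop 0))).exists
  refine ⟨t₀ + x, by linarith, ?_⟩
  rw [add_sub_cancel_left, Real.mul_rpow hκ.le hx0.le]
  rw [div_lt_iff₀ (by positivity)] at hx
  have h2 : (2 * x) ^ (-α) ≤ (t₀ + x + τ) ^ (-α) :=
    Real.rpow_le_rpow_of_nonpos (by linarith) (by linarith) (by linarith)
  rw [Real.mul_rpow zero_le_two hx0.le] at h2
  have h3 : x ^ (-α) = x ^ (γ - α) * x ^ (-γ) := by
    rw [← Real.rpow_add hx0]
    ring_nf
  have h4 : 0 < x ^ (-γ) := Real.rpow_pos_of_pos hx0 _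
  calc κ ^ (-γ) * x ^ (-γ) < x ^ (γ - α) * (c * 2 ^ (-α)) * x ^ (-γ) :=
        mul_lt_mul_of_pos_right hx h4
    _ = c * (2 ^ (-α) * x ^ (-α)) := by rw [h3]; ring
    _ ≤ c * (t₀ + x + τ) ^ (-α) := mul_le_mul_of_nonneg_left h2 hc.le

/-- A positive solution which stays below the range of validity of `f s ≥ c * s ^ (q + 1)` yields,
after the backward reaction flow, a supersolution of the linear equation. -/
theorem IsShearSol.powerFlow_supersolution (hT : IsShearSol m h M A u f T0 T) {q c t₀ t : ℝ}
    (hq : 0 < q) (hc : 0 < c) (hM : 0 < M) (ht₀ : 0 < t₀) (ht : t₀ < t) (hpos : ∀ z, 0 < T t z)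
    (hf : ∀ z, c * T t z ^ (q + 1) ≤ f (T t z)) (z : Fin (m + 1) → ℝ) :
    DifferentiableAt ℝ (fun s => powerFlow q (q * c * M) (T s z) (s - t₀)) t ∧
    ContDiff ℝ 2 (fun z => powerFlow q (q * c * M) (T t z) (t - t₀)) ∧
    lap (fun z => powerFlow q (q * c * M) (T t z) (t - t₀)) z
      ≤ deriv (fun s => powerFlow q (q * c * M) (T s z) (s - t₀)) t
        + A * u (fun j => z j.succ) * pd 0 (fun z => powerFlow q (q * c * M) (T t z) (t - t₀)) z := by
  obtain ⟨κ, hκdef⟩ : ∃ κ, κ = q * c * M := ⟨_, rfl⟩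
  rw [← hκdef]
  have hκ : 0 < κ := by rw [hκdef]; positivity
  have ht0 : 0 < t := ht₀.trans ht
  have hτ : 0 ≤ t - t₀ := by linarith
  have hd := hasPartials_powerFlow hq hκ (hT.timeDiff t z ht0).hasDerivAt
    ((hasDerivAt_id t).sub_const t₀) ⟨hpos z, hτ⟩
  simp only [id] at hd
  have hTC := hT.spaceC2 t ht0
  have hC : ContDiff ℝ 2 (fun z => powerFlow q κ (T t z) (t - t₀)) := by
    unfold powerFlow
    exact ((hTC.rpow_const_of_ne fun z => (hpos z).ne').add contDiff_const).rpow_const_of_ne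
      fun z => (powerFlow_base_pos hκ (hpos z) hτ).ne'
  refine ⟨hd.differentiableAt, hC, ?_⟩
  have hP : HasPartials (fun s _ => 0 < s) (fun s _ => powerFlow q κ s (t - t₀))
      (fun s _ => (s ^ (-q) + κ * (t - t₀)) ^ (-(1 / q) - 1) * s ^ (-q - 1)) (fun _ _ => 0) := by
    intro s x s' x' r hs _ h0
    have := hasPartials_powerFlow hq hκ hs (hasDerivAt_const r (t - t₀)) ⟨h0, hτ⟩
    simpa using this
  have hP0 : HasPartials (fun s _ => 0 < s) (fun _ _ => 0) (fun _ _ => 0) (fun _ _ => 0) := by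
    intro s x s' x' r _ _ _
    simpa using hasDerivAt_const r (0 : ℝ)
  rw [hd.deriv, hP.pd_comp (X := fun _ => 0) 0 (hTC.differentiable two_ne_zero z) (by fun_prop)
    (hpos z) (hC.differentiable two_ne_zero z),
    hP.lap_comp (hasPartials_powerFlow_fst hq hκ hτ) hP0 (X := fun _ => 0) hTC contDiff_const hpos hC]
  have hω := powerFlow_base_pos (q := q) hκ (hpos z) hτ
  have heq := hT.eqn t z ht0
  have hs : T t z ^ (-q - 1) * T t z ^ (q + 1) = 1 := by
    rw [← Real.rpow_add (hpos z), show -q - 1 + (q + 1) = 0 by ring, Real.rpow_zero]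
  have hκq : κ / q = c * M := by rw [hκdef]; field_simp
  have h1 : 0 < (T t z ^ (-q) + κ * (t - t₀)) ^ (-(1 / q) - 1) := Real.rpow_pos_of_pos hω _
  have h2 : 0 ≤ (q + 1) * (κ * (t - t₀)) * ((T t z ^ (-q) + κ * (t - t₀)) ^ (-(1 / q) - 1 - 1)
      * T t z ^ (-q - 1 - 1)) * ∑ i, pd i (T t) z ^ 2 :=
    mul_nonneg (mul_nonneg (by positivity) (mul_nonneg (Real.rpow_nonneg hω.le _)
      (Real.rpow_nonneg (hpos z).le _))) (Finset.sum_nonneg fun i _ => sq_nonneg _)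
  have h3 : 0 < T t z ^ (-q - 1) := Real.rpow_pos_of_pos (hpos z) _
  have h4 := mul_le_mul_of_nonneg_left (hf z) (mul_nonneg (mul_nonneg h1.le h3.le) hM.le)
  have h5 : (T t z ^ (-q) + κ * (t - t₀)) ^ (-(1 / q) - 1) * T t z ^ (-q - 1) * M
      * (c * T t z ^ (q + 1)) = (T t z ^ (-q) + κ * (t - t₀)) ^ (-(1 / q) - 1) * (c * M) := by
    linear_combination ((T t z ^ (-q) + κ * (t - t₀)) ^ (-(1 / q) - 1) * M * c) * hs
  rw [h5] at h4
  rw [hκq, show deriv (fun s => T s z) t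
    = lap (T t) z + M * f (T t z) - A * u (fun j => z j.succ) * pd 0 (T t) z by linarith]
  nlinarith

set_option maxHeartbeats 1000000 in
/-- A nontrivial solution with reaction stronger than cubic never quenches. -/
theorem IsShearSol.not_cylQuenches (hT : IsShearSol m h M A u f T0 T) (hh : 0 < h) (hM : 0 < M)
    (hf : ∀ s ∈ Set.Icc (0 : ℝ) 1, 0 ≤ f s) {c θ p : ℝ} (hc : 0 < c) (hθ : 0 < θ) (hp : p < 3)
    (hfp : ∀ s ∈ Set.Icc (0 : ℝ) θ, c * s ^ p ≤ f s) (hu : ContDiff ℝ 1 u)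
    (hper : IsCellPeriodic h u) (h0 : ∃ z, T0 z ≠ 0) : ¬ CylQuenches m T := by
  intro hquench
  have hpos : ∀ {t}, 0 < t → ∀ z, 0 < T t z := fun ht z => hT.pos hh hM hf hu.continuous hper h0 ht z
  obtain ⟨q, hpq, hq1, hq2⟩ : ∃ q, p ≤ q + 1 ∧ 1 < q ∧ q < 2 := by
    refine ⟨max p (5 / 2) - 1, by linarith [le_max_left p (5 / 2)],
      by linarith [le_max_right p (5 / 2)], ?_⟩
    have : max p (5 / 2) < 3 := max_lt hp (by norm_num)
    linarith
  have hq : 0 < q := by linarith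
  obtain ⟨α, hα, hαq⟩ : ∃ α, 1 / 2 < α ∧ α < 1 / q :=
    exists_between (one_div_lt_one_div_of_lt hq hq2)
  obtain ⟨κ, hκdef⟩ : ∃ κ, κ = q * c * M := ⟨_, rfl⟩
  have hκ : 0 < κ := by rw [hκdef]; positivity
  have hbper : IsCellPeriodic h fun y => A * u y := fun y j => by simp only [hper y j]
  have hbC : ContDiff ℝ 1 fun y => A * u y := contDiff_const.mul hu
  obtain ⟨β, -, hβ⟩ := hbper.exists_norm_le hh hbC.continuous
  obtain ⟨φ, t₁, τ, c₀, hc₀, hτ, hφcont, hφ⟩ := exists_shear_subsolution hh hbC hbper hα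
  obtain ⟨tθ, htθ⟩ := hquench θ hθ
  obtain ⟨t₂, h21, h2θ, h20⟩ : ∃ t₂, t₁ ≤ t₂ ∧ tθ ≤ t₂ ∧ 0 < t₂ :=
    ⟨max t₁ (max tθ 1), le_max_left _ _, (le_max_left _ _).trans (le_max_right _ _),
      zero_lt_one.trans_le ((le_max_right _ _).trans (le_max_right _ _))⟩
  obtain ⟨-, -, ⟨L, hL⟩, hφ2⟩ := hφ t₂ h21
  obtain ⟨ε, hε, hεT⟩ := hT.exists_lower_bound hh h20 (hpos h20) L
  have hcomp : ∀ t₃, t₂ < t₃ → ∀ z, ε * φ t₃ z ≤ powerFlow q κ (T t₃ z) (t₃ - t₂) := by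
    intro t₃ ht₃ z
    have hv0 : ∀ t ∈ Set.Icc t₂ t₃, ∀ z, 0 ≤ powerFlow q κ (T t z) (t - t₂) := fun t ht z =>
      Real.rpow_nonneg (powerFlow_base_pos hκ (hpos (h20.trans_le ht.1) z)
        (by linarith [ht.1])).le _
    have hsuper : ∀ t ∈ Set.Ioc t₂ t₃, ∀ z, _ := fun t ht z =>
      hT.powerFlow_supersolution hq hc hM h20 ht.1 (hpos (h20.trans ht.1)) (fun z => by
        have h1 := hpos (h20.trans ht.1) z
        refine le_trans (mul_le_mul_of_nonneg_left ?_ hc.le)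
          (hfp _ ⟨h1.le, htθ t (h2θ.trans ht.1.le) z⟩)
        exact Real.rpow_le_rpow_of_exponent_ge h1 (hT.mem_Icc t z (h20.trans ht.1).le).2 hpq) z
    rw [← hκdef] at hsuper
    have key := parabolic_max_principle (t₀ := t₂) (t₁ := t₃) (B := ε) (β := β)
      (b := fun z => A * u fun j => z j.succ)
      (w := fun t z => ε * φ t z + (-1) * powerFlow q κ (T t z) (t - t₂)) (fun z => hβ _) ?_
      (fun t ht z => ?_) (fun z => ?_) (fun t ht z => ?_) (fun t ht => ?_)
      (fun t ht z hw => ?_) t₃ ⟨ht₃.le, le_rfl⟩ z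
    · linarith
    · refine ((hφcont.mono fun p hp => ⟨h21.trans hp.1.1, trivial⟩).const_smul ε).add
        (ContinuousOn.const_smul ?_ (-1 : ℝ))
      have hTc : ContinuousOn (fun p : ℝ × (Fin (m + 1) → ℝ) => T p.1 p.2)
          (Set.Icc t₂ t₃ ×ˢ Set.univ) := hT.cont.mono fun p hp => h20.le.trans hp.1.1
      unfold powerFlow
      refine ContinuousOn.rpow_const ((hTc.rpow_const fun p hp =>
        Or.inl (hpos (h20.trans_le hp.1.1) _).ne').add (by fun_prop)) fun p hp =>
        Or.inl (powerFlow_base_pos hκ (hpos (h20.trans_le hp.1.1) _)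
          (sub_nonneg.2 hp.1.1)).ne'
    · have h1 := ((hφ t (h21.trans ht.1)).2.2.2 z).2.1
      have h2 := hv0 t ht z
      nlinarith
    · simp only [sub_self]
      rw [powerFlow_zero hq (hpos h20 z)]
      have h1 := (hφ2 z).2.1
      rcases le_or_gt (φ t₂ z) 0 with h2 | h2
      · nlinarith [hpos h20 z]
      · have h3 := hεT z (hL z h2)
        nlinarith
    · exact (((hφ t (h21.trans ht.1.le)).2.2.2 z).1.const_mul ε).add
        ((hsuper t ht z).1.const_mul (-1))
    · exact (contDiff_const.mul (hφ t (h21.trans ht.1.le)).1).add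
        (contDiff_const.mul (hsuper t ht 0).2.1)
    · obtain ⟨hφC, -, -, hφz⟩ := hφ t (h21.trans ht.1.le)
      obtain ⟨hφd, -, hφL⟩ := hφz z
      obtain ⟨hvd, hvC, hvL⟩ := hsuper t ht z
      have hφpos : 0 < φ t z := by
        have h2 := hv0 t ⟨ht.1.le, ht.2⟩ z
        exact (pos_iff_pos_of_mul_pos (by linarith : 0 < ε * φ t z)).1 hε
      have h1 : deriv (fun s => ε * φ s z + (-1) * powerFlow q κ (T s z) (s - t₂)) t
          = ε * deriv (fun s => φ s z) t
            + (-1) * deriv (fun s => powerFlow q κ (T s z) (s - t₂)) t :=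
        ((hφd.hasDerivAt.const_mul ε).add (hvd.hasDerivAt.const_mul (-1))).deriv
      rw [h1, pd_add 0 ((hφC.differentiable two_ne_zero z).const_mul ε)
        ((hvC.differentiable two_ne_zero z).const_mul (-1)),
        pd_const_mul 0 ε (hφC.differentiable two_ne_zero z),
        pd_const_mul 0 (-1) (hvC.differentiable two_ne_zero z),
        lap_add (contDiff_const.mul hφC) (contDiff_const.mul hvC), lap_const_mul _ hφC,
        lap_const_mul _ hvC]
      have h2 := mul_le_mul_of_nonneg_left (hφL hφpos) hε.le
      linarith
  obtain ⟨t, ht, hlt⟩ := exists_rpow_lt_rpow (κ := κ) (t₀ := t₂) (τ := τ) (by linarith) hαq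
    (mul_pos hε hc₀) hκ (by linarith)
  obtain ⟨-, ⟨z, hz⟩, -⟩ := hφ t (h21.trans ht.le)
  have h1 := hcomp t ht z
  have h2 := powerFlow_le hq hκ (hpos (h20.trans ht) z) (sub_pos.2 ht)
  have h3 := mul_le_mul_of_nonneg_left hz hε.le
  linarith

end NoQuenching

/-- If `f(T) ≥ c T^p` on `[0,θ]` with `p < 3`, then no shear profile `u`
is quenching; in fact for every amplitude `A` and every admissible initial datum `T₀ ≢ 0`,
no classical solution quenches. -/
theorem quenching_paper_stmt5
    (m : ℕ) (hm : 1 ≤ m) (h M : ℝ) (hh : 0 < h) (hM : 0 < M)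
    (f : ℝ → ℝ) (hf_lip : ∃ K, LipschitzOnWith K f (Set.Icc 0 1))
    (hf_nonneg : ∀ s ∈ Set.Icc (0:ℝ) 1, 0 ≤ f s)
    (hf0 : f 0 = 0) (hf1 : f 1 = 0)
    (c θ p : ℝ) (hc : 0 < c) (hθ : 0 < θ) (hp : p < 3)
    (hfp : ∀ s ∈ Set.Icc (0:ℝ) θ, c * s ^ p ≤ f s)
    (u : (Fin m → ℝ) → ℝ) (hu : ContDiff ℝ 1 u)
    (hu_per : ∀ y : Fin m → ℝ, ∀ j : Fin m, u (y + Pi.single j h) = u y) :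
    ¬ IsQuenchingProfile m h M u f ∧
      ∀ A : ℝ, ∀ T0 : (Fin (m+1) → ℝ) → ℝ, AdmissibleIC m h T0 → (∃ z, T0 z ≠ 0) →
        ∀ T : ℝ → (Fin (m+1) → ℝ) → ℝ,
          IsShearSol m h M A u f T0 T → ¬ CylQuenches m T := by
  have hmain : ∀ A : ℝ, ∀ T0 : (Fin (m+1) → ℝ) → ℝ, AdmissibleIC m h T0 → (∃ z, T0 z ≠ 0) →
      ∀ T : ℝ → (Fin (m+1) → ℝ) → ℝ,
        IsShearSol m h M A u f T0 T → ¬ CylQuenches m T := fun A T0 _ h0 T hT =>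
    hT.not_cylQuenches hh hM hf_nonneg hc hθ hp hfp hu hu_per h0
  refine ⟨fun hq => ?_, hmain⟩
  let ψ : ContDiffBump (0 : ℝ) := ⟨1, 2, one_pos, one_lt_two⟩
  have hψ : ∀ x, ψ x ∈ Set.Icc (0 : ℝ) 1 := fun x => ⟨ψ.nonneg, ψ.le_one⟩
  have hadm : AdmissibleIC m h fun z => ψ (z 0) := by
    refine ⟨fun z => hψ _, fun z j => ?_, 2, fun z hz => ψ.zero_of_le_dist ?_⟩
    · simp
    · simpa using hz
  have hne : ∃ z : Fin (m + 1) → ℝ, ψ (z 0) ≠ 0 := ⟨0, by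
    rw [ψ.one_of_mem_closedBall (by simp [ψ])]
    exact one_ne_zero⟩
  obtain ⟨A₀, hA₀⟩ := hq _ hadm
  obtain ⟨T, hT⟩ := exists_isShearSol M |A₀| hh hf_lip hf0 hf1 hu hu_per ψ.contDiff
    ψ.hasCompactSupport hψ
  exact hmain _ _ hadm hne T hT (hA₀ _ (by rw [abs_abs]; exact le_abs_self _) T hT)
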